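/- arXiv:2002.05363 — 6 statements merged into one kernel-verified Lean document; each statement's English description precedes it below -/
import Mathlib

section
/- For every finite graph G, there is a separation (A,B) of G such that χ(G[V(A) ∩ V(B)]) ≤ tree-χ(G), and both χ(A − V(B)) ≥ χ(G) − tree-χ(G) and χ(B − V(A)) ≥ χ(G) − tree-χ(G). -/
open SimpleGraph

/-- The chromatic number of a graph, as a natural number. -/
noncomputable def chromNat {V : Type} (G : SimpleGraph V) : ℕ :=
  sInf {k : ℕ | G.Colorable k}

/-- A tree-decomposition of a graph `G`: a tree `T` together with bags `B_t ⊆ V(G)`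
such that every edge of `G` lies in some bag and, for each vertex `v`, the set of
nodes whose bag contains `v` induces a non-empty subtree of `T`. -/
structure TreeDecomp {V : Type} (G : SimpleGraph V) : Type 1 where
  ι : Type
  fin : Finite ι
  T : SimpleGraph ι
  isTree : T.IsTree
  bag : ι → Set V
  covers : ∀ ⦃u v : V⦄, G.Adj u v → ∃ t, u ∈ bag t ∧ v ∈ bag t
  conn : ∀ v : V, (T.induce {t | v ∈ bag t}).Connected

/-- The chromatic number of a tree-decomposition: the maximum over bags of the
chromatic number of the induced subgraph. -/
noncomputable def TreeDecomp.chrom {V : Type} {G : SimpleGraph V} (D : TreeDecomp G) : ℕ :=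
  sSup {m : ℕ | ∃ t, chromNat (G.induce (D.bag t)) = m}

/-- The tree-chromatic number of `G`. -/
noncomputable def treeChi {V : Type} (G : SimpleGraph V) : ℕ :=
  sInf {m : ℕ | ∃ D : TreeDecomp G, D.chrom = m}


section Chromatic

variable {V W : Type}

lemma colorable_chromNat [Finite V] (G : SimpleGraph V) : G.Colorable (chromNat G) := by
  cases nonempty_fintype V
  exact Nat.sInf_mem (s := {k : ℕ | G.Colorable k}) ⟨_, G.colorable_of_fintype⟩

lemma chromNat_le_of_colorable {G : SimpleGraph V} {n : ℕ} (h : G.Colorable n) :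
    chromNat G ≤ n :=
  Nat.sInf_le h

lemma chromNat_le_of_hom [Finite W] {G : SimpleGraph V} {H : SimpleGraph W} (f : G →g H) :
    chromNat G ≤ chromNat H :=
  chromNat_le_of_colorable ((colorable_chromNat H).of_hom f)

lemma chromNat_induce_mono [Finite V] (G : SimpleGraph V) {X Y : Set V} (h : X ⊆ Y) :
    chromNat (G.induce X) ≤ chromNat (G.induce Y) :=
  chromNat_le_of_hom (induceHomOfLE G h).toHom

lemma chromNat_le_add_compl [Finite V] (G : SimpleGraph V) (X : Set V) :
    chromNat G ≤ chromNat (G.induce X) + chromNat (G.induce Xᶜ) := by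
  classical
  obtain ⟨c⟩ := colorable_chromNat (G.induce X)
  obtain ⟨d⟩ := colorable_chromNat (G.induce Xᶜ)
  let f : G.Coloring (Fin (chromNat (G.induce X)) ⊕ Fin (chromNat (G.induce Xᶜ))) :=
    Coloring.mk (fun v => if h : v ∈ X then .inl (c ⟨v, h⟩) else .inr (d ⟨v, h⟩)) (by
      intro u v huv
      by_cases hu : u ∈ X <;> by_cases hv : v ∈ X
      · simpa [hu, hv] using c.valid (v := ⟨u, hu⟩) (w := ⟨v, hv⟩) huv
      · simp [hu, hv]
      · simp [hu, hv]
      · simpa [hu, hv] using d.valid (v := ⟨u, hu⟩) (w := ⟨v, hv⟩) huv)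
  exact chromNat_le_of_colorable (by simpa using f.colorable)

end Chromatic

section Separation

variable {V : Type} {G : SimpleGraph V}

lemma exists_separation_of_cover {X Y : Set V} (hV : ∀ v, v ∈ X ∨ v ∈ Y)
    (hE : ∀ ⦃u v⦄, G.Adj u v → (u ∈ X ∧ v ∈ X) ∨ (u ∈ Y ∧ v ∈ Y)) :
    ∃ A B : G.Subgraph, A.verts = X ∧ B.verts = Y ∧ A ⊔ B = ⊤ ∧
      Disjoint A.edgeSet B.edgeSet := by
  let A : G.Subgraph :=
    { verts := X
      Adj := fun u v => G.Adj u v ∧ u ∈ X ∧ v ∈ X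
      adj_sub := fun h => h.1
      edge_vert := fun h => h.2.1
      symm := ⟨fun _ _ h => ⟨h.1.symm, h.2.2, h.2.1⟩⟩ }
  let B : G.Subgraph :=
    { verts := Y
      Adj := fun u v => G.Adj u v ∧ (u ∈ Y ∧ v ∈ Y) ∧ ¬(u ∈ X ∧ v ∈ X)
      adj_sub := fun h => h.1
      edge_vert := fun h => h.2.1.1
      symm := ⟨fun _ _ h => ⟨h.1.symm, h.2.1.symm, fun h' => h.2.2 h'.symm⟩⟩ }
  refine ⟨A, B, rfl, rfl, ?_, ?_⟩
  · ext u v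
    · simpa [A, B] using hV u
    · have := @hE u v
      simp only [Subgraph.sup_adj, Subgraph.top_adj, A, B]
      tauto
  · rw [Set.disjoint_left]
    intro e
    induction e with
    | h u v =>
      simp only [Subgraph.mem_edgeSet, A, B]
      tauto

lemma chromNat_induce_diff_le [Finite V] {A B : G.Subgraph} (h : A ⊔ B = ⊤) :
    chromNat (G.induce (A.verts \ B.verts)) ≤ chromNat (A.deleteVerts B.verts).coe := by
  refine chromNat_le_of_hom ⟨fun v => ⟨v.1, v.2⟩, ?_⟩
  rintro ⟨u, hu⟩ ⟨v, hv⟩ huv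
  have hadj : (A ⊔ B).Adj u v := by
    rw [h]
    exact huv
  have hA : A.Adj u v := hadj.resolve_right fun hB => hu.2 hB.fst_mem
  exact Subgraph.deleteVerts_adj.2 ⟨hu.1, hu.2, hv.1, hv.2, hA⟩

end Separation

section TreeSide

variable {ι : Type} {T : SimpleGraph ι} {r s s' t x y : ι} {W : Set ι}

/-- The nodes joined to `s` once the edge between `s` and `t` is deleted. -/
def treeSide (T : SimpleGraph ι) (s t : ι) : Set ι :=
  {r | (T.deleteEdges {s(s, t)}).Reachable s r}

lemma self_mem_treeSide : s ∈ treeSide T s t :=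
  Reachable.refl s

lemma eq_and_eq_of_adj_treeSide (hxy : T.Adj x y) (hx : x ∈ treeSide T s t)
    (hy : y ∉ treeSide T s t) : x = s ∧ y = t := by
  by_cases he : s(x, y) = s(s, t)
  · rcases Sym2.eq_iff.1 he with h | ⟨rfl, rfl⟩
    · exact h
    · exact (hy self_mem_treeSide).elim
  · refine (hy (Reachable.trans hx (Adj.reachable ?_))).elim
    simpa [deleteEdges_adj] using ⟨hxy, by simpa using he⟩

lemma not_mem_treeSide (hT : T.IsAcyclic) (hst : T.Adj s t) : t ∉ treeSide T s t :=
  isBridge_iff.1 (isAcyclic_iff_forall_adj_isBridge.1 hT hst)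

lemma mem_treeSide_or_mem_treeSide (hT : T.Connected) (s t r : ι) :
    r ∈ treeSide T s t ∨ r ∈ treeSide T t s := by
  by_contra! h
  obtain ⟨p⟩ := hT.preconnected s r
  obtain ⟨d, -, hd, hd'⟩ := p.exists_boundary_dart (treeSide T s t ∪ treeSide T t s)
    (Or.inl self_mem_treeSide) (by simpa using h)
  rw [Set.mem_union, not_or] at hd'
  rcases hd with hd | hd
  · have := (eq_and_eq_of_adj_treeSide d.adj hd hd'.1).2
    exact hd'.2 (this ▸ self_mem_treeSide)
  · have := (eq_and_eq_of_adj_treeSide d.adj hd hd'.2).2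
    exact hd'.1 (this ▸ self_mem_treeSide)

lemma disjoint_treeSide (hT : T.IsAcyclic) (hst : T.Adj s t) :
    Disjoint (treeSide T s t) (treeSide T t s) := by
  rw [Set.disjoint_left]
  intro r hs ht
  refine not_mem_treeSide hT hst (Reachable.trans hs (Reachable.symm ?_))
  simpa [treeSide, Sym2.eq_swap] using ht

lemma mem_and_mem_of_not_subset_treeSide (hW : (T.induce W).Connected) (hr : r ∈ W)
    (hrs : r ∈ treeSide T s t) (h : ¬W ⊆ treeSide T s t) : s ∈ W ∧ t ∈ W := by
  obtain ⟨q, hq, hqs⟩ := Set.not_subset.1 h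
  obtain ⟨p⟩ := hW.preconnected ⟨r, hr⟩ ⟨q, hq⟩
  obtain ⟨d, -, hd, hd'⟩ := p.exists_boundary_dart {v | v.1 ∈ treeSide T s t} hrs hqs
  obtain ⟨h₁, h₂⟩ := eq_and_eq_of_adj_treeSide (induce_adj.1 d.adj) hd hd'
  exact ⟨h₁ ▸ d.fst.2, h₂ ▸ d.snd.2⟩

lemma eq_of_mem_treeSide (hT : T.IsAcyclic) (hs : T.Adj s t) (hs' : T.Adj s' t)
    (h : r ∈ treeSide T s t) (h' : r ∈ treeSide T s' t) : s = s' := by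
  by_contra hne
  have hs't : s' ∉ treeSide T s t := fun hmem =>
    hne (eq_and_eq_of_adj_treeSide hs' hmem (not_mem_treeSide hT hs)).1.symm
  obtain ⟨p⟩ := Reachable.symm h'
  obtain ⟨d, -, hd, hd'⟩ := p.exists_boundary_dart (treeSide T s t ∩ treeSide T s' t)
    ⟨h, h'⟩ (fun hmem => hs't hmem.1)
  have hsnd : d.snd ∈ treeSide T s' t := Reachable.trans hd.2 d.adj.reachable
  have ht := (eq_and_eq_of_adj_treeSide (deleteEdges_le _ d.adj) hd.1
    (fun hmem => hd' ⟨hmem, hsnd⟩)).2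
  rw [ht] at hsnd
  exact not_mem_treeSide hT hs' hsnd

lemma exists_adj_mem_treeSide (hT : T.Connected) (hr : r ≠ t) :
    ∃ s, T.Adj s t ∧ r ∈ treeSide T s t := by
  obtain ⟨p, hp⟩ := (hT.preconnected t r).exists_isPath
  cases p with
  | nil => exact (hr rfl).elim
  | cons h q =>
    refine ⟨_, h.symm, ⟨q.toDeleteEdges _ ?_⟩⟩
    rintro e he rfl
    exact ((Walk.cons_isPath_iff h q).1 hp).2 (q.snd_mem_support_of_mem_edges he)

lemma exists_adj_apply_eq_of_isTree [Finite ι] (hT : T.IsTree) (f : ι → ι)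
    (hf : ∀ t, T.Adj (f t) t) : ∃ s t, T.Adj s t ∧ f t = s ∧ f s = t := by
  classical
  cases nonempty_fintype ι
  have hcard : Fintype.card T.edgeSet < Fintype.card ι := by
    have := hT.card_edgeFinset
    rw [edgeFinset_card] at this
    omega
  obtain ⟨a, b, hne, hab⟩ := Fintype.exists_ne_map_eq_of_card_lt
    (fun t => (⟨s(f t, t), hf t⟩ : T.edgeSet)) hcard
  rcases Sym2.eq_iff.1 (congrArg Subtype.val hab) with h | h
  · exact (hne h.2).elim
  · exact ⟨b, a, h.1 ▸ hf a, h.1, h.2.symm⟩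

end TreeSide

namespace TreeDecomp

variable {V : Type} {G : SimpleGraph V}

lemma chromNat_bag_le_chrom (D : TreeDecomp G) (t : D.ι) :
    chromNat (G.induce (D.bag t)) ≤ D.chrom := by
  have := D.fin
  exact le_csSup (Set.finite_range fun t => chromNat (G.induce (D.bag t))).bddAbove ⟨t, rfl⟩

/-- The tree-decomposition whose only bag contains every vertex. -/
def trivial (G : SimpleGraph V) : TreeDecomp G where
  ι := Unit
  fin := inferInstance
  T := ⊥
  isTree := IsTree.of_subsingleton
  bag _ := Set.univ
  covers _ _ _ := ⟨(), Set.mem_univ _, Set.mem_univ _⟩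
  conn _ :=
    { preconnected := fun a b => by
        rw [Subsingleton.elim a b]
      nonempty := ⟨⟨(), Set.mem_univ _⟩⟩ }

lemma exists_chrom_eq_treeChi (G : SimpleGraph V) : ∃ D : TreeDecomp G, D.chrom = treeChi G :=
  Nat.sInf_mem (s := {m : ℕ | ∃ D : TreeDecomp G, D.chrom = m}) ⟨_, trivial G, rfl⟩

/-- The vertices all of whose bags lie on the side of `s` of the edge between `s` and `t`. -/
def vertexSide (D : TreeDecomp G) (s t : D.ι) : Set V :=
  {v | {r | v ∈ D.bag r} ⊆ treeSide D.T s t}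

lemma exists_mem_bag (D : TreeDecomp G) (v : V) : ∃ r, v ∈ D.bag r :=
  let ⟨r⟩ := (D.conn v).nonempty
  ⟨r.1, r.2⟩

lemma mem_vertexSide (D : TreeDecomp G) {v : V} {r s t : D.ι} (hv : v ∉ D.bag t)
    (hr : v ∈ D.bag r) (hrs : r ∈ treeSide D.T s t) : v ∈ D.vertexSide s t := by
  by_contra h
  exact hv (mem_and_mem_of_not_subset_treeSide (D.conn v) hr hrs h).2

lemma exists_le_chromNat_vertexSide [Finite V] (D : TreeDecomp G) (hD : D.chrom < chromNat G)
    (t : D.ι) :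
    ∃ s, D.T.Adj s t ∧ chromNat G - D.chrom ≤ chromNat (G.induce (D.vertexSide s t)) := by
  classical
  by_contra! hsmall
  obtain ⟨m, hm⟩ := Nat.exists_eq_add_of_lt hD
  have hcol : ∀ s, D.T.Adj s t → (G.induce (D.vertexSide s t)).Colorable m := fun s hs =>
    (colorable_chromNat _).mono (by have := hsmall s hs; omega)
  have hside : ∀ v : ↥(D.bag t)ᶜ, ∃ s, D.T.Adj s t ∧ v.1 ∈ D.vertexSide s t := by
    rintro ⟨v, hv⟩
    obtain ⟨r, hr⟩ := D.exists_mem_bag v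
    obtain ⟨s, hs, hrs⟩ := exists_adj_mem_treeSide D.isTree.connected
      (show r ≠ t from fun h => hv (h ▸ hr))
    exact ⟨s, hs, D.mem_vertexSide hv hr hrs⟩
  choose n hadj hn using hside
  let c := fun s hs => (hcol s hs).some
  have hcompl : (G.induce (D.bag t)ᶜ).Colorable m := by
    refine ⟨Coloring.mk (fun v => c (n v) (hadj v) ⟨v, hn v⟩) ?_⟩
    intro u v huv
    obtain ⟨r, hur, hvr⟩ := D.covers (induce_adj.1 huv)
    have heq : n u = n v := eq_of_mem_treeSide D.isTree.isAcyclic (hadj u) (hadj v)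
      (hn u hur) (hn v hvr)
    have key : ∀ (s : D.ι) (hs : D.T.Adj s t) (hvs : v.1 ∈ D.vertexSide s t), n u = s →
        c (n u) (hadj u) ⟨u, hn u⟩ ≠ c s hs ⟨v, hvs⟩ := by
      rintro s hs hvs rfl
      exact (c (n u) hs).valid huv
    exact key (n v) (hadj v) (hn v) heq
  have h₁ := chromNat_le_add_compl G (D.bag t)
  have h₂ := D.chromNat_bag_le_chrom t
  have h₃ := chromNat_le_of_colorable hcompl
  omega

/-- The union of the bags on the side of `s` of the edge between `s` and `t`. -/
def bagSide (D : TreeDecomp G) (s t : D.ι) : Set V :=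
  {v | ∃ r ∈ treeSide D.T s t, v ∈ D.bag r}

lemma bagSide_cover (D : TreeDecomp G) (s t : D.ι) (v : V) :
    v ∈ D.bagSide s t ∨ v ∈ D.bagSide t s := by
  obtain ⟨r, hr⟩ := D.exists_mem_bag v
  exact (mem_treeSide_or_mem_treeSide D.isTree.connected s t r).imp
    (fun h => ⟨r, h, hr⟩) (fun h => ⟨r, h, hr⟩)

lemma bagSide_cover_adj (D : TreeDecomp G) (s t : D.ι) ⦃u v : V⦄ (huv : G.Adj u v) :
    (u ∈ D.bagSide s t ∧ v ∈ D.bagSide s t) ∨ (u ∈ D.bagSide t s ∧ v ∈ D.bagSide t s) := by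
  obtain ⟨r, hu, hv⟩ := D.covers huv
  exact (mem_treeSide_or_mem_treeSide D.isTree.connected s t r).imp
    (fun h => ⟨⟨r, h, hu⟩, ⟨r, h, hv⟩⟩) (fun h => ⟨⟨r, h, hu⟩, ⟨r, h, hv⟩⟩)

lemma bagSide_inter_subset (D : TreeDecomp G) {s t : D.ι} (hst : D.T.Adj s t) :
    D.bagSide s t ∩ D.bagSide t s ⊆ D.bag s := by
  rintro v ⟨⟨r, hr, hvr⟩, q, hq, hvq⟩
  refine (mem_and_mem_of_not_subset_treeSide (D.conn v) hvr hr fun h => ?_).1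
  exact Set.disjoint_left.1 (disjoint_treeSide D.isTree.isAcyclic hst) (h hvq) hq

lemma vertexSide_subset_diff (D : TreeDecomp G) {s t : D.ι} (hst : D.T.Adj s t) :
    D.vertexSide s t ⊆ D.bagSide s t \ D.bagSide t s := by
  intro v hv
  obtain ⟨r, hr⟩ := D.exists_mem_bag v
  refine ⟨⟨r, hv hr, hr⟩, ?_⟩
  rintro ⟨q, hq, hvq⟩
  exact Set.disjoint_left.1 (disjoint_treeSide D.isTree.isAcyclic hst) (hv hvq) hq

end TreeDecomp

/-- For every finite graph `G` there is a separation `(A, B)` of `G`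
(a pair of edge-disjoint subgraphs whose union is `G`) such that
`χ(G[V(A) ∩ V(B)]) ≤ tree-χ(G)` and both `χ(A − V(B))` and `χ(B − V(A))` are at least
`χ(G) − tree-χ(G)`. -/
theorem stmt0 {V : Type} [Fintype V] (G : SimpleGraph V) :
    ∃ A B : G.Subgraph, A ⊔ B = ⊤ ∧ Disjoint A.edgeSet B.edgeSet ∧
      chromNat (G.induce (A.verts ∩ B.verts)) ≤ treeChi G ∧
      chromNat G - treeChi G ≤ chromNat (A.deleteVerts B.verts).coe ∧
      chromNat G - treeChi G ≤ chromNat (B.deleteVerts A.verts).coe := by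
  obtain ⟨D, hD⟩ := TreeDecomp.exists_chrom_eq_treeChi G
  rw [← hD]
  rcases le_or_gt (chromNat G) D.chrom with hle | hlt
  · obtain ⟨A, B, hA, hB, hsup, hdisj⟩ := exists_separation_of_cover (G := G)
      (X := Set.univ) (Y := ∅) (by simp) (by simp)
    refine ⟨A, B, hsup, hdisj, ?_, by omega, by omega⟩
    rw [hA, hB, Set.inter_empty]
    exact (chromNat_le_of_colorable (Colorable.of_isEmpty 0)).trans (Nat.zero_le _)
  · have := D.fin
    choose f hadj hf using D.exists_le_chromNat_vertexSide hlt
    obtain ⟨s, t, hst, hft, hfs⟩ := exists_adj_apply_eq_of_isTree D.isTree f hadj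
    obtain ⟨A, B, hA, hB, hsup, hdisj⟩ :=
      exists_separation_of_cover (D.bagSide_cover s t) (D.bagSide_cover_adj s t)
    refine ⟨A, B, hsup, hdisj, ?_, ?_, ?_⟩
    · rw [hA, hB]
      exact (chromNat_induce_mono G (D.bagSide_inter_subset hst)).trans
        (D.chromNat_bag_le_chrom s)
    · refine le_trans ?_ (chromNat_induce_diff_le hsup)
      rw [hA, hB]
      exact (hft ▸ hf t).trans (chromNat_induce_mono G (D.vertexSide_subset_diff hst))
    · refine le_trans ?_ (chromNat_induce_diff_le (sup_comm A B ▸ hsup))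
      rw [hA, hB]
      exact (hfs ▸ hf s).trans (chromNat_induce_mono G (D.vertexSide_subset_diff hst.symm))
end

section
/- For each integer n ≥ 2, there exists a finite graph H with tree-chromatic number exactly 2 and path-chromatic number exactly n. -/
open SimpleGraph

/-- A path-decomposition of a graph `G`: a tree-decomposition whose underlying tree
is a path. -/
structure PathDecomp {V : Type} (G : SimpleGraph V) : Type where
  n : ℕ
  npos : 0 < n
  bag : Fin n → Set V
  covers : ∀ ⦃u v : V⦄, G.Adj u v → ∃ t, u ∈ bag t ∧ v ∈ bag t
  conn : ∀ v : V, ((pathGraph n).induce {t | v ∈ bag t}).Connected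

/-- The chromatic number of a path-decomposition. -/
noncomputable def PathDecomp.chrom {V : Type} {G : SimpleGraph V} (D : PathDecomp G) : ℕ :=
  sSup {m : ℕ | ∃ t, chromNat (G.induce (D.bag t)) = m}

/-- The path-chromatic number of `G`. -/
noncomputable def pathChi {V : Type} (G : SimpleGraph V) : ℕ :=
  sInf {m : ℕ | ∃ D : PathDecomp G, D.chrom = m}

/-! ### Rooted trees given by a parent function -/

section ParentTree

variable {ι : Type}

/-- The graph joining every node to its parent. -/
def parentGraph (p : ι → ι) : SimpleGraph ι := SimpleGraph.fromRel fun x y => p x = y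

theorem parentGraph_induce_connected (p : ι → ι) (depth : ι → ℕ) (A : Set ι) (top : ι)
    (htop : top ∈ A) (hA : ∀ x ∈ A, x ≠ top → p x ∈ A ∧ depth (p x) < depth x) :
    ((parentGraph p).induce A).Connected := by
  have key : ∀ d, ∀ x (hx : x ∈ A), depth x = d →
      ((parentGraph p).induce A).Reachable ⟨x, hx⟩ ⟨top, htop⟩ := by
    intro d
    induction d using Nat.strong_induction_on with
    | _ d ih =>
      intro x hx hd
      by_cases hxt : x = top
      · subst hxt; exact Reachable.refl _
      · obtain ⟨hpx, hlt⟩ := hA x hx hxt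
        have hadj : ((parentGraph p).induce A).Adj ⟨x, hx⟩ ⟨p x, hpx⟩ := by
          simp only [comap_adj, Function.Embedding.subtype_apply, parentGraph, fromRel_adj]
          exact ⟨fun h => by rw [← h] at hlt; omega, Or.inl trivial⟩
        exact hadj.reachable.trans (ih _ (hd ▸ hlt) _ hpx rfl)
  exact (connected_iff_exists_forall_reachable _).2
    ⟨⟨top, htop⟩, fun x => (key _ x.1 x.2 rfl).symm⟩

theorem parentGraph_connected (p : ι → ι) (depth : ι → ℕ) (root : ι)
    (h : ∀ x, x ≠ root → depth (p x) < depth x) : (parentGraph p).Connected := by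
  have := parentGraph_induce_connected p depth Set.univ root trivial
    fun x _ hx => ⟨trivial, h x hx⟩
  exact (induceUnivIso _).connected_iff.1 this

theorem parentGraph_isTree [Finite ι] (p : ι → ι) (depth : ι → ℕ) (root : ι)
    (hroot : p root = root) (h : ∀ x, x ≠ root → depth (p x) < depth x) :
    (parentGraph p).IsTree := by
  classical
  have := Fintype.ofFinite ι
  have hne : ∀ x, x ≠ root → x ≠ p x := fun x hx hp => by
    have := h x hx
    rw [← hp] at this; omega
  rw [isTree_iff_connected_and_card]
  refine ⟨parentGraph_connected p depth root h, ?_⟩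
  let f : {x : ι // x ≠ root} → (parentGraph p).edgeSet := fun x =>
    ⟨s(x.1, p x.1), by
      rw [mem_edgeSet, parentGraph, fromRel_adj]
      exact ⟨hne x.1 x.2, Or.inl rfl⟩⟩
  have hf : Function.Bijective f := by
    constructor
    · rintro ⟨x, hx⟩ ⟨y, hy⟩ hxy
      have hs : s(x, p x) = s(y, p y) := congrArg Subtype.val hxy
      rw [Sym2.eq_iff] at hs
      rcases hs with hs | ⟨h1, h2⟩
      · exact Subtype.ext hs.1
      · have a := h x hx
        have b := h y hy
        rw [h2] at a
        rw [← h1] at b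
        omega
    · rintro ⟨e, he⟩
      induction e using Sym2.ind with
      | _ x y =>
        have hxy := he
        rw [mem_edgeSet, parentGraph, fromRel_adj] at hxy
        obtain ⟨hn, rfl | rfl⟩ := hxy
        · exact ⟨⟨x, fun hx => hn (by rw [hx, hroot])⟩, rfl⟩
        · exact ⟨⟨y, fun hy => hn (by rw [hy, hroot])⟩, Subtype.ext Sym2.eq_swap⟩
  have hpos : 0 < Fintype.card ι := Fintype.card_pos_iff.2 ⟨root⟩
  rw [← Nat.card_congr (Equiv.ofBijective f hf), Nat.card_eq_fintype_card,
    Nat.card_eq_fintype_card, Fintype.card_subtype_compl, Fintype.card_subtype_eq]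
  omega

end ParentTree

/-! ### Colourings -/

section Colouring

variable {V : Type}

theorem chromNat_le_iff [Finite V] (G : SimpleGraph V) (k : ℕ) :
    chromNat G ≤ k ↔ G.Colorable k := by
  have := Fintype.ofFinite V
  refine ⟨fun h => ?_, fun h => Nat.sInf_le h⟩
  have hm : G.Colorable (sInf {k : ℕ | G.Colorable k}) :=
    Nat.sInf_mem (s := {k : ℕ | G.Colorable k}) ⟨_, G.colorable_of_fintype⟩
  exact hm.mono h

theorem sSup_values_le_iff {ι : Type} [Finite ι] (f : ι → ℕ) (k : ℕ) :
    sSup {m : ℕ | ∃ t, f t = m} ≤ k ↔ ∀ t, f t ≤ k := by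
  refine ⟨fun h t => (le_csSup (Set.finite_range f).bddAbove ⟨t, rfl⟩).trans h, fun h => ?_⟩
  apply csSup_le'
  rintro _ ⟨t, rfl⟩
  exact h t

theorem TreeDecomp.chrom_le_iff [Finite V] {G : SimpleGraph V} (D : TreeDecomp G) (k : ℕ) :
    D.chrom ≤ k ↔ ∀ t, (G.induce (D.bag t)).Colorable k := by
  have := D.fin
  simp only [TreeDecomp.chrom, sSup_values_le_iff fun t => chromNat (G.induce (D.bag t)),
    chromNat_le_iff]

theorem PathDecomp.chrom_le_iff [Finite V] {G : SimpleGraph V} (D : PathDecomp G) (k : ℕ) :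
    D.chrom ≤ k ↔ ∀ t, (G.induce (D.bag t)).Colorable k := by
  simp only [PathDecomp.chrom, sSup_values_le_iff fun t => chromNat (G.induce (D.bag t)),
    chromNat_le_iff]

/-- The path-decomposition with one bag. -/
def PathDecomp.trivial (G : SimpleGraph V) : PathDecomp G where
  n := 1
  npos := one_pos
  bag _ := Set.univ
  covers _ _ _ := ⟨0, ⟨⟩, ⟨⟩⟩
  conn _ := by
    refine (connected_iff_exists_forall_reachable _).2 ⟨⟨0, ⟨⟩⟩, fun x => ?_⟩
    rw [Subsingleton.elim x ⟨0, ⟨⟩⟩]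

theorem pathChi_le_iff [Finite V] (G : SimpleGraph V) (k : ℕ) :
    pathChi G ≤ k ↔ ∃ D : PathDecomp G, ∀ t, (G.induce (D.bag t)).Colorable k := by
  constructor
  · intro h
    obtain ⟨D, hD⟩ := Nat.sInf_mem (s := {m : ℕ | ∃ D : PathDecomp G, D.chrom = m})
      ⟨_, PathDecomp.trivial G, rfl⟩
    exact ⟨D, (D.chrom_le_iff k).1 (hD.trans_le h)⟩
  · rintro ⟨D, hD⟩
    have hle : pathChi G ≤ D.chrom := Nat.sInf_le ⟨D, rfl⟩
    exact hle.trans ((D.chrom_le_iff k).2 hD)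

theorem colorable_induce_mono {G : SimpleGraph V} {A B : Set V} {k : ℕ} (hAB : A ⊆ B)
    (h : (G.induce B).Colorable k) : (G.induce A).Colorable k :=
  h.of_hom (G.induceHomOfLE hAB).toHom

theorem colorable_induce_union {G : SimpleGraph V} {A B : Set V} {j k : ℕ}
    (hA : (G.induce A).Colorable j) (hB : (G.induce B).Colorable k) :
    (G.induce (A ∪ B)).Colorable (j + k) := by
  classical
  obtain ⟨c⟩ := hA
  obtain ⟨d⟩ := hB
  let e : (G.induce (A ∪ B)).Coloring (Fin j ⊕ Fin k) := Coloring.mk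
    (fun x => if h : x.1 ∈ A then Sum.inl (c ⟨x.1, h⟩)
      else Sum.inr (d ⟨x.1, x.2.resolve_left h⟩)) (by
    rintro ⟨x, hx⟩ ⟨y, hy⟩ hxy
    have hxy' : G.Adj x y := hxy
    by_cases h1 : x ∈ A <;> by_cases h2 : y ∈ A <;> simp only [h1, h2, dif_pos, dif_neg,
      not_false_eq_true, ne_eq, Sum.inl.injEq, Sum.inr.injEq, reduceCtorEq]
    · exact c.valid (v := ⟨x, h1⟩) (w := ⟨y, h2⟩) hxy'
    · exact d.valid (v := ⟨x, hx.resolve_left h1⟩) (w := ⟨y, hy.resolve_left h2⟩) hxy')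
  simpa using e.colorable

/-- A shift graph on more than `2 ^ q` points is not `q`-colourable. -/
theorem not_colorable_of_shift {G : SimpleGraph V} {X : Set V} {N q : ℕ} (hN : 2 ^ q < N)
    (f : Fin N → Fin N → V) (hX : ∀ i j, i < j → f i j ∈ X)
    (hadj : ∀ i j k, i < j → j < k → G.Adj (f i j) (f j k)) :
    ¬ (G.induce X).Colorable q := by
  rintro ⟨c⟩
  let F : Fin N → Set (Fin q) := fun i => {x | ∃ j, ∃ h : i < j, c ⟨f i j, hX i j h⟩ = x}
  have key : ∀ i j, i < j → F i ≠ F j := by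
    intro i j hij hF
    have hi : c ⟨f i j, hX i j hij⟩ ∈ F i := ⟨j, hij, rfl⟩
    rw [hF] at hi
    obtain ⟨k, hjk, he⟩ := hi
    exact c.valid (v := ⟨f i j, hX i j hij⟩) (w := ⟨f j k, hX j k hjk⟩)
      (hadj i j k hij hjk) he.symm
  have hinj : Function.Injective F := by
    intro i j h
    by_contra hne
    rcases lt_or_gt_of_ne hne with h' | h'
    · exact key i j h' h
    · exact key j i h' h.symm
  have := Fintype.card_le_of_injective F hinj
  simp at this
  omega

end Colouring

/-! ### Interval representations of path-decompositions -/

section Interval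

variable {V : Type}

theorem pathGraph_induce_convex {n : ℕ} {A : Set (Fin n)}
    (h : ((pathGraph n).induce A).Connected) {a b c : Fin n} (ha : a ∈ A) (hc : c ∈ A)
    (hab : a ≤ b) (hbc : b ≤ c) : b ∈ A := by
  by_contra hb
  have key : ∀ x y : A, ((pathGraph n).induce A).Walk x y → x.1 < b → y.1 < b := by
    intro x y w
    induction w with
    | nil => exact id
    | @cons x y z hxy _ ih =>
      intro hx
      refine ih ?_
      have hadj : (pathGraph n).Adj x.1 y.1 := hxy
      rw [pathGraph_adj] at hadj
      have hyb : y.1 ≠ b := fun e => hb (e ▸ y.2)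
      have : (y.1 : ℕ) ≠ b := fun e => hyb (Fin.ext e)
      rw [Fin.lt_def] at hx ⊢
      omega
  obtain ⟨w⟩ := h.preconnected ⟨a, ha⟩ ⟨c, hc⟩
  have hlt : a < b := lt_of_le_of_ne hab fun e => hb (e ▸ ha)
  exact absurd (key _ _ w hlt) (not_lt.2 hbc)

theorem PathDecomp.exists_endpoints {G : SimpleGraph V} (D : PathDecomp G) :
    ∃ l r : V → Fin D.n, ∀ v t, v ∈ D.bag t ↔ l v ≤ t ∧ t ≤ r v := by
  have h : ∀ v, ∃ a b : Fin D.n, ∀ t, v ∈ D.bag t ↔ a ≤ t ∧ t ≤ b := by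
    intro v
    have hne : ({t | v ∈ D.bag t} : Set (Fin D.n)).Nonempty :=
      Set.nonempty_coe_sort.1 (D.conn v).nonempty
    obtain ⟨a, ha, ha'⟩ := Set.exists_min_image _ id (Set.toFinite _) hne
    obtain ⟨b, hb, hb'⟩ := Set.exists_max_image _ id (Set.toFinite _) hne
    exact ⟨a, b, fun t => ⟨fun ht => ⟨ha' t ht, hb' t ht⟩,
      fun ht => pathGraph_induce_convex (D.conn v) ha hb ht.1 ht.2⟩⟩
  choose l r hlr using h
  exact ⟨l, r, hlr⟩

/-- If every point lies in intervals spanning a `k`-colourable graph only, then disjoint intervals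
can be chosen from any family of vertex sets of large chromatic number. -/
theorem exists_disjoint_representatives [Finite V] [Nonempty V] {Λ α : Type} [DecidableEq Λ]
    [LinearOrder α] {G : SimpleGraph V} {k : ℕ} (l r : V → α)
    (hcol : ∀ p, (G.induce {v | l v ≤ p ∧ p ≤ r v}).Colorable k) (s : Finset Λ) :
    ∀ A : Λ → Set V, (∀ x ∈ s, ¬ (G.induce (A x)).Colorable (k * s.card)) →
      ∃ u : Λ → V, (∀ x ∈ s, u x ∈ A x) ∧
        ∀ x ∈ s, ∀ y ∈ s, x ≠ y → r (u x) < l (u y) ∨ r (u y) < l (u x) := by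
  induction hc : s.card generalizing s with
  | zero =>
    intro A _
    rw [Finset.card_eq_zero] at hc
    subst hc
    exact ⟨fun _ => Classical.arbitrary V, by simp, by simp⟩
  | succ c ih =>
    intro A hA
    obtain ⟨x₀, hx₀⟩ : s.Nonempty := Finset.card_pos.1 (by omega)
    let U : Set V := {v | ∃ x ∈ s, v ∈ A x}
    have hU : U.Nonempty := by
      by_contra hne
      rw [Set.not_nonempty_iff_eq_empty] at hne
      apply hA x₀ hx₀
      have : IsEmpty (A x₀) := ⟨fun v => by
        have : v.1 ∈ U := ⟨x₀, hx₀, v.2⟩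
        rw [hne] at this
        exact this⟩
      exact Colorable.of_isEmpty _
    obtain ⟨v, ⟨x, hx, hvx⟩, hmin⟩ := Set.exists_min_image U r (Set.toFinite _) hU
    have hcard : (s.erase x).card = c := by rw [Finset.card_erase_of_mem hx, hc]; rfl
    obtain ⟨u, hu, hdis⟩ := ih (s.erase x) hcard (fun y => A y ∩ {w | r v < l w}) (by
      intro y hy hcoly
      have hys := Finset.mem_of_mem_erase hy
      refine hA y hys (colorable_induce_mono (fun w hw => ?_)
        (colorable_induce_union hcoly (hcol (r v))))
      by_cases hlt : r v < l w
      · exact Or.inl ⟨hw, hlt⟩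
      · exact Or.inr ⟨not_lt.1 hlt, hmin w ⟨y, hys, hw⟩⟩)
    refine ⟨Function.update u x v, fun y hy => ?_, fun y hy z hz hyz => ?_⟩
    · by_cases hyx : y = x
      · subst hyx; simpa using hvx
      · simpa [hyx] using (hu y (Finset.mem_erase.2 ⟨hyx, hy⟩)).1
    · by_cases hyx : y = x
      · subst hyx
        have hzy : z ≠ y := fun e => hyz e.symm
        simpa [hzy] using Or.inl (hu z (Finset.mem_erase.2 ⟨hzy, hz⟩)).2
      · by_cases hzx : z = x
        · subst hzx
          simpa [hyx] using Or.inr (hu y (Finset.mem_erase.2 ⟨hyx, hy⟩)).2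
        · simpa [hyx, hzx] using hdis y (Finset.mem_erase.2 ⟨hyx, hy⟩) z
            (Finset.mem_erase.2 ⟨hzx, hz⟩) hyz

end Interval

/-! ### The graph -/

section Construction

/-- The nodes of the complete ternary tree of depth `m`; the parent of a word is its tail. -/
abbrev TernaryNode (m : ℕ) : Type := {l : List (Fin 3) // l.length ≤ m}

/-- The vertex `(w, i, j)` stands for the pair `(i, j)` of the shift graph placed at `w`. -/
abbrev ShiftVertex (m N : ℕ) : Type := TernaryNode m × Fin N × Fin N

/-- The vertex `(a, b, g, h)` stands for the subtree that runs from `a` down to `b`, where it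
branches towards the places of `g` and `h`. -/
abbrev ForkVertex (m N : ℕ) : Type :=
  TernaryNode m × TernaryNode m × ShiftVertex m N × ShiftVertex m N

/-- The nodes of the tree obtained by hanging a path on `N` nodes at each ternary node. -/
abbrev HairyNode (m N : ℕ) : Type := TernaryNode m ⊕ (TernaryNode m × Fin N)

instance (m : ℕ) : Finite (TernaryNode m) := (List.finite_length_le (Fin 3) m).to_subtype

variable {m N : ℕ}

/-- The fork `(a, b, g, h)` really runs from `a` to a lower node `b` and branches below it. -/
def IsFork : ForkVertex m N → Prop
  | (a, b, g, h) => a ≠ b ∧ a.1 <:+ b.1 ∧ b.1 <:+ g.1.1 ∧ b.1 <:+ h.1.1 ∧ g.1 ≠ h.1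

/-- The directed adjacency of `forkGraph`. A fork is joined to its two ends, and to the forks that
start where it branches and run into a branch it does not use. -/
def ForkRel : ShiftVertex m N ⊕ ForkVertex m N → ShiftVertex m N ⊕ ForkVertex m N → Prop
  | .inl (w, i, j), .inl (w', j', k) => w = w' ∧ j = j' ∧ i < j ∧ j < k
  | .inl _, .inr _ => False
  | .inr (a, b, g, h), .inl u => IsFork (a, b, g, h) ∧ (u = g ∨ u = h)
  | .inr (a, b, g, h), .inr (b', c, g', h') =>
      IsFork (a, b, g, h) ∧ IsFork (b', c, g', h') ∧ b = b' ∧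
        ∃ i, i :: b.1 <:+ c.1 ∧ ¬ i :: b.1 <:+ g.1.1 ∧ ¬ i :: b.1 <:+ h.1.1

/-- The graph that separates the tree-chromatic from the path-chromatic number. -/
def forkGraph (m N : ℕ) : SimpleGraph (ShiftVertex m N ⊕ ForkVertex m N) :=
  SimpleGraph.fromRel ForkRel

/-- The subtree occupied by a vertex of `forkGraph`. -/
def Occupies : ShiftVertex m N ⊕ ForkVertex m N → HairyNode m N → Prop
  | .inl _, .inl _ => False
  | .inl (w, i, j), .inr (w', t) => w = w' ∧ i ≤ t ∧ t ≤ max i j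
  | .inr (a, b, g, h), .inl x =>
      IsFork (a, b, g, h) → a.1 <:+ x.1 ∧ (x.1 <:+ g.1.1 ∨ x.1 <:+ h.1.1)
  | .inr (a, b, g, h), .inr (w, _) => IsFork (a, b, g, h) → w = g.1 ∨ w = h.1

/-- The parent of a node. -/
def HairyNode.parent : HairyNode m N → HairyNode m N
  | .inl x => .inl ⟨x.1.tail, by have := x.2; rw [List.length_tail]; omega⟩
  | .inr (w, t) =>
      if t.1 = 0 then .inl w else .inr (w, ⟨t.1 - 1, by omega⟩)

/-- The distance of a node from the root. -/
def HairyNode.depth : HairyNode m N → ℕ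
  | .inl x => x.1.length
  | .inr (w, t) => w.1.length + 1 + t.1

/-- The empty word. -/
def TernaryNode.root : TernaryNode m := ⟨[], by simp⟩

theorem HairyNode.depth_parent_lt (x : HairyNode m N) (hx : x ≠ .inl TernaryNode.root) :
    x.parent.depth < x.depth := by
  rcases x with ⟨l, hl⟩ | ⟨w, t⟩
  · cases l with
    | nil => exact absurd rfl hx
    | cons a l => simp [HairyNode.parent, HairyNode.depth]
  · by_cases ht : t.1 = 0
    · simp [HairyNode.parent, HairyNode.depth, ht]
    · simp only [HairyNode.parent, HairyNode.depth, ht, if_false]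
      omega

theorem suffix_tail_of_ne {α : Type} {a x : List α} (h : a <:+ x) (hne : x ≠ a) :
    a <:+ x.tail := by
  cases x with
  | nil => exact absurd (List.suffix_nil.1 h).symm hne
  | cons i x =>
    rcases List.suffix_cons_iff.1 h with h | h
    · exact absurd h.symm hne
    · exact h

theorem occupied_connected (v : ShiftVertex m N ⊕ ForkVertex m N) :
    ((parentGraph HairyNode.parent).induce {t : HairyNode m N | Occupies v t}).Connected := by
  rcases v with ⟨w, i, j⟩ | ⟨a, b, g, h⟩
  · refine parentGraph_induce_connected _ HairyNode.depth _ (.inr (w, i))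
      ⟨rfl, le_rfl, le_max_left _ _⟩ ?_
    rintro (x | ⟨w', t⟩) hx hne
    · exact hx.elim
    · refine ⟨?_, HairyNode.depth_parent_lt _ (by simp)⟩
      obtain ⟨rfl, h1, h2⟩ := hx
      have hit : i ≠ t := fun e => hne (by rw [e])
      have hlt : i.1 < t.1 := lt_of_le_of_ne h1 fun e => hit (Fin.ext e)
      have ht : t.1 ≠ 0 := by omega
      simp only [HairyNode.parent, ht, if_false, Set.mem_ofPred_eq, Occupies, true_and]
      refine ⟨by rw [Fin.le_def]; simp; omega, le_trans ?_ h2⟩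
      rw [Fin.le_def]; simp
  · by_cases hv : IsFork (a, b, g, h)
    · have hv' := hv
      obtain ⟨-, hab, hbg, hbh, -⟩ := hv'
      refine parentGraph_induce_connected _ HairyNode.depth _ (.inl a)
        (fun _ => ⟨List.suffix_rfl, Or.inl (hab.trans hbg)⟩) ?_
      rintro (x | ⟨w', t⟩) hx hne
      · obtain ⟨hax, hxw⟩ := hx hv
        have hxa : x.1 ≠ a.1 := fun e => hne (by rw [Subtype.ext e])
        refine ⟨fun _ => ⟨suffix_tail_of_ne hax hxa,
          hxw.imp (List.tail_suffix _).trans (List.tail_suffix _).trans⟩,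
          HairyNode.depth_parent_lt _ fun e => ?_⟩
        have hr : x.1 = [] := congrArg Subtype.val (Sum.inl.inj e)
        rw [hr] at hax hxa
        exact hxa (List.suffix_nil.1 hax).symm
      · refine ⟨?_, HairyNode.depth_parent_lt _ (by simp)⟩
        have hw := hx hv
        by_cases ht : t.1 = 0
        · simp only [HairyNode.parent, ht, if_true, Set.mem_ofPred_eq, Occupies]
          rintro -
          rcases hw with rfl | rfl
          · exact ⟨hab.trans hbg, Or.inl List.suffix_rfl⟩
          · exact ⟨hab.trans hbh, Or.inr List.suffix_rfl⟩
        · simp only [HairyNode.parent, ht, if_false, Set.mem_ofPred_eq, Occupies]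
          exact fun _ => hw
    · have hall : ∀ t, Occupies (.inr (a, b, g, h)) t := by
        rintro (x | ⟨w', t⟩) hf <;> exact absurd hf hv
      exact parentGraph_induce_connected _ HairyNode.depth _ (.inl TernaryNode.root)
        (hall (.inl TernaryNode.root))
        fun x _ hx => ⟨hall _, HairyNode.depth_parent_lt x hx⟩

theorem ForkRel.exists_occupies {u v : ShiftVertex m N ⊕ ForkVertex m N} (h : ForkRel u v) :
    ∃ t, Occupies u t ∧ Occupies v t := by
  rcases u with ⟨w, i, j⟩ | ⟨a, b, g, g'⟩ <;> rcases v with ⟨w', j', k⟩ | ⟨b', c, e, e'⟩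
  · obtain ⟨rfl, rfl, hij, hjk⟩ := h
    exact ⟨.inr (w, j), ⟨rfl, hij.le, le_max_right _ _⟩, ⟨rfl, le_rfl, le_max_left _ _⟩⟩
  · exact h.elim
  · obtain ⟨-, h⟩ := h
    refine ⟨.inr (w', j'), fun _ => ?_, ⟨rfl, le_rfl, le_max_left _ _⟩⟩
    rcases h with h | h
    · exact Or.inl (congrArg Prod.fst h)
    · exact Or.inr (congrArg Prod.fst h)
  · obtain ⟨⟨-, hab, hbg, -⟩, ⟨-, hbc, hce, -⟩, rfl, -⟩ := h
    exact ⟨.inl b, fun _ => ⟨hab, Or.inl hbg⟩, fun _ => ⟨List.suffix_rfl, Or.inl (hbc.trans hce)⟩⟩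

/-- The tree-decomposition of `forkGraph` into occupied subtrees. -/
def forkTreeDecomp (m N : ℕ) : TreeDecomp (forkGraph m N) where
  ι := HairyNode m N
  fin := inferInstance
  T := parentGraph HairyNode.parent
  isTree := parentGraph_isTree _ HairyNode.depth (.inl TernaryNode.root) rfl
    HairyNode.depth_parent_lt
  bag t := {v | Occupies v t}
  covers := by
    intro u v huv
    rw [forkGraph, fromRel_adj] at huv
    rcases huv.2 with h | h
    · exact h.exists_occupies
    · obtain ⟨t, h1, h2⟩ := h.exists_occupies
      exact ⟨t, h2, h1⟩
  conn := occupied_connected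

open Classical in
/-- A colouring of `forkGraph` that is proper on the bag at the given node. -/
noncomputable def bagColour : HairyNode m N → ShiftVertex m N ⊕ ForkVertex m N → Bool
  | .inl _, .inl _ => true
  | .inl x, .inr (a, _, _, _) => decide (a = x)
  | .inr (_, t), .inl (_, i, _) => decide (i = t)
  | .inr (w, t), .inr (_, _, g, h) =>
      if w = g.1 then !decide (g.2.1 = t) else !decide (h.2.1 = t)

theorem bagColour_ne (t : HairyNode m N) {u v : ShiftVertex m N ⊕ ForkVertex m N}
    (hu : Occupies u t) (hv : Occupies v t) (h : ForkRel u v) :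
    bagColour t u ≠ bagColour t v := by
  rcases u with ⟨w, i, j⟩ | ⟨a, b, g, g'⟩ <;> rcases v with ⟨w', j', k⟩ | ⟨b', c, e, e'⟩ <;>
    rcases t with x | ⟨y, t⟩
  · exact hu.elim
  · obtain ⟨rfl, rfl, hij, hjk⟩ := h
    obtain ⟨-, -, h1⟩ := hu
    obtain ⟨-, h2, -⟩ := hv
    rw [max_eq_right hij.le] at h1
    have hjt : j = t := le_antisymm h2 h1
    simp [bagColour, hjt, (hjt ▸ hij).ne]
  · exact h.elim
  · exact h.elim
  · exact hv.elim
  · obtain ⟨hf, h⟩ := h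
    have hne : g.1 ≠ g'.1 := hf.2.2.2.2
    obtain ⟨rfl, -, -⟩ := hv
    rcases h with rfl | rfl
    · simp [bagColour]
    · simp [bagColour, hne.symm]
  · obtain ⟨hf, hf', rfl, i, hic, hig, hig'⟩ := h
    obtain ⟨hax, hxg⟩ := hu hf
    obtain ⟨hbx, hxe⟩ := hv hf'
    have hbx' : b = x := by
      by_contra hne
      have hlen : (i :: b.1).length ≤ x.1.length := by
        have h1 := hbx.length_le
        have h2 : b.1.length ≠ x.1.length := fun e => hne (Subtype.ext (hbx.eq_of_length e))
        simp only [List.length_cons]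
        omega
      have hix : i :: b.1 <:+ x.1 := by
        rcases hxe with hxe | hxe
        · exact List.suffix_of_suffix_length_le (hic.trans hf'.2.2.1) hxe hlen
        · exact List.suffix_of_suffix_length_le (hic.trans hf'.2.2.2.1) hxe hlen
      exact hxg.elim (fun hx => hig (hix.trans hx)) (fun hx => hig' (hix.trans hx))
    have hne : a ≠ x := hbx' ▸ hf.1
    simp [bagColour, hbx', hne]
  · obtain ⟨hf, hf', rfl, i, hic, hig, hig'⟩ := h
    have hiy : i :: b.1 <:+ y.1 := by
      rcases hv hf' with rfl | rfl
      · exact hic.trans hf'.2.2.1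
      · exact hic.trans hf'.2.2.2.1
    rcases hu hf with rfl | rfl
    · exact absurd hiy hig
    · exact absurd hiy hig'

theorem forkTreeDecomp_colorable (t : HairyNode m N) :
    ((forkGraph m N).induce ((forkTreeDecomp m N).bag t)).Colorable 2 := by
  let c : ((forkGraph m N).induce ((forkTreeDecomp m N).bag t)).Coloring Bool :=
    Coloring.mk (fun v => bagColour t v.1) (by
      rintro ⟨u, hu⟩ ⟨v, hv⟩ huv
      have huv' : (forkGraph m N).Adj u v := huv
      rw [forkGraph, fromRel_adj] at huv'
      rcases huv'.2 with h | h
      · exact bagColour_ne t hu hv h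
      · exact (bagColour_ne t hv hu h).symm)
  simpa using c.colorable

theorem ForkRel.adj {u v : ShiftVertex m N ⊕ ForkVertex m N} (h : ForkRel u v) :
    (forkGraph m N).Adj u v := by
  obtain ⟨t, hu, hv⟩ := h.exists_occupies
  exact (fromRel_adj _ _ _).2 ⟨fun e => bagColour_ne t hu hv h (by rw [e]), Or.inl h⟩

/-- Below each inner node there are a branch and two leaves outside it such that the intervals of
these leaves lie on either side of all intervals from the branch. -/
theorem exists_enclosed_branch {α : Type} [LinearOrder α] (l r : TernaryNode m → α)
    (hlr : ∀ x, l x ≤ r x)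
    (hdis : ∀ x y : TernaryNode m, x.1.length = m → y.1.length = m → x ≠ y →
      r x < l y ∨ r y < l x)
    (b : List (Fin 3)) (hb : b.length < m) :
    ∃ (i : Fin 3) (x y : TernaryNode m), x.1.length = m ∧ y.1.length = m ∧ x ≠ y ∧
      b <:+ x.1 ∧ b <:+ y.1 ∧ ¬ i :: b <:+ x.1 ∧ ¬ i :: b <:+ y.1 ∧
      ∀ z : TernaryNode m, z.1.length = m → i :: b <:+ z.1 → r x < l z ∧ r z < l y := by
  have hext : ∀ c : List (Fin 3), c.length ≤ m →
      ∃ z : TernaryNode m, z.1.length = m ∧ c <:+ z.1 := fun c hc =>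
    ⟨⟨List.replicate (m - c.length) 0 ++ c, by simp; omega⟩, by simp; omega,
      List.suffix_append _ _⟩
  let S : Set (TernaryNode m) := {z | z.1.length = m ∧ b <:+ z.1}
  have hS : S.Nonempty := hext b hb.le
  obtain ⟨x, ⟨hxm, hbx⟩, hx⟩ := Set.exists_min_image S l (Set.toFinite _) hS
  obtain ⟨y, ⟨hym, hby⟩, hy⟩ := Set.exists_max_image S r (Set.toFinite _) hS
  have huniq : ∀ {z : TernaryNode m} {i j : Fin 3}, i :: b <:+ z.1 → j :: b <:+ z.1 → i = j := by
    intro z i j hi hj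
    have := (List.suffix_of_suffix_length_le hi hj (by simp)).eq_of_length (by simp)
    exact (List.cons.inj this).1
  have hbr : ∀ z : TernaryNode m, ∃ i : Fin 3, ∀ j, j :: b <:+ z.1 → j = i := by
    intro z
    by_cases h : ∃ i, i :: b <:+ z.1
    · obtain ⟨i, hi⟩ := h
      exact ⟨i, fun j hj => huniq hj hi⟩
    · exact ⟨0, fun j hj => absurd ⟨j, hj⟩ h⟩
  obtain ⟨i₁, h₁⟩ := hbr x
  obtain ⟨i₂, h₂⟩ := hbr y
  obtain ⟨i, hi₁, hi₂⟩ : ∃ i : Fin 3, i ≠ i₁ ∧ i ≠ i₂ := by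
    clear * -
    revert i₁ i₂
    decide
  have hix : ¬ i :: b <:+ x.1 := fun h => hi₁ (h₁ i h)
  have hiy : ¬ i :: b <:+ y.1 := fun h => hi₂ (h₂ i h)
  have hsep : ∀ z : TernaryNode m, z.1.length = m → i :: b <:+ z.1 → r x < l z ∧ r z < l y := by
    intro z hzm hz
    have hzS : z ∈ S := ⟨hzm, (List.suffix_cons i b).trans hz⟩
    constructor
    · rcases hdis x z hxm hzm (fun e => hix (e ▸ hz)) with h | h
      · exact h
      · exact absurd ((h.trans_le (hx z hzS)).trans_le (hlr z)) (lt_irrefl _)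
    · rcases hdis z y hzm hym (fun e => hiy (e ▸ hz)) with h | h
      · exact h
      · exact absurd ((h.trans_le (hlr z)).trans_le (hy z hzS)) (lt_irrefl _)
  refine ⟨i, x, y, hxm, hym, ?_, hbx, hby, hix, hiy, hsep⟩
  rintro rfl
  obtain ⟨z, hzm, hz⟩ := hext (i :: b) (by simpa using hb)
  obtain ⟨h1, h2⟩ := hsep z hzm hz
  exact absurd (((h1.trans_le (hlr z)).trans h2).trans_le (hlr x)) (lt_irrefl _)

/-- The branch of an infinite tree that follows the given choices of children. -/
def branchWord (i : List (Fin 3) → Fin 3) : ℕ → List (Fin 3)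
  | 0 => []
  | d + 1 => i (branchWord i d) :: branchWord i d

theorem branchWord_length (i : List (Fin 3) → Fin 3) (d : ℕ) : (branchWord i d).length = d := by
  induction d with
  | zero => rfl
  | succ d ih => simp [branchWord, ih]

theorem branchWord_suffix (i : List (Fin 3) → Fin 3) {d e : ℕ} (h : d ≤ e) :
    branchWord i d <:+ branchWord i e := by
  induction e, h using Nat.le_induction with
  | base => exact List.suffix_rfl
  | succ e _ ih => exact ih.trans (List.suffix_cons _ _)

theorem lt_pathChi_forkGraph (k : ℕ) : ∃ m N, k < pathChi (forkGraph m N) := by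
  classical
  let m := 2 ^ k + 1
  have := Fintype.ofFinite (TernaryNode m)
  let s : Finset (TernaryNode m) := Finset.univ.filter fun x => x.1.length = m
  let N := 2 ^ (k * s.card) + 1
  refine ⟨m, N, ?_⟩
  by_contra hle
  rw [not_lt, pathChi_le_iff] at hle
  obtain ⟨D, hD⟩ := hle
  obtain ⟨l, r, hbag⟩ := D.exists_endpoints
  have hcol : ∀ p, ((forkGraph m N).induce {v | l v ≤ p ∧ p ≤ r v}).Colorable k := by
    intro p
    have : {v | l v ≤ p ∧ p ≤ r v} = D.bag p := Set.ext fun v => (hbag v p).symm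
    rw [this]
    exact hD p
  have hlr : ∀ v, l v ≤ r v := by
    intro v
    obtain ⟨⟨t, ht⟩⟩ := (D.conn v).nonempty
    obtain ⟨h1, h2⟩ := (hbag v t).1 ht
    exact h1.trans h2
  have hadj : ∀ {u v}, ForkRel u v → l u ≤ r v ∧ l v ≤ r u := by
    intro u v huv
    obtain ⟨t, hu, hv⟩ := D.covers huv.adj
    rw [hbag] at hu hv
    exact ⟨hu.1.trans hv.2, hv.1.trans hu.2⟩
  let A : TernaryNode m → Set (ShiftVertex m N ⊕ ForkVertex m N) :=
    fun w => {v | ∃ i j, v = .inl (w, i, j)}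
  have : Nonempty (ShiftVertex m N ⊕ ForkVertex m N) := ⟨.inl (TernaryNode.root, 0, 0)⟩
  obtain ⟨u, hu, hdis⟩ := exists_disjoint_representatives l r hcol s A fun w _ =>
    not_colorable_of_shift (N := N) (Nat.lt_succ_self _) (fun i j => .inl (w, i, j))
      (fun i j _ => ⟨i, j, rfl⟩)
      (fun i j k hij hjk => ForkRel.adj (u := .inl (w, i, j)) (v := .inl (w, j, k))
        ⟨rfl, rfl, hij, hjk⟩)
  have hs : ∀ x : TernaryNode m, x.1.length = m → x ∈ s := fun x hx => by simp [s, hx]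
  have hrep : ∀ x : TernaryNode m, ∃ g : ShiftVertex m N,
      x.1.length = m → g.1 = x ∧ u x = .inl g := by
    intro x
    by_cases hx : x.1.length = m
    · obtain ⟨i, j, h⟩ := hu x (hs x hx)
      exact ⟨(x, i, j), fun _ => ⟨rfl, h⟩⟩
    · exact ⟨(x, 0, 0), fun h => absurd h hx⟩
  choose g hg using hrep
  have hbranch : ∀ b : List (Fin 3), ∃ (i : Fin 3) (x y : TernaryNode m), b.length < m →
      x.1.length = m ∧ y.1.length = m ∧ x ≠ y ∧
      b <:+ x.1 ∧ b <:+ y.1 ∧ ¬ i :: b <:+ x.1 ∧ ¬ i :: b <:+ y.1 ∧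
      ∀ z : TernaryNode m, z.1.length = m → i :: b <:+ z.1 →
        r (u x) < l (u z) ∧ r (u z) < l (u y) := by
    intro b
    by_cases hb : b.length < m
    · obtain ⟨i, x, y, h⟩ := exists_enclosed_branch (fun x => l (u x)) (fun x => r (u x))
        (fun x => hlr _) (fun x y hx hy hxy => hdis x (hs x hx) y (hs y hy) hxy) b hb
      exact ⟨i, x, y, fun _ => h⟩
    · exact ⟨0, TernaryNode.root, TernaryNode.root, fun h => absurd h hb⟩
  choose i x y hixy using hbranch
  let a : ℕ → List (Fin 3) := branchWord i
  let a' : Fin m → TernaryNode m := fun d => ⟨a d, by rw [branchWord_length]; exact d.2.le⟩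
  let z : TernaryNode m := ⟨a m, (branchWord_length i m).le⟩
  have hz : z.1.length = m := branchWord_length i m
  have ha : ∀ d : Fin m, (a d).length < m := fun d => by rw [branchWord_length]; exact d.2
  let f : Fin m → Fin m → ForkVertex m N := fun d e => (a' d, a' e, g (x (a e)), g (y (a e)))
  have hfork : ∀ d e, d < e → IsFork (f d e) := by
    intro d e hde
    obtain ⟨hx, hy, hxy, hbx, hby, -⟩ := hixy (a e) (ha e)
    refine ⟨fun h => ?_, branchWord_suffix i hde.le, ?_, ?_, ?_⟩
    · have := congrArg (fun w : TernaryNode m => w.1.length) h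
      simp only [a', a, branchWord_length] at this
      exact hde.ne (Fin.ext this)
    · rw [(hg _ hx).1]; exact hbx
    · rw [(hg _ hy).1]; exact hby
    · rw [(hg _ hx).1, (hg _ hy).1]; exact hxy
  refine not_colorable_of_shift (N := m) (Nat.lt_succ_self _) (fun d e => .inr (f d e))
    (fun d e hde => ?_) (fun d e c hde hec => ?_) (hcol (l (u z)))
  · obtain ⟨hx, hy, -, -, -, -, -, hsep⟩ := hixy (a e) (ha e)
    obtain ⟨h1, h2⟩ := hsep z hz (branchWord_suffix i (d := e + 1) e.2)
    have hl := (hadj (u := .inr (f d e)) (v := .inl (g (x (a e))))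
      ⟨hfork d e hde, Or.inl rfl⟩).1
    have hr := (hadj (u := .inr (f d e)) (v := .inl (g (y (a e))))
      ⟨hfork d e hde, Or.inr rfl⟩).2
    rw [← (hg _ hx).2] at hl
    rw [← (hg _ hy).2] at hr
    exact ⟨hl.trans h1.le, ((hlr _).trans h2.le).trans hr⟩
  · obtain ⟨hx, hy, -, -, -, hix, hiy, -⟩ := hixy (a e) (ha e)
    refine ForkRel.adj (u := .inr (f d e)) (v := .inr (f e c)) ⟨hfork d e hde, hfork e c hec, rfl,
      i (a e), branchWord_suffix i (d := e + 1) hec, ?_, ?_⟩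
    · rw [(hg _ hx).1]; exact hix
    · rw [(hg _ hy).1]; exact hiy

end Construction

/-! ### Induced subgraphs -/

section Induced

variable {V : Type}

/-- The restriction of a tree-decomposition to an induced subgraph. -/
def TreeDecomp.restrict {G : SimpleGraph V} (D : TreeDecomp G) (s : Set V) :
    TreeDecomp (G.induce s) where
  ι := D.ι
  fin := D.fin
  T := D.T
  isTree := D.isTree
  bag t := {v | v.1 ∈ D.bag t}
  covers _ _ h := D.covers h
  conn v := D.conn v.1

theorem treeChi_induce_le [Finite V] {G : SimpleGraph V} (D : TreeDecomp G) {k : ℕ}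
    (hD : ∀ t, (G.induce (D.bag t)).Colorable k) (s : Set V) : treeChi (G.induce s) ≤ k := by
  have hle : treeChi (G.induce s) ≤ (D.restrict s).chrom := Nat.sInf_le ⟨_, rfl⟩
  refine hle.trans (((D.restrict s).chrom_le_iff k).2 fun t => ?_)
  obtain ⟨c⟩ := hD t
  exact ⟨Coloring.mk (fun v => c ⟨v.1.1, v.2⟩) fun {u v} h =>
    c.valid (v := ⟨u.1.1, u.2⟩) (w := ⟨v.1.1, v.2⟩) h⟩

theorem pathChi_induce_insert_le [Finite V] (G : SimpleGraph V) (s : Set V) (a : V) :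
    pathChi (G.induce (insert a s)) ≤ pathChi (G.induce s) + 1 := by
  obtain ⟨D, hD⟩ := (pathChi_le_iff (G.induce s) _).1 le_rfl
  have : NeZero D.n := ⟨D.npos.ne'⟩
  have hpath : (pathGraph D.n).Connected := by
    obtain ⟨n, hn⟩ := Nat.exists_eq_succ_of_ne_zero D.npos.ne'
    rw [hn]
    exact pathGraph_connected n
  let E : PathDecomp (G.induce (insert a s)) :=
    { n := D.n
      npos := D.npos
      bag := fun t => {v | v.1 = a ∨ ∃ h : v.1 ∈ s, ⟨v.1, h⟩ ∈ D.bag t}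
      covers := by
        rintro ⟨u, hu⟩ ⟨v, hv⟩ huv
        have hmem : ∀ w (hw : w ∈ insert a s), w = a ∨ ∃ t, ∃ h : w ∈ s, ⟨w, h⟩ ∈ D.bag t := by
          rintro w (h | h)
          · exact Or.inl h
          · obtain ⟨⟨t, ht⟩⟩ := (D.conn ⟨w, h⟩).nonempty
            exact Or.inr ⟨t, h, ht⟩
        rcases hmem u hu with h1 | ⟨t, ht⟩
        · rcases hmem v hv with h2 | ⟨t, ht⟩
          · exact ⟨0, Or.inl h1, Or.inl h2⟩
          · exact ⟨t, Or.inl h1, Or.inr ht⟩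
        · rcases hmem v hv with h2 | ⟨t', hvs, -⟩
          · exact ⟨t, Or.inr ht, Or.inl h2⟩
          · obtain ⟨p, hp1, hp2⟩ := D.covers (u := ⟨u, ht.1⟩) (v := ⟨v, hvs⟩) huv
            exact ⟨p, Or.inr ⟨_, hp1⟩, Or.inr ⟨_, hp2⟩⟩
      conn := by
        rintro ⟨v, hv⟩
        by_cases hva : v = a
        · have : {t : Fin D.n | v = a ∨ ∃ h : v ∈ s, ⟨v, h⟩ ∈ D.bag t} = Set.univ := by
            simp [hva]
          change ((pathGraph D.n).induce
            {t : Fin D.n | v = a ∨ ∃ h : v ∈ s, ⟨v, h⟩ ∈ D.bag t}).Connected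
          rw [this]
          exact (induceUnivIso _).connected_iff.2 hpath
        · have hvs : v ∈ s := hv.resolve_left hva
          have : {t : Fin D.n | v = a ∨ ∃ h : v ∈ s, ⟨v, h⟩ ∈ D.bag t} =
              {t | ⟨v, hvs⟩ ∈ D.bag t} := by
            simp [hva, hvs]
          change ((pathGraph D.n).induce
            {t : Fin D.n | v = a ∨ ∃ h : v ∈ s, ⟨v, h⟩ ∈ D.bag t}).Connected
          rw [this]
          exact D.conn _ }
  refine (pathChi_le_iff _ _).2 ⟨E, fun t => ?_⟩
  let X : Set ↥(insert a s) := {v | ∃ h : v.1 ∈ s, ⟨v.1, h⟩ ∈ D.bag t}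
  let Y : Set ↥(insert a s) := {v | v.1 = a}
  have hX : ((G.induce (insert a s)).induce X).Colorable (pathChi (G.induce s)) := by
    obtain ⟨c⟩ := hD t
    exact ⟨Coloring.mk (fun v => c ⟨⟨v.1.1, v.2.1⟩, v.2.2⟩) fun {u v} h =>
      c.valid (v := ⟨⟨u.1.1, u.2.1⟩, u.2.2⟩) (w := ⟨⟨v.1.1, v.2.1⟩, v.2.2⟩) h⟩
  have hY : ((G.induce (insert a s)).induce Y).Colorable 1 := by
    refine ⟨Coloring.mk (fun _ => 0) fun {u v} h => ?_⟩
    have h' : G.Adj u.1.1 v.1.1 := h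
    rw [show u.1.1 = a from u.2, show v.1.1 = a from v.2] at h'
    exact absurd h' G.irrefl
  exact colorable_induce_mono (fun v hv => Or.symm hv) (colorable_induce_union hX hY)

theorem exists_induce_pathChi_eq [Finite V] (G : SimpleGraph V) {n : ℕ} (hn : 0 < n)
    (h : n ≤ pathChi G) : ∃ s : Set V, pathChi (G.induce s) = n := by
  have key : ∀ s : Set V, n ≤ pathChi (G.induce s) → ∃ s : Set V, pathChi (G.induce s) = n := by
    intro s
    induction s, Set.toFinite s using Set.Finite.induction_on with
    | empty =>
      intro h0
      have : pathChi (G.induce ∅) ≤ 0 :=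
        (pathChi_le_iff _ _).2 ⟨PathDecomp.trivial _, fun _ => Colorable.of_isEmpty _⟩
      omega
    | @insert a s _ _ ih =>
      intro h1
      by_cases h2 : n ≤ pathChi (G.induce s)
      · exact ih h2
      · have := pathChi_induce_insert_le G s a
        exact ⟨insert a s, by omega⟩
  refine key Set.univ (h.trans ?_)
  obtain ⟨D, hD⟩ := (pathChi_le_iff (G.induce Set.univ) _).1 le_rfl
  refine (pathChi_le_iff _ _).2 ⟨⟨D.n, D.npos, fun t => {v : V | (⟨v, Set.mem_univ v⟩ : ↥(Set.univ : Set V)) ∈ D.bag t},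
    fun u v huv => D.covers (u := ⟨u, trivial⟩) (v := ⟨v, trivial⟩) huv,
    fun v => D.conn ⟨v, trivial⟩⟩, fun t => ?_⟩
  obtain ⟨c⟩ := hD t
  exact ⟨Coloring.mk (fun v => c ⟨⟨v.1, trivial⟩, v.2⟩) fun {u v} h =>
    c.valid (v := ⟨⟨u.1, trivial⟩, u.2⟩) (w := ⟨⟨v.1, trivial⟩, v.2⟩) h⟩

/-- A graph of path-chromatic number at least two has tree-chromatic number at least two. -/
theorem two_le_treeChi [Finite V] {G : SimpleGraph V} (D : TreeDecomp G) (h : 2 ≤ pathChi G) :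
    2 ≤ treeChi G := by
  refine le_csInf ⟨_, D, rfl⟩ ?_
  rintro _ ⟨E, rfl⟩
  by_contra hlt
  have hE := (E.chrom_le_iff 1).1 (by omega)
  have hno : ∀ u v, ¬ G.Adj u v := by
    intro u v huv
    obtain ⟨t, hu, hv⟩ := E.covers huv
    obtain ⟨c⟩ := hE t
    exact c.valid (v := ⟨u, hu⟩) (w := ⟨v, hv⟩) huv (Subsingleton.elim _ _)
  have : pathChi G ≤ 1 := (pathChi_le_iff _ _).2 ⟨PathDecomp.trivial G, fun _ =>
    ⟨Coloring.mk (fun _ => 0) fun {u v} h => absurd h (hno _ _)⟩⟩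
  omega

end Induced

/-- For every integer `n ≥ 2` there is a finite graph with
tree-chromatic number exactly `2` and path-chromatic number exactly `n`. -/
theorem stmt5 (n : ℕ) (hn : 2 ≤ n) :
    ∃ (V : Type) (_ : Fintype V) (H : SimpleGraph V),
      treeChi H = 2 ∧ pathChi H = n := by
  obtain ⟨m, N, h⟩ := lt_pathChi_forkGraph n
  obtain ⟨s, hs⟩ := exists_induce_pathChi_eq (forkGraph m N) (by omega) h.le
  refine ⟨s, Fintype.ofFinite _, (forkGraph m N).induce s, le_antisymm ?_ ?_, hs⟩
  · exact treeChi_induce_le (forkTreeDecomp m N) forkTreeDecomp_colorable s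
  · exact two_le_treeChi ((forkTreeDecomp m N).restrict s) (hs ▸ hn)
end

section
/- For all integers d ≥ 1 and ℓ ≥ 4, if G is a graph with no hole of length greater than ℓ and χ(G[N_G(v)]) ≤ d for every vertex v of G, then tree-χ(G) ≤ d(ℓ − 2). -/
open SimpleGraph

/-- `C` is a hole of `G`: an induced cycle of length at least `4`.  Here `C` is a
cycle of `G` such that every edge of `G` between vertices of `C` is an edge of `C`. -/
def IsHole {V : Type} (G : SimpleGraph V) {v : V} (C : G.Walk v v) : Prop :=
  C.IsCycle ∧ 4 ≤ C.length ∧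
    ∀ x y, x ∈ C.support → y ∈ C.support → G.Adj x y → C.toSubgraph.Adj x y

namespace SimpleGraph

variable {V : Type} {G : SimpleGraph V}

/-- A walk of minimum length among those staying inside `S` is an induced path. -/
theorem Walk.isPath_and_isChordless_of_minimal (S : Set V) {u v : V} (p : G.Walk u v)
    (hS : ∀ x ∈ p.support, x ∈ S)
    (hmin : ∀ q : G.Walk u v, (∀ x ∈ q.support, x ∈ S) → p.length ≤ q.length) :
    p.IsPath ∧ p.IsChordless := by
  classical
  induction p with
  | nil =>
    refine ⟨Walk.IsPath.nil, ?_⟩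
    rw [Walk.isChordless_iff_forall_mem_edges]
    intro x y hx hy h
    simp only [Walk.support_nil, List.mem_singleton] at hx hy
    subst hx hy
    exact (h.ne rfl).elim
  | @cons u c v h p ih =>
    have hSu : u ∈ S := hS u (by simp)
    have hSp : ∀ x ∈ p.support, x ∈ S := fun x hx => hS x (by simp [hx])
    obtain ⟨hp, hc⟩ := ih hSp fun q hq => by
      have := hmin (.cons h q) (by
        intro x hx
        rw [Walk.support_cons, List.mem_cons] at hx
        rcases hx with rfl | hx
        · exact hSu
        · exact hq x hx)
      simpa using this
    have hdrop : ∀ w (hw : w ∈ p.support), ∀ x ∈ (p.dropUntil w hw).support, x ∈ S :=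
      fun w hw x hx => hSp x (p.support_dropUntil_subset_support hw hx)
    have hu : u ∉ p.support := fun hu => by
      have h1 := hmin (p.dropUntil u hu) (hdrop u hu)
      have h2 := p.length_dropUntil_le_length hu
      simp only [Walk.length_cons] at h1
      omega
    have hchord : ∀ w ∈ p.support, G.Adj u w → w = c := by
      intro w hw huw
      by_contra hne
      have h1 := hmin (.cons huw (p.dropUntil w hw)) (by
        intro x hx
        rw [Walk.support_cons, List.mem_cons] at hx
        rcases hx with rfl | hx
        · exact hSu
        · exact hdrop w hw x hx)
      have h2 := p.length_dropUntil_lt_length hw hne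
      simp only [Walk.length_cons] at h1
      omega
    refine ⟨hp.cons hu, ?_⟩
    rw [Walk.isChordless_iff_forall_mem_edges]
    intro x y hx hy hxy
    simp only [Walk.support_cons, List.mem_cons] at hx hy
    rw [Walk.edges_cons, List.mem_cons]
    rcases hx with rfl | hx <;> rcases hy with rfl | hy
    · exact (hxy.ne rfl).elim
    · exact .inl (by rw [hchord y hy hxy])
    · exact .inl (by rw [hchord x hx hxy.symm, Sym2.eq_swap])
    · exact .inr (hc.mem_edges hx hy hxy)

/-- Two disjoint induced paths, joined only at their ends, form a hole. -/
theorem exists_isHole_of_paths {a b c e : V} (p : G.Walk a b) (q : G.Walk c e)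
    (hp : p.IsPath) (hpc : p.IsChordless) (hq : q.IsPath) (hqc : q.IsChordless)
    (hdisj : ∀ x ∈ p.support, x ∉ q.support) (hbc : G.Adj b c) (hea : G.Adj e a)
    (hcross : ∀ x ∈ p.support, ∀ y ∈ q.support, G.Adj x y → (x = b ∧ y = c) ∨ (x = a ∧ y = e))
    (hlen : 2 ≤ p.length + q.length) :
    ∃ C : G.Walk e e, IsHole G C ∧ C.length = p.length + q.length + 2 := by
  refine ⟨.cons hea (p.append (.cons hbc q)), ⟨?_, ?_, ?_⟩, ?_⟩
  · rw [Walk.cons_isCycle_iff]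
    constructor
    · rw [Walk.isPath_def, Walk.support_append, Walk.support_cons, List.tail_cons]
      exact List.Nodup.append hp.support_nodup hq.support_nodup fun x hx hx' => hdisj x hx hx'
    · rw [Walk.edges_append, Walk.edges_cons, List.mem_append, List.mem_cons]
      rintro (h | h | h)
      · exact hdisj e (p.fst_mem_support_of_mem_edges h) q.end_mem_support
      · rw [Sym2.eq_iff] at h
        rcases h with ⟨rfl, -⟩ | ⟨rfl, rfl⟩
        · exact hdisj _ p.end_mem_support q.end_mem_support
        · rw [(hp.nil_iff_eq.2 rfl).length_eq_zero, (hq.nil_iff_eq.2 rfl).length_eq_zero] at hlen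
          omega
      · exact hdisj a p.start_mem_support (q.snd_mem_support_of_mem_edges h)
  · simp only [Walk.length_cons, Walk.length_append]
    omega
  · intro x y hx hy hxy
    rw [Walk.adj_toSubgraph_iff_mem_edges, Walk.edges_cons, Walk.edges_append, Walk.edges_cons,
      List.mem_cons, List.mem_append, List.mem_cons]
    have key : ∀ z, z ∈ (Walk.cons hea (p.append (.cons hbc q))).support →
        z ∈ p.support ∨ z ∈ q.support := by
      intro z hz
      simp only [Walk.support_cons, List.mem_cons, Walk.support_append, List.tail_cons,
        List.mem_append] at hz
      rcases hz with rfl | hz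
      · exact .inr q.end_mem_support
      · exact hz
    rcases key x hx with hx | hx <;> rcases key y hy with hy | hy
    · exact .inr (.inl (hpc.mem_edges hx hy hxy))
    · rcases hcross x hx y hy hxy with ⟨rfl, rfl⟩ | ⟨rfl, rfl⟩
      · exact .inr (.inr (.inl rfl))
      · exact .inl Sym2.eq_swap
    · rcases hcross y hy x hx hxy.symm with ⟨rfl, rfl⟩ | ⟨rfl, rfl⟩
      · exact .inr (.inr (.inl Sym2.eq_swap))
      · exact .inl rfl
    · exact .inr (.inr (.inr (hqc.mem_edges hx hy hxy)))
  · simp only [Walk.length_cons, Walk.length_append]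
    omega

/-- The vertices outside `Z` with a neighbour in `Z`. -/
def outerBoundary (G : SimpleGraph V) (Z : Set V) : Set V :=
  {u | u ∉ Z ∧ ∃ z ∈ Z, G.Adj z u}

/-- Any two vertices of `Z` are joined by a walk inside `Z`. -/
def JoinedIn (G : SimpleGraph V) (Z : Set V) : Prop :=
  ∀ x ∈ Z, ∀ y ∈ Z, ∃ w : G.Walk x y, ∀ u ∈ w.support, u ∈ Z

theorem JoinedIn.exists_path {Z : Set V} (hZ : G.JoinedIn Z) {x y : V}
    (hx : x ∈ G.outerBoundary Z) (hy : y ∈ G.outerBoundary Z) :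
    ∃ q : G.Walk x y, q.IsPath ∧ q.IsChordless ∧ ∀ w ∈ q.support, w ∈ Z ∨ w = x ∨ w = y := by
  classical
  obtain ⟨z, hz, hzx⟩ := hx.2
  obtain ⟨z', hz', hzy⟩ := hy.2
  obtain ⟨w, hw⟩ := hZ z hz z' hz'
  let S : Set V := {u | u ∈ Z ∨ u = x ∨ u = y}
  have hex : ∃ n, ∃ q : G.Walk x y, (∀ u ∈ q.support, u ∈ S) ∧ q.length = n := by
    refine ⟨_, .cons hzx.symm (w.concat hzy), ?_, rfl⟩
    intro u hu
    simp only [Walk.support_cons, Walk.support_concat, List.mem_cons,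
      List.mem_append, List.not_mem_nil, or_false] at hu
    rcases hu with rfl | hu | rfl
    · exact .inr (.inl rfl)
    · exact .inl (hw u hu)
    · exact .inr (.inr rfl)
  obtain ⟨q, hqS, hq⟩ := Nat.find_spec hex
  obtain ⟨h1, h2⟩ := q.isPath_and_isChordless_of_minimal S hqS fun q' hq' => by
    rw [hq]
    exact Nat.find_min' hex ⟨q', hq', rfl⟩
  exact ⟨q, h1, h2, hqS⟩

/-- The induced path `p` misses `Z`, has no neighbours in `Z`, and dominates the boundary of `Z`. -/
structure Guards (Z : Set V) {a b : V} (p : G.Walk a b) : Prop where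
  isPath : p.IsPath
  isChordless : p.IsChordless
  far : ∀ z ∈ Z, ∀ x ∈ p.support, z ≠ x ∧ ¬ G.Adj z x
  dom : ∀ u ∈ G.outerBoundary Z, ∃ x ∈ p.support, G.Adj x u

theorem Walk.IsChordless.reverse {a b : V} {p : G.Walk a b} (hp : p.IsChordless) :
    p.reverse.IsChordless := by
  rw [Walk.isChordless_iff_forall_mem_edges] at hp ⊢
  simpa using hp

theorem Walk.IsChordless.of_cons {a b c : V} {h : G.Adj a b} {p : G.Walk b c}
    (hp : (Walk.cons h p).IsChordless) (ha : a ∉ p.support) : p.IsChordless := by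
  rw [Walk.isChordless_iff_forall_mem_edges] at hp ⊢
  intro x y hx hy hxy
  have := hp (by simp [hx]) (by simp [hy]) hxy
  rw [Walk.edges_cons, List.mem_cons, Sym2.eq_iff] at this
  rcases this with (⟨rfl, -⟩ | ⟨-, rfl⟩) | h
  · exact (ha hx).elim
  · exact (ha hy).elim
  · exact h

theorem Walk.IsChordless.concat {a b c : V} {p : G.Walk a b} (hp : p.IsChordless)
    (h : G.Adj b c) (hc : ∀ w ∈ p.support, G.Adj c w → w = b) : (p.concat h).IsChordless := by
  rw [Walk.isChordless_iff_forall_mem_edges] at hp ⊢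
  intro x y hx hy hxy
  simp only [Walk.support_concat, List.mem_append, List.mem_singleton]
    at hx hy
  rw [Walk.edges_concat, List.concat_eq_append, List.mem_append, List.mem_singleton]
  rcases hx with hx | rfl <;> rcases hy with hy | rfl
  · exact .inl (hp hx hy hxy)
  · exact .inr (by rw [hc x hx hxy.symm])
  · exact .inr (by rw [hc y hy hxy, Sym2.eq_swap])
  · exact (hxy.ne rfl).elim

namespace Guards

variable {Z : Set V} {a b : V} {p : G.Walk a b}

theorem reverse (hp : Guards Z p) : Guards Z p.reverse where
  isPath := hp.isPath.reverse
  isChordless := hp.isChordless.reverse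
  far z hz x hx := hp.far z hz x (by simpa using hx)
  dom u hu := by simpa using hp.dom u hu

/-- In a shortest guarding path, the first vertex has a private neighbour in the boundary. -/
theorem exists_private (hp : Guards Z p)
    (hmin : ∀ (a' b' : V) (p' : G.Walk a' b'), Guards Z p' → p.length ≤ p'.length)
    (hlen : 1 ≤ p.length) :
    ∃ x ∈ G.outerBoundary Z, G.Adj a x ∧ ∀ w ∈ p.support, G.Adj x w → w = a := by
  cases p with
  | nil => simp at hlen
  | cons h p =>
    by_contra! hno
    have ha := ((Walk.cons_isPath_iff h p).1 hp.isPath).2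
    have hg : Guards Z p :=
      { isPath := hp.isPath.of_cons
        isChordless := hp.isChordless.of_cons ha
        far := fun z hz x hx => hp.far z hz x (by simp [hx])
        dom := fun u hu => by
          obtain ⟨x, hx, hxu⟩ := hp.dom u hu
          rw [Walk.support_cons, List.mem_cons] at hx
          rcases hx with rfl | hx
          · obtain ⟨w, hw, huw, hne⟩ := hno u hu hxu
            rw [Walk.support_cons, List.mem_cons] at hw
            exact ⟨w, hw.resolve_left hne, huw.symm⟩
          · exact ⟨x, hx, hxu⟩ }
    have := hmin _ _ p hg
    simp at this

/-- If both ends of a guarding path have private neighbours in the boundary of a connected set,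
then the path is short when all holes are. -/
theorem length_le (hp : Guards Z p) (hZ : G.JoinedIn Z) {ℓ : ℕ}
    (hhole : ∀ (v : V) (C : G.Walk v v), IsHole G C → C.length ≤ ℓ) (hlen : 1 ≤ p.length)
    {x y : V} (hx : x ∈ G.outerBoundary Z) (hy : y ∈ G.outerBoundary Z)
    (hax : G.Adj a x) (hby : G.Adj b y) (hxa : ∀ w ∈ p.support, G.Adj x w → w = a)
    (hyb : ∀ w ∈ p.support, G.Adj y w → w = b) :
    p.length + 3 ≤ ℓ ∧ (¬ G.Adj y x → p.length + 4 ≤ ℓ) := by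
  have hab : a ≠ b := by
    rintro rfl
    rw [(hp.isPath.nil_iff_eq.2 rfl).length_eq_zero] at hlen
    omega
  have hyx : y ≠ x := by
    rintro rfl
    exact hab (hyb a p.start_mem_support hax.symm)
  have hout : ∀ u ∈ G.outerBoundary Z, u ∉ p.support := by
    intro u hu hup
    obtain ⟨z, hz, hzu⟩ := hu.2
    exact (hp.far z hz u hup).2 hzu
  obtain ⟨q, hq, hqc, hqZ⟩ := hZ.exists_path hy hx
  have hq0 : q.length ≠ 0 := fun h => hyx (Walk.eq_of_length_eq_zero h)
  obtain ⟨C, hC, hCl⟩ := exists_isHole_of_paths p q hp.isPath hp.isChordless hq hqc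
    (by
      intro w hw hwq
      rcases hqZ w hwq with h | rfl | rfl
      · exact (hp.far w h w hw).1 rfl
      · exact hout _ hy hw
      · exact hout _ hx hw)
    hby hax.symm
    (by
      intro u hu w hw huw
      rcases hqZ w hw with h | rfl | rfl
      · exact ((hp.far w h u hu).2 huw.symm).elim
      · exact .inl ⟨hyb u hu huw.symm, rfl⟩
      · exact .inr ⟨hxa u hu huw.symm, rfl⟩)
    (by omega)
  have hle := hhole _ C hC
  refine ⟨by omega, fun hnadj => ?_⟩
  have hq1 : q.length ≠ 1 := fun h => hnadj (Walk.adj_of_length_eq_one h)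
  omega

end Guards

theorem induce_colorable_of_cover {d : ℕ} (hd : 1 ≤ d)
    (hnbr : ∀ v : V, (G.induce (G.neighborSet v)).Colorable d) (Q : Finset V) (S : Set V)
    (hS : ∀ u ∈ S, ∃ q ∈ Q, G.Adj q u) : (G.induce S).Colorable (d * Q.card) := by
  classical
  have hf : ∀ q, ∃ f : V → Fin d, ∀ u w, G.Adj q u → G.Adj q w → G.Adj u w → f u ≠ f w := by
    intro q
    obtain ⟨C⟩ := hnbr q
    refine ⟨fun u => if h : G.Adj q u then C ⟨u, h⟩ else ⟨0, hd⟩, fun u w hu hw huw => ?_⟩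
    simp only [hu, hw, dif_pos]
    exact C.valid (by simpa using huw)
  choose f hf using hf
  choose g hgQ hg using hS
  let C : (G.induce S).Coloring (Fin d × Q) :=
    Coloring.mk (fun u => (f (g u u.2) u, ⟨g u u.2, hgQ u u.2⟩)) (by
      rintro ⟨u, hu⟩ ⟨w, hw⟩ huw heq
      simp only [Prod.mk.injEq, Subtype.mk.injEq] at heq
      refine hf (g u hu) u w (hg u hu) (heq.2 ▸ hg w hw) huw ?_
      rw [heq.1, heq.2])
  have := C.colorable
  simpa using this

theorem induce_insert_neighborSet_colorable {d : ℕ} {v : V}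
    (h : (G.induce (G.neighborSet v)).Colorable d) :
    (G.induce (insert v (G.neighborSet v))).Colorable (d + 1) := by
  classical
  obtain ⟨C⟩ := h
  let C' : (G.induce (insert v (G.neighborSet v))).Coloring (Option (Fin d)) :=
    Coloring.mk (fun u => if h : G.Adj v u then some (C ⟨u, h⟩) else none) (by
      rintro ⟨u, hu⟩ ⟨w, hw⟩ huw
      have huw' : G.Adj u w := huw
      by_cases h1 : G.Adj v u <;> by_cases h2 : G.Adj v w
      · simp only [h1, h2, dif_pos, ne_eq, Option.some.injEq]
        exact C.valid (by simpa using huw')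
      · simp [h1, h2]
      · simp [h1, h2]
      · rcases hu with rfl | hu
        · exact (h2 huw').elim
        · exact (h1 hu).elim)
  have := C'.colorable
  simpa using this

/-- A bag with which a tree-decomposition can be extended into the component `Z`, together with a
path guarding what then remains of `Z`. -/
theorem exists_extension {d ℓ : ℕ} (hd : 1 ≤ d) (hl : 4 ≤ ℓ)
    (hhole : ∀ (v : V) (C : G.Walk v v), IsHole G C → C.length ≤ ℓ)
    (hnbr : ∀ v : V, (G.induce (G.neighborSet v)).Colorable d) {Z : Set V} (hne : Z.Nonempty)
    (hZ : G.JoinedIn Z)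
    (hg : G.outerBoundary Z = ∅ ∨ ∃ (a b : V) (p : G.Walk a b), Guards Z p) :
    ∃ (B : Set V) (a b : V) (p : G.Walk a b), p.IsPath ∧ p.IsChordless ∧
      (G.induce B).Colorable (d * (ℓ - 2)) ∧ G.outerBoundary Z ⊆ B ∧
      B ⊆ G.outerBoundary Z ∪ Z ∧ (B ∩ Z).Nonempty ∧
      (∀ z ∈ Z \ B, ∀ x ∈ p.support, z ≠ x ∧ ¬ G.Adj z x) ∧
      ∀ u ∈ B, u ∈ p.support ∨ ∃ x ∈ p.support, G.Adj x u := by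
  classical
  by_cases hbd : G.outerBoundary Z = ∅
  · obtain ⟨v, hv⟩ := hne
    refine ⟨insert v (G.neighborSet v), v, v, .nil, .nil, ?_, ?_, by simp [hbd], ?_,
      ⟨v, by simp, hv⟩, ?_, ?_⟩
    · rw [Walk.isChordless_iff_forall_mem_edges]
      intro x y hx hy h
      simp only [Walk.support_nil, List.mem_singleton] at hx hy
      subst hx hy
      exact (h.ne rfl).elim
    · refine (induce_insert_neighborSet_colorable (hnbr v)).mono ?_
      have : d * 2 ≤ d * (ℓ - 2) := Nat.mul_le_mul_left d (by omega)
      omega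
    · rw [hbd, Set.empty_union]
      rintro u (rfl | hu)
      · exact hv
      · by_contra huZ
        exact (Set.eq_empty_iff_forall_notMem.1 hbd u) ⟨huZ, v, hv, hu⟩
    · rintro z ⟨-, hz⟩ x hx
      simp only [Walk.support_nil, List.mem_singleton] at hx
      subst hx
      exact ⟨fun h => hz (.inl h), fun h => hz (.inr h.symm)⟩
    · rintro u (rfl | hu)
      · exact .inl (by simp)
      · exact .inr ⟨v, by simp, hu⟩
  · have hex : ∃ n, ∃ (a b : V) (p : G.Walk a b), Guards Z p ∧ p.length = n := by
      obtain ⟨a, b, p, hp⟩ := hg.resolve_left hbd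
      exact ⟨_, a, b, p, hp, rfl⟩
    obtain ⟨a, b, p, hp, hpn⟩ := Nat.find_spec hex
    have hmin : ∀ (a' b' : V) (p' : G.Walk a' b'), Guards Z p' → p.length ≤ p'.length := by
      intro a' b' p' hp'
      rw [hpn]
      exact Nat.find_min' hex ⟨a', b', p', hp', rfl⟩
    obtain ⟨v, Q, hv, hbv, hvb, hQ, hcov⟩ : ∃ (v : V) (Q : Finset V), v ∈ G.outerBoundary Z ∧
        G.Adj b v ∧ (∀ w ∈ p.support, G.Adj v w → w = b) ∧ Q.card ≤ ℓ - 2 ∧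
        ∀ u ∈ G.outerBoundary Z ∪ (G.neighborSet v ∩ Z), ∃ q ∈ Q, G.Adj q u := by
      have hfull : ∀ v, ∀ u ∈ G.outerBoundary Z ∪ (G.neighborSet v ∩ Z),
          ∃ q ∈ insert v p.support.toFinset, G.Adj q u := by
        rintro v u (hu | hu)
        · obtain ⟨x, hx, hxu⟩ := hp.dom u hu
          exact ⟨x, by simp [hx], hxu⟩
        · exact ⟨v, by simp, hu.1⟩
      have hcard : ∀ v, (insert v p.support.toFinset).card ≤ p.length + 2 := by
        intro v
        have h1 := Finset.card_insert_le v p.support.toFinset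
        have h2 := p.support.toFinset_card_le
        rw [Walk.length_support] at h2
        omega
      by_cases hlen : 1 ≤ p.length
      · obtain ⟨x, hx, hax, hxa⟩ := hp.exists_private hmin hlen
        obtain ⟨v, hv, hbv, hvb⟩ := hp.reverse.exists_private (by simpa using hmin)
          (by simpa using hlen)
        simp only [Walk.support_reverse, List.mem_reverse] at hvb
        have h3 := (hp.length_le hZ hhole hlen hx hv hax hbv hxa hvb).1
        by_cases hall : ∀ u ∈ G.outerBoundary Z, G.Adj a u →
            (∀ w ∈ p.support, G.Adj u w → w = a) → G.Adj v u
        · have hba : b ≠ a := by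
            rintro rfl
            exact Nat.ne_of_gt hlen (hp.isPath.nil_iff_eq.2 rfl).length_eq_zero
          refine ⟨v, insert v (p.support.toFinset.erase a), hv, hbv, hvb, ?_, ?_⟩
          · have h1 := Finset.card_insert_le v (p.support.toFinset.erase a)
            have h2 := p.support.toFinset_card_le
            rw [Walk.length_support] at h2
            rw [Finset.card_erase_of_mem (by simp)] at h1
            omega
          · rintro u (hu | hu)
            · obtain ⟨w, hw, hwu⟩ := hp.dom u hu
              by_cases hpriv : ∀ w ∈ p.support, G.Adj u w → w = a
              · obtain rfl := hpriv w hw hwu.symm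
                exact ⟨v, by simp, hall u hu hwu hpriv⟩
              · push Not at hpriv
                obtain ⟨w, hw, huw, hwa⟩ := hpriv
                exact ⟨w, by simp [hw, hwa], huw.symm⟩
            · exact ⟨v, by simp, hu.1⟩
        · push Not at hall
          obtain ⟨u, hu, hau, hua, hvu⟩ := hall
          have h4 := (hp.length_le hZ hhole hlen hu hv hau hbv hua hvb).2 hvu
          exact ⟨v, _, hv, hbv, hvb, (hcard v).trans (by omega), hfull v⟩
      · obtain ⟨v, hv⟩ := Set.nonempty_iff_ne_empty.2 hbd
        have h0 : p.length = 0 := by omega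
        have hall : ∀ w ∈ p.support, w = b := by
          cases p with
          | nil => simp
          | cons _ _ => simp at h0
        obtain ⟨w, hw, hwv⟩ := hp.dom v hv
        exact ⟨v, _, hv, hall w hw ▸ hwv, fun w hw _ => hall w hw, (hcard v).trans (by omega),
          hfull v⟩
    obtain ⟨z₀, hz₀, hz₀v⟩ := hv.2
    have hvp : v ∉ p.support := fun h => (hp.far z₀ hz₀ v h).2 hz₀v
    refine ⟨G.outerBoundary Z ∪ (G.neighborSet v ∩ Z), a, v, p.concat hbv, hp.isPath.concat hvp hbv,
      hp.isChordless.concat hbv hvb, ?_, Set.subset_union_left,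
      Set.union_subset_union_right _ Set.inter_subset_right,
      ⟨z₀, .inr ⟨hz₀v.symm, hz₀⟩, hz₀⟩, ?_, ?_⟩
    · exact (induce_colorable_of_cover hd hnbr Q _ hcov).mono (Nat.mul_le_mul_left d hQ)
    · rintro z ⟨hz, hzB⟩ x hx
      simp only [Walk.support_concat, List.mem_append,
        List.mem_singleton] at hx
      rcases hx with hx | rfl
      · exact hp.far z hz x hx
      · exact ⟨fun h => hv.1 (h ▸ hz), fun h => hzB (.inr ⟨h.symm, hz⟩)⟩
    · rintro u (hu | hu)
      · obtain ⟨x, hx, hxu⟩ := hp.dom u hu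
        exact .inr ⟨x, by simp [Walk.support_concat, hx], hxu⟩
      · exact .inr ⟨v, by simp [Walk.support_concat], hu.1⟩

/-- The graph obtained from `T` by adding a new vertex joined to `t` only. -/
def addLeaf {ι : Type} (T : SimpleGraph ι) (t : ι) : SimpleGraph (Option ι) :=
  T.map Function.Embedding.some ⊔ edge none (some t)

section AddLeaf

variable {ι : Type} {T : SimpleGraph ι}

theorem addLeaf_induce_image_connected (t : ι) {S : Set ι} (hS : (T.induce S).Connected) :
    ((T.addLeaf t).induce (some '' S)).Connected := by
  let f : T.induce S →g (T.addLeaf t).induce (some '' S) :=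
    { toFun := fun x => ⟨some x, x, x.2, rfl⟩
      map_rel' := fun {x y} h => by
        refine Or.inl ?_
        exact (map_adj_apply (f := .some)).2 h }
  refine hS.map f ?_
  rintro ⟨_, x, hx, rfl⟩
  exact ⟨⟨x, hx⟩, rfl⟩

theorem addLeaf_induce_insert_connected {t : ι} {S : Set ι} (hS : (T.induce S).Connected)
    (ht : t ∈ S) : ((T.addLeaf t).induce (insert none (some '' S))).Connected := by
  refine connected_induce_union (s := {none}) (v := none) (w := some t) ?_
    (addLeaf_induce_image_connected t hS).preconnected rfl ⟨t, ht, rfl⟩ ?_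
  · exact Preconnected.of_subsingleton
  · exact Or.inr (by simp [edge_adj])

theorem IsTree.addLeaf [Finite ι] (hT : T.IsTree) (t : ι) : (T.addLeaf t).IsTree := by
  rw [isTree_iff_connected_and_card] at hT ⊢
  obtain ⟨hc, hcard⟩ := hT
  constructor
  · have h := addLeaf_induce_insert_connected (t := t) (S := Set.univ)
      ((induceUnivIso T).connected_iff.2 hc) trivial
    have hu : (insert none (some '' Set.univ) : Set (Option ι)) = Set.univ := by
      ext (_ | x) <;> simp
    rw [hu] at h
    exact (induceUnivIso _).connected_iff.1 h
  · have hE : (T.addLeaf t).edgeSet = insert s(none, some t) (Sym2.map some '' T.edgeSet) := by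
      rw [SimpleGraph.addLeaf, edgeSet_sup, edgeSet_edge_of_ne (by simp), edgeSet_map,
        Set.union_comm, ← Set.insert_eq]
      rfl
    rw [hE, Nat.card_coe_set_eq, Set.ncard_insert_of_notMem _ (Set.toFinite _),
      Set.ncard_image_of_injective _ (Sym2.map.injective (Option.some_injective _)),
      ← Nat.card_coe_set_eq, hcard, Finite.card_option]
    rintro ⟨e, -, he⟩
    induction e with
    | _ x y => simp at he

end AddLeaf

/-- `bag` is a tree-decomposition, over the tree `T`, of the subgraph induced by its bags. -/
structure IsPartialTreeDecomp (G : SimpleGraph V) {ι : Type} (T : SimpleGraph ι)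
    (bag : ι → Set V) : Prop where
  isTree : T.IsTree
  covers : ∀ u ∈ ⋃ t, bag t, ∀ v ∈ ⋃ t, bag t, G.Adj u v → ∃ t, u ∈ bag t ∧ v ∈ bag t
  conn : ∀ v ∈ ⋃ t, bag t, (T.induce {t | v ∈ bag t}).Connected

theorem IsPartialTreeDecomp.addLeaf {ι : Type} [Finite ι] {T : SimpleGraph ι} {bag : ι → Set V}
    (h : IsPartialTreeDecomp G T bag) {t : ι} {B : Set V} (hB : B ∩ (⋃ t, bag t) ⊆ bag t)
    (hedge : ∀ u ∈ B \ ⋃ t, bag t, ∀ w ∈ B ∪ ⋃ t, bag t, G.Adj u w → w ∈ B) :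
    IsPartialTreeDecomp G (T.addLeaf t) (fun o => o.elim B bag) := by
  have hU : (⋃ o : Option ι, o.elim B bag) = B ∪ ⋃ t, bag t := by
    ext x
    simp [Option.exists]
  refine ⟨h.isTree.addLeaf t, ?_, ?_⟩
  · rw [hU]
    intro u hu w hw huw
    by_cases huW : u ∈ ⋃ t, bag t
    · by_cases hwW : w ∈ ⋃ t, bag t
      · obtain ⟨s, hs⟩ := h.covers u huW w hwW huw
        exact ⟨some s, hs⟩
      · have hwB := hw.resolve_right hwW
        exact ⟨none, hedge w ⟨hwB, hwW⟩ u hu huw.symm, hwB⟩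
    · have huB := hu.resolve_right huW
      exact ⟨none, huB, hedge u ⟨huB, huW⟩ w hw huw⟩
  · rw [hU]
    intro v hv
    by_cases hvB : v ∈ B
    · by_cases hvW : v ∈ ⋃ t, bag t
      · have hset : {o : Option ι | v ∈ o.elim B bag} = insert none (some '' {t | v ∈ bag t}) := by
          ext (_ | x) <;> simp [hvB]
        rw [hset]
        exact addLeaf_induce_insert_connected (h.conn v hvW) (hB ⟨hvB, hvW⟩)
      · have hset : {o : Option ι | v ∈ o.elim B bag} = {none} := by
          simp only [Set.mem_iUnion, not_exists] at hvW
          ext (_ | x) <;> simp [hvB, hvW]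
        rw [hset]
        exact Connected.of_subsingleton
    · have hset : {o : Option ι | v ∈ o.elim B bag} = some '' {t | v ∈ bag t} := by
        ext (_ | x) <;> simp [hvB]
      rw [hset]
      exact addLeaf_induce_image_connected t (h.conn v (hv.resolve_left hvB))

/-- `Z` is a connected component of `G` with the vertices of `W` deleted. -/
structure IsComponentOff (G : SimpleGraph V) (W Z : Set V) : Prop where
  nonempty : Z.Nonempty
  disjoint : ∀ z ∈ Z, z ∉ W
  boundary : G.outerBoundary Z ⊆ W
  joined : G.JoinedIn Z

theorem exists_isComponentOff {W : Set V} {v : V} (hv : v ∉ W) : ∃ Z, G.IsComponentOff W Z := by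
  classical
  let Z : Set V := {y | ∃ w : G.Walk v y, ∀ x ∈ w.support, x ∉ W}
  have hsupp : ∀ y (w : G.Walk v y), (∀ x ∈ w.support, x ∉ W) → ∀ x ∈ w.support, x ∈ Z :=
    fun y w hw x hx =>
      ⟨w.takeUntil x hx, fun u hu => hw u (w.support_takeUntil_subset_support hx hu)⟩
  refine ⟨Z, ⟨v, .nil, by simpa using hv⟩, ?_, ?_, ?_⟩
  · rintro z ⟨w, hw⟩
    exact hw z w.end_mem_support
  · rintro u ⟨huZ, z, ⟨w, hw⟩, hzu⟩
    by_contra huW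
    refine huZ ⟨w.concat hzu, fun x hx => ?_⟩
    simp only [Walk.support_concat, List.mem_append,
      List.mem_singleton] at hx
    rcases hx with hx | rfl
    · exact hw x hx
    · exact huW
  · rintro x ⟨w, hw⟩ y ⟨w', hw'⟩
    refine ⟨w.reverse.append w', fun u hu => ?_⟩
    rw [Walk.mem_support_append_iff, Walk.support_reverse, List.mem_reverse] at hu
    rcases hu with hu | hu
    · exact hsupp x w hw u hu
    · exact hsupp y w' hw' u hu

theorem IsComponentOff.subset_of_inter {W Z Z' : Set V} (hZ : G.IsComponentOff W Z)
    (hZ' : G.JoinedIn Z') (hW : ∀ z ∈ Z', z ∉ W) {z : V} (hz : z ∈ Z) (hz' : z ∈ Z') :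
    Z' ⊆ Z := by
  intro y hy
  obtain ⟨w, hw⟩ := hZ' z hz' y hy
  induction w with
  | nil => exact hz
  | @cons x c y h w ih =>
    have hc : c ∈ Z' := hw c (by simp)
    refine ih ?_ hc hy fun u hu => hw u (by simp [hu])
    by_contra hcZ
    exact hW c hc (hZ.boundary ⟨hcZ, x, hz, h⟩)

/-- `W` is the union of the bags of a partial tree-decomposition with `k`-colourable bags, such
that each component of the rest attaches to a single bag and is guarded by an induced path. -/
def IsReachedSet (G : SimpleGraph V) (k : ℕ) (W : Set V) : Prop :=
  ∃ (ι : Type) (_ : Finite ι) (T : SimpleGraph ι) (bag : ι → Set V),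
    IsPartialTreeDecomp G T bag ∧ (⋃ t, bag t) = W ∧ (∀ t, (G.induce (bag t)).Colorable k) ∧
    ∀ Z, G.IsComponentOff W Z → (∃ t, G.outerBoundary Z ⊆ bag t) ∧
      (G.outerBoundary Z = ∅ ∨ ∃ (a b : V) (p : G.Walk a b), Guards Z p)

theorem isReachedSet_empty (k : ℕ) : G.IsReachedSet k ∅ := by
  refine ⟨Unit, inferInstance, ⊥, fun _ => ∅, ⟨.of_subsingleton, ?_, ?_⟩, by simp, ?_, ?_⟩
  · simp
  · simp
  · exact fun _ => Colorable.of_isEmpty _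
  · intro Z hZ
    have : G.outerBoundary Z = ∅ := Set.subset_empty_iff.1 hZ.boundary
    exact ⟨⟨(), this.le⟩, .inl this⟩

theorem IsReachedSet.exists_ssuperset {d ℓ : ℕ} (hd : 1 ≤ d) (hl : 4 ≤ ℓ)
    (hhole : ∀ (v : V) (C : G.Walk v v), IsHole G C → C.length ≤ ℓ)
    (hnbr : ∀ v : V, (G.induce (G.neighborSet v)).Colorable d) {W : Set V}
    (hW : G.IsReachedSet (d * (ℓ - 2)) W) (hne : W ≠ Set.univ) :
    ∃ W', G.IsReachedSet (d * (ℓ - 2)) W' ∧ W ⊂ W' := by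
  obtain ⟨ι, hfin, T, bag, hT, rfl, hcol, hcomp⟩ := hW
  obtain ⟨v, hv⟩ := (Set.ne_univ_iff_exists_notMem _).1 hne
  obtain ⟨Z, hZ⟩ := exists_isComponentOff (G := G) hv
  obtain ⟨⟨t, ht⟩, hguard⟩ := hcomp Z hZ
  obtain ⟨B, a, b, p, hp, hpc, hBcol, hZB, hBZ, ⟨x, hxB, hxZ⟩, hfar, hdom⟩ :=
    exists_extension hd hl hhole hnbr hZ.nonempty hZ.joined hguard
  set W : Set V := ⋃ t, bag t with hWdef
  have hU : (⋃ o : Option ι, o.elim B bag) = B ∪ W := by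
    ext x
    simp [Option.exists, hWdef]
  refine ⟨B ∪ W, ⟨Option ι, inferInstance, T.addLeaf t, fun o => o.elim B bag,
    hT.addLeaf ?_ ?_, hU, ?_, ?_⟩, ?_⟩
  · rintro u ⟨huB, huW⟩
    rcases hBZ huB with h | h
    · exact ht h
    · exact (hZ.disjoint u h huW).elim
  · rintro u ⟨huB, huW⟩ w hw huw
    have huZ : u ∈ Z := (hBZ huB).resolve_left fun h => huW (hZ.boundary h)
    by_cases hwZ : w ∈ Z
    · exact hw.resolve_right (hZ.disjoint w hwZ)
    · exact hZB ⟨hwZ, u, huZ, huw⟩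
  · rintro (_ | s)
    · exact hBcol
    · exact hcol s
  · intro Z' hZ'
    have hZ'W : ∀ z ∈ Z', z ∉ W := fun z hz h => hZ'.disjoint z hz (.inr h)
    by_cases hint : ∃ z, z ∈ Z ∧ z ∈ Z'
    · obtain ⟨z, hz, hz'⟩ := hint
      have hsub : Z' ⊆ Z := hZ.subset_of_inter hZ'.joined hZ'W hz hz'
      have hfar' : ∀ z ∈ Z', ∀ x ∈ p.support, z ≠ x ∧ ¬ G.Adj z x :=
        fun z hz => hfar z ⟨hsub hz, fun h => hZ'.disjoint z hz (.inl h)⟩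
      have hbd : G.outerBoundary Z' ⊆ B := by
        rintro u hu
        rcases hZ'.boundary hu with h | h
        · exact h
        · obtain ⟨-, z, hz, hzu⟩ := hu
          exact hZB ⟨fun huZ => hZ.disjoint u huZ h, z, hsub hz, hzu⟩
      refine ⟨⟨none, hbd⟩, .inr ⟨a, b, p, hp, hpc, hfar', fun u hu => ?_⟩⟩
      refine (hdom u (hbd hu)).resolve_left fun hup => ?_
      obtain ⟨-, z, hz, hzu⟩ := hu
      exact (hfar' z hz u hup).2 hzu
    · push Not at hint
      have hZ'' : G.IsComponentOff W Z' := by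
        refine ⟨hZ'.nonempty, hZ'W, ?_, hZ'.joined⟩
        intro u hu
        rcases hZ'.boundary hu with h | h
        · rcases hBZ h with h | h
          · exact hZ.boundary h
          · obtain ⟨-, z, hz, hzu⟩ := hu
            exact (hZ'W z hz (hZ.boundary ⟨fun hzZ => hint z hzZ hz, u, h, hzu.symm⟩)).elim
        · exact h
      obtain ⟨⟨s, hs⟩, hg⟩ := hcomp Z' hZ''
      exact ⟨⟨some s, hs⟩, hg⟩
  · exact ⟨Set.subset_union_right, fun h => hZ.disjoint x hxZ (h (.inl hxB))⟩

theorem isReachedSet_univ [Finite V] {d ℓ : ℕ} (hd : 1 ≤ d) (hl : 4 ≤ ℓ)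
    (hhole : ∀ (v : V) (C : G.Walk v v), IsHole G C → C.length ≤ ℓ)
    (hnbr : ∀ v : V, (G.induce (G.neighborSet v)).Colorable d) :
    G.IsReachedSet (d * (ℓ - 2)) Set.univ := by
  obtain ⟨W, hW⟩ := (Set.toFinite {W | G.IsReachedSet (d * (ℓ - 2)) W}).exists_maximal
    ⟨∅, isReachedSet_empty _⟩
  by_contra h
  obtain ⟨W', hW', hlt⟩ := hW.prop.exists_ssuperset hd hl hhole hnbr fun hu => h (hu ▸ hW.prop)
  exact hW.not_prop_of_gt hlt hW'

theorem colorable_of_chromNat_le [Finite V] {d : ℕ} (h : chromNat G ≤ d) : G.Colorable d := by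
  have := Fintype.ofFinite V
  exact Colorable.mono h (Nat.sInf_mem (s := {k | G.Colorable k}) ⟨_, G.colorable_of_fintype⟩)

end SimpleGraph

/-- For all integers `d ≥ 1` and `ℓ ≥ 4`, if `G` is a graph with no
hole of length greater than `ℓ` and `χ(G[N_G(v)]) ≤ d` for every vertex `v`, then
`tree-χ(G) ≤ d(ℓ − 2)`. -/
theorem stmt6 {V : Type} [Fintype V] (G : SimpleGraph V) (d ℓ : ℕ)
    (hd : 1 ≤ d) (hl : 4 ≤ ℓ)
    (hhole : ∀ (v : V) (C : G.Walk v v), IsHole G C → C.length ≤ ℓ)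
    (hnbr : ∀ v : V, chromNat (G.induce (G.neighborSet v)) ≤ d) :
    treeChi G ≤ d * (ℓ - 2) := by
  have hnbr' : ∀ v : V, (G.induce (G.neighborSet v)).Colorable d :=
    fun v => colorable_of_chromNat_le (hnbr v)
  obtain ⟨ι, hfin, T, bag, hT, hU, hcol, -⟩ := isReachedSet_univ hd hl hhole hnbr'
  have hmem : ∀ v, v ∈ ⋃ t, bag t := fun v => hU ▸ Set.mem_univ v
  let D : TreeDecomp G :=
    { ι := ι
      fin := hfin
      T := T
      isTree := hT.isTree
      bag := bag
      covers := fun u v huv => hT.covers u (hmem u) v (hmem v) huv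
      conn := fun v => hT.conn v (hmem v) }
  refine (Nat.sInf_le ⟨D, rfl⟩ : treeChi G ≤ D.chrom).trans (csSup_le' ?_)
  rintro m ⟨t, rfl⟩
  exact Nat.sInf_le (hcol t)
end

section
/- For every integer ℓ ≥ 4, if G is a triangle-free graph with no hole of length greater than ℓ, then tree-χ(G) ≤ ℓ − 2. -/
open SimpleGraph

lemma isAcyclic_sum {α β : Type} {S : SimpleGraph α} {T : SimpleGraph β}
    (hS : S.IsAcyclic) (hT : T.IsAcyclic) : (S ⊕g T).IsAcyclic := by
  rw [isAcyclic_iff_forall_adj_isBridge] at *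
  rintro (a | a) (b | b) h
  · have hb := hS (sum_adj_inl.1 h)
    rw [isBridge_iff] at hb ⊢
    intro hr
    apply hb
    suffices ∀ x y, ((S ⊕g T).deleteEdges {s(Sum.inl a, Sum.inl b)}).Reachable x y →
        ∀ c, x = Sum.inl c → ∃ d, y = Sum.inl d ∧ (S.deleteEdges {s(a, b)}).Reachable c d by
      obtain ⟨d, hd, h⟩ := this _ _ hr a rfl
      cases hd
      exact h
    rintro x y ⟨w⟩
    induction w with
    | nil => rintro c rfl; exact ⟨c, rfl, .rfl⟩
    | @cons u v w huv p ih =>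
      rintro c rfl
      rcases v with v | v
      · obtain ⟨d, hd, hr⟩ := ih v rfl
        refine ⟨d, hd, .trans (Adj.reachable ?_) hr⟩
        simpa [deleteEdges_adj] using huv
      · simp [deleteEdges_adj] at huv
  · simp at h
  · simp at h
  · have hb := hT (sum_adj_inr.1 h)
    rw [isBridge_iff] at hb ⊢
    intro hr
    apply hb
    suffices ∀ x y, ((S ⊕g T).deleteEdges {s(Sum.inr a, Sum.inr b)}).Reachable x y →
        ∀ c, x = Sum.inr c → ∃ d, y = Sum.inr d ∧ (T.deleteEdges {s(a, b)}).Reachable c d by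
      obtain ⟨d, hd, h⟩ := this _ _ hr a rfl
      cases hd
      exact h
    rintro x y ⟨w⟩
    induction w with
    | nil => rintro c rfl; exact ⟨c, rfl, .rfl⟩
    | @cons u v w huv p ih =>
      rintro c rfl
      rcases v with v | v
      · simp [deleteEdges_adj] at huv
      · obtain ⟨d, hd, hr⟩ := ih v rfl
        refine ⟨d, hd, .trans (Adj.reachable ?_) hr⟩
        simpa [deleteEdges_adj] using huv

lemma isTree_sum_sup_edge {α β : Type} {S : SimpleGraph α} {T : SimpleGraph β}
    (hS : S.IsTree) (hT : T.IsTree) (a : α) (b : β) :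
    ((S ⊕g T) ⊔ edge (Sum.inl a) (Sum.inr b)).IsTree :=
  ⟨hS.connected.sum_sup_edge hT.connected,
    (isAcyclic_sum hS.isAcyclic hT.isAcyclic).sup_edge_of_not_reachable
      (not_reachable_sum_inl_inr a b)⟩

/-- `G[S]` has a rooted tree-decomposition into `k`-colorable bags whose root bag contains `R`. -/
def RootedDecomp {V : Type} (G : SimpleGraph V) (k : ℕ) (S R : Set V) : Prop :=
  ∃ (ι : Type) (_ : Finite ι) (T : SimpleGraph ι) (r : ι) (bag : ι → Set V),
    T.IsTree ∧ (∀ t, bag t ⊆ S) ∧ R ⊆ bag r ∧ (∀ t, (G.induce (bag t)).Colorable k) ∧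
    (∀ u ∈ S, ∀ v ∈ S, G.Adj u v → ∃ t, u ∈ bag t ∧ v ∈ bag t) ∧
    ∀ v ∈ S, (T.induce {t | v ∈ bag t}).Connected

lemma RootedDecomp.single {V : Type} {G : SimpleGraph V} {k : ℕ} {B : Set V}
    (hB : (G.induce B).Colorable k) : RootedDecomp G k B B := by
  refine ⟨Unit, inferInstance, ⊥, (), fun _ ↦ B, .of_subsingleton, fun _ ↦ subset_rfl, subset_rfl,
    fun _ ↦ hB, fun u hu v hv _ ↦ ⟨(), hu, hv⟩, fun v hv ↦ ?_⟩
  have : Nonempty {t : Unit | v ∈ B} := ⟨⟨(), hv⟩⟩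
  exact .of_subsingleton

lemma connected_induce_image {α β : Type} {S : SimpleGraph α} {T : SimpleGraph β}
    (f : α → β) (hf : ∀ a b, S.Adj a b → T.Adj (f a) (f b)) {A : Set α}
    (hA : (S.induce A).Connected) : (T.induce (f '' A)).Connected := by
  refine hA.map (H := T.induce (f '' A))
    ⟨fun x : A ↦ (⟨f x, x, x.2, rfl⟩ : (f '' A : Set β)), fun {x y} h ↦ hf _ _ h⟩ ?_
  rintro ⟨_, x, hx, rfl⟩
  exact ⟨⟨x, hx⟩, rfl⟩

lemma RootedDecomp.glue {V : Type} {G : SimpleGraph V} {k : ℕ} {S₁ S₂ R₁ R₂ : Set V}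
    (h₁ : RootedDecomp G k S₁ R₁) (h₂ : RootedDecomp G k S₂ R₂)
    (hS₁ : S₁ ∩ S₂ ⊆ R₁) (hS₂ : S₁ ∩ S₂ ⊆ R₂)
    (hadj : ∀ u ∈ S₁, ∀ v ∈ S₂, G.Adj u v → u ∈ S₂ ∨ v ∈ S₁) :
    RootedDecomp G k (S₁ ∪ S₂) R₁ := by
  obtain ⟨ι₁, _, T₁, r₁, b₁, ht₁, hs₁, hr₁, hc₁, he₁, hv₁⟩ := h₁
  obtain ⟨ι₂, _, T₂, r₂, b₂, ht₂, hs₂, hr₂, hc₂, he₂, hv₂⟩ := h₂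
  have hl : ∀ v ∈ S₁, (((T₁ ⊕g T₂) ⊔ edge (Sum.inl r₁) (Sum.inr r₂)).induce
      (Sum.inl '' {t | v ∈ b₁ t})).Connected := fun v hv ↦
    connected_induce_image _ (fun a b h ↦ Or.inl (by simpa using h)) (hv₁ v hv)
  have hr : ∀ v ∈ S₂, (((T₁ ⊕g T₂) ⊔ edge (Sum.inl r₁) (Sum.inr r₂)).induce
      (Sum.inr '' {t | v ∈ b₂ t})).Connected := fun v hv ↦
    connected_induce_image _ (fun a b h ↦ Or.inl (by simpa using h)) (hv₂ v hv)
  have hset : ∀ v, {t | v ∈ Sum.elim b₁ b₂ t} =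
      Sum.inl '' {t | v ∈ b₁ t} ∪ Sum.inr '' {t | v ∈ b₂ t} := by
    intro v; ext (t | t) <;> simp
  refine ⟨ι₁ ⊕ ι₂, inferInstance, _, Sum.inl r₁, Sum.elim b₁ b₂,
    isTree_sum_sup_edge ht₁ ht₂ r₁ r₂, ?_, hr₁, ?_, ?_, ?_⟩
  · rintro (t | t)
    exacts [(hs₁ t).trans Set.subset_union_left, (hs₂ t).trans Set.subset_union_right]
  · rintro (t | t)
    exacts [hc₁ t, hc₂ t]
  · have key : ∀ u v, G.Adj u v → (u ∈ S₁ ∧ v ∈ S₁) ∨ (u ∈ S₂ ∧ v ∈ S₂) →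
        ∃ t, u ∈ Sum.elim b₁ b₂ t ∧ v ∈ Sum.elim b₁ b₂ t := by
      rintro u v h (⟨hu, hv⟩ | ⟨hu, hv⟩)
      · obtain ⟨t, ht⟩ := he₁ u hu v hv h
        exact ⟨.inl t, ht⟩
      · obtain ⟨t, ht⟩ := he₂ u hu v hv h
        exact ⟨.inr t, ht⟩
    intro u hu v hv h
    refine key u v h ?_
    have h1 := hadj u
    have h2 := hadj v
    have h3 := h.symm
    simp only [Set.mem_union] at hu hv
    grind
  · intro v hv
    rw [hset]
    by_cases h1 : v ∈ S₁ <;> by_cases h2 : v ∈ S₂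
    · exact connected_induce_union (hl v h1).preconnected (hr v h2).preconnected
        ⟨r₁, hr₁ (hS₁ ⟨h1, h2⟩), rfl⟩ ⟨r₂, hr₂ (hS₂ ⟨h1, h2⟩), rfl⟩
        (Or.inr (by simp [edge_adj]))
    · have : {t | v ∈ b₂ t} = ∅ := Set.eq_empty_of_forall_notMem fun t h ↦ h2 (hs₂ t h)
      rw [this, Set.image_empty, Set.union_empty]
      exact hl v h1
    · have : {t | v ∈ b₁ t} = ∅ := Set.eq_empty_of_forall_notMem fun t h ↦ h1 (hs₁ t h)
      rw [this, Set.image_empty, Set.empty_union]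
      exact hr v h2
    · exact absurd hv (by simp [h1, h2])

lemma RootedDecomp.treeChi_le {V : Type} {G : SimpleGraph V} {k : ℕ} {R : Set V}
    (h : RootedDecomp G k Set.univ R) : treeChi G ≤ k := by
  obtain ⟨ι, hfin, T, r, bag, hT, -, -, hc, he, hv⟩ := h
  let D : TreeDecomp G := ⟨ι, hfin, T, hT, bag, fun u v h ↦ he u trivial v trivial h,
    fun v ↦ hv v trivial⟩
  refine (Nat.sInf_le ⟨D, rfl⟩ : treeChi G ≤ D.chrom).trans ?_
  refine csSup_le ⟨_, r, rfl⟩ ?_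
  rintro _ ⟨t, rfl⟩
  exact Nat.sInf_le (hc t)

/-- The list `l` enumerates the vertices of an induced path of `G` in order. -/
def IsInducedPath {V : Type} (G : SimpleGraph V) : List V → Prop
  | [] => True
  | a :: l => a ∉ l ∧ (∀ b l', l = b :: l' → G.Adj a b ∧ ∀ c ∈ l', ¬ G.Adj a c) ∧
      IsInducedPath G l

namespace IsInducedPath

variable {V : Type} {G : SimpleGraph V}

lemma singleton (a : V) : IsInducedPath G [a] := by simp [IsInducedPath]

lemma of_append_left {l m : List V} (h : IsInducedPath G (l ++ m)) : IsInducedPath G l := by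
  induction l with
  | nil => trivial
  | cons a l ih =>
    rw [List.cons_append] at h
    obtain ⟨h1, h2, h3⟩ := h
    refine ⟨by grind, ?_, ih h3⟩
    rintro b l' rfl
    have := h2 b (l' ++ m) rfl
    grind

lemma of_append_right {l m : List V} (h : IsInducedPath G (l ++ m)) : IsInducedPath G m := by
  induction l with
  | nil => exact h
  | cons a l ih => exact ih h.2.2

lemma nodup {l : List V} (h : IsInducedPath G l) : l.Nodup := by
  induction l with
  | nil => simp
  | cons a l ih => exact List.nodup_cons.2 ⟨h.1, ih h.2.2⟩

lemma append {l m : List V} {x y : V} (hl : IsInducedPath G (l ++ [x]))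
    (hm : IsInducedPath G (y :: m)) (hdisj : ∀ a ∈ l ++ [x], a ∉ y :: m) (hxy : G.Adj x y)
    (hadj : ∀ a ∈ l ++ [x], ∀ b ∈ y :: m, G.Adj a b → a = x ∧ b = y) :
    IsInducedPath G (l ++ x :: y :: m) := by
  have hnd := hl.nodup
  induction l with
  | nil =>
    refine ⟨hdisj x (by simp), ?_, hm⟩
    intro b l' h
    obtain ⟨rfl, rfl⟩ := List.cons.inj h
    refine ⟨hxy, fun c hc h ↦ ?_⟩
    obtain ⟨-, rfl⟩ := hadj x (by simp) c (by simp [hc]) h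
    exact hm.1 hc
  | cons a l ih =>
    obtain ⟨h1, h2, h3⟩ := hl
    refine ⟨?_, ?_, ih h3 (fun c hc ↦ hdisj c (by simp at hc ⊢; tauto))
      (fun c hc ↦ hadj c (by simp at hc ⊢; tauto)) h3.nodup⟩
    · have := hdisj a (by simp)
      simp at h1 this ⊢
      tauto
    · have hax : a ≠ x := by rintro rfl; simp at h1
      have hno : ∀ c ∈ y :: m, ¬ G.Adj a c := fun c hc h ↦ hax (hadj a (by simp) c hc h).1
      rcases l with _ | ⟨d, l⟩
      · intro b l' h
        obtain ⟨rfl, rfl⟩ := List.cons.inj h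
        exact ⟨(h2 x [] rfl).1, hno⟩
      · intro b l' h
        obtain ⟨rfl, rfl⟩ := List.cons.inj h
        have := h2 d (l ++ [x]) rfl
        refine ⟨this.1, fun c hc ↦ ?_⟩
        have h4 := this.2 c
        have h5 := hno c
        simp at hc h4 h5
        grind

lemma exists_walk {a : V} {l : List V} (h : IsInducedPath G (a :: l)) :
    ∃ (b : V) (w : G.Walk a b), w.support = a :: l ∧
      ∀ x ∈ a :: l, ∀ y ∈ a :: l, G.Adj x y → s(x, y) ∈ w.edges := by
  induction l generalizing a with
  | nil =>
    refine ⟨a, .nil, rfl, fun x hx y hy hxy ↦ ?_⟩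
    simp at hx hy
    subst hx hy
    exact absurd hxy (G.loopless.irrefl _)
  | cons c l ih =>
    obtain ⟨b, w, hw, hw'⟩ := ih h.2.2
    have h2 := h.2.1 c l rfl
    refine ⟨b, .cons h2.1 w, by simp [hw], fun x hx y hy hxy ↦ ?_⟩
    rw [Walk.edges_cons, List.mem_cons]
    rcases List.mem_cons.1 hx with rfl | hxl <;> rcases List.mem_cons.1 hy with rfl | hyl
    · exact absurd hxy (G.loopless.irrefl _)
    · rcases List.mem_cons.1 hyl with rfl | hyl
      · exact .inl rfl
      · exact absurd hxy (h2.2 y hyl)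
    · rcases List.mem_cons.1 hxl with rfl | hxl
      · exact .inl Sym2.eq_swap
      · exact absurd hxy.symm (h2.2 x hxl)
    · exact .inr (hw' x hxl y hyl hxy)

lemma exists_isHole {a b y : V} {l m : List V} (h : IsInducedPath G (a :: l))
    (hb : a :: l = m ++ [b]) (hlen : 2 ≤ l.length) (hy : y ∉ a :: l) (hya : G.Adj y a)
    (hyb : G.Adj y b) (hadj : ∀ c ∈ a :: l, G.Adj y c → c = a ∨ c = b) :
    ∃ C : G.Walk y y, IsHole G C ∧ C.length = l.length + 2 := by
  obtain ⟨b', w, hw, hw'⟩ := h.exists_walk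
  obtain rfl : b' = b := by
    have := congrArg List.getLast? (hw.trans hb)
    rw [List.getLast?_eq_getLast_of_ne_nil (by simp)] at this
    simpa using this
  have hwl : w.length = l.length := by
    have := congrArg List.length hw
    simpa using this
  have hab : a ≠ b' := by
    rintro rfl
    have := h.nodup
    rw [hb] at this
    rcases m with _ | ⟨c, m⟩
    · simp at hb; simp [hb] at hlen
    · simp at hb
      simp [hb] at this
  refine ⟨.cons hya (w.concat hyb.symm), ⟨?_, ?_, ?_⟩, by simp [hwl]⟩
  · rw [Walk.cons_isCycle_iff, Walk.concat_isPath_iff, Walk.isPath_def, hw]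
    refine ⟨⟨h.nodup, hy⟩, ?_⟩
    rw [Walk.edges_concat]
    simp only [List.concat_eq_append, List.mem_append, List.mem_singleton, not_or]
    refine ⟨fun h ↦ hy (hw ▸ w.fst_mem_support_of_mem_edges h), ?_⟩
    rw [Sym2.eq_swap]
    simp [hab, hya.ne']
  · simp [hwl]; omega
  · intro u v hu hv huv
    rw [Walk.adj_toSubgraph_iff_mem_edges]
    simp only [Walk.support_cons, Walk.support_concat, hw, List.concat_eq_append, Walk.edges_cons,
      Walk.edges_concat, List.mem_cons, List.mem_append] at hu hv ⊢
    have key : ∀ c ∈ a :: l, G.Adj y c → s(y, c) = s(y, a) ∨ s(y, c) = s(b', y) := by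
      intro c hc h
      rcases hadj c hc h with rfl | rfl
      exacts [.inl rfl, .inr Sym2.eq_swap]
    have hu' : u = y ∨ u ∈ a :: l := by simp; tauto
    have hv' : v = y ∨ v ∈ a :: l := by simp; tauto
    rcases hu' with rfl | hu' <;> rcases hv' with rfl | hv'
    · exact absurd huv (G.loopless.irrefl _)
    · have := key v hv' huv
      tauto
    · have := key u hu' huv.symm
      rw [Sym2.eq_swap (a := u)]
      tauto
    · exact .inr (.inl (hw' u hu' v hv' huv))

lemma exists_of_walk {a b : V} (w : G.Walk a b) :
    ∃ l m : List V, IsInducedPath G (a :: l) ∧ a :: l = m ++ [b] ∧ ∀ c ∈ l, c ∈ w.support := by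
  classical
  induction w with
  | nil => exact ⟨[], [], singleton _, rfl, by simp⟩
  | @cons a c b h w ih =>
    obtain ⟨l, m, hl, hm, hs⟩ := ih
    have hs' : ∀ d ∈ c :: l, d ∈ w.support := by simpa using hs
    have hlast : ∀ s x t, c :: l = s ++ x :: t → ∃ m', x :: t = m' ++ [b] := by
      intro s x t hx
      refine ⟨(x :: t).dropLast, ?_⟩
      have h1 : (c :: l).getLast? = some b := by simp [hm]
      rw [hx, List.getLast?_append_of_ne_nil _ (by simp),
        List.getLast?_eq_getLast_of_ne_nil (by simp), Option.some_inj] at h1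
      rw [← h1, List.dropLast_append_getLast]
    by_cases ha : a ∈ c :: l
    · obtain ⟨s, t, hst⟩ := List.append_of_mem ha
      obtain ⟨m', hm'⟩ := hlast _ _ _ hst
      rw [hst] at hl hs'
      exact ⟨t, m', hl.of_append_right, hm', fun d hd ↦ by
        simp [hs' d (by simp [hd])]⟩
    · obtain ⟨s, x, t, hst, hx, ht⟩ : ∃ s x t, c :: l = s ++ x :: t ∧ G.Adj a x ∧
          ∀ d ∈ t, ¬ G.Adj a d := by
        have : ∃ x ∈ c :: l, G.Adj a x := ⟨c, by simp, h⟩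
        clear * - this
        generalize c :: l = L at this
        induction L with
        | nil => simp at this
        | cons x L ih =>
          by_cases hL : ∃ x ∈ L, G.Adj a x
          · obtain ⟨s, y, t, rfl, h⟩ := ih hL
            exact ⟨x :: s, y, t, rfl, h⟩
          · push Not at hL
            refine ⟨[], x, L, rfl, ?_, hL⟩
            grind
      obtain ⟨m', hm'⟩ := hlast _ _ _ hst
      rw [hst] at hl hs' ha
      refine ⟨x :: t, a :: m', ⟨by simp at ha ⊢; tauto, ?_, hl.of_append_right⟩, by simp [hm'],
        fun d hd ↦ by simp [hs' d (by simp at hd ⊢; tauto)]⟩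
      intro y t' h
      obtain ⟨rfl, rfl⟩ := List.cons.inj h
      exact ⟨hx, ht⟩

lemma exists_long_hole {P P₁ P₂ : List V} {p q y z : V} {C : Set V} (hP : IsInducedPath G P)
    (hp : P = p :: P₁) (hq : P = P₂ ++ [q]) (hyz : y ≠ z) (hyz' : ¬ G.Adj y z)
    (hyP : y ∉ P) (hzP : z ∉ P)
    (hy : ∀ c ∈ P, G.Adj y c ↔ c = q) (hz : ∀ c ∈ P, G.Adj z c ↔ c = p)
    (hCP : ∀ c ∈ C, ∀ d ∈ P, c ≠ d ∧ ¬ G.Adj c d)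
    (hC : ∀ a ∈ C, ∀ b ∈ C, ∃ w : G.Walk a b, ∀ v ∈ w.support, v ∈ C)
    (hyc : ∃ c ∈ C, G.Adj y c) (hzc : ∃ c ∈ C, G.Adj z c) :
    ∃ (v : V) (H : G.Walk v v), IsHole G H ∧ P.length + 3 ≤ H.length := by
  obtain ⟨c, hc, hyc⟩ := hyc
  obtain ⟨d, hd, hzd⟩ := hzc
  obtain ⟨w, hw⟩ := hC c hc d hd
  obtain ⟨l, m, hl, hm, hs⟩ := exists_of_walk (Walk.cons hyc (w.concat hzd.symm))
  have hs : ∀ v ∈ l, v = y ∨ v ∈ C ∨ v = z := by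
    intro v hv
    have := hs v hv
    have h2 := hw v
    simp [Walk.support_concat] at this
    tauto
  rcases m with _ | ⟨_, m⟩
  · simp at hm; exact absurd hm.1 hyz
  rw [List.cons_append, List.cons.injEq] at hm
  obtain ⟨rfl, rfl⟩ := hm
  rcases m with _ | ⟨x, m⟩
  · exact absurd (hl.2.1 z [] rfl).1 hyz'
  rw [List.cons_append] at hs hl
  obtain ⟨hyl, hl2, hl3⟩ := hl
  have hx := hl2 x (m ++ [z]) rfl
  have hnd := hl3.nodup
  have hmC : ∀ v ∈ x :: m, v ∈ C := by
    intro v hv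
    rcases hs v (List.mem_append_left _ hv) with rfl | h | rfl
    · exact absurd (List.mem_append_left _ hv) hyl
    · exact h
    · rw [← List.cons_append, List.nodup_append] at hnd
      exact absurd rfl (hnd.2.2 v hv v (by simp))
  have hall : IsInducedPath G ((x :: m) ++ z :: p :: P₁) := by
    refine append hl3 (hp ▸ hP) ?_ ((hz p (by simp [hp])).2 rfl) ?_ <;> rw [← hp]
    · intro a ha hP
      rcases List.mem_append.1 ha with ha | ha
      · exact (hCP a (hmC a ha) a hP).1 rfl
      · simp at ha; exact hzP (ha ▸ hP)
    · intro a ha b hb hab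
      rcases List.mem_append.1 ha with ha | ha
      · exact absurd hab (hCP a (hmC a ha) b hb).2
      · simp at ha
        subst ha
        exact ⟨rfl, (hz b hb).1 hab⟩
  rw [← hp, List.cons_append] at hall
  obtain ⟨H, hH, hHl⟩ := exists_isHole (y := y) (b := q) (m := x :: m ++ z :: P₂) hall (by simp [hq])
    (by simp [hp]; omega) (by
      have : y ∉ m ∧ y ≠ x := by simp at hyl; tauto
      simp; tauto) hx.1 ((hy q (by simp [hq])).2 rfl) (by
      intro c hc hyc
      rw [← List.cons_append, List.mem_append, List.mem_cons, List.mem_cons] at hc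
      rcases hc with (rfl | hc) | rfl | hc
      · exact .inl rfl
      · exact absurd hyc (hx.2 c (by simp [hc]))
      · exact absurd hyc hyz'
      · exact .inr ((hy c hc).1 hyc))
  exact ⟨y, H, hH, by simp [hHl]⟩

end IsInducedPath

section

variable {V : Type} {G : SimpleGraph V}

lemma not_adj_of_cliqueFree_three (h : G.CliqueFree 3) {a b c : V} (hab : G.Adj a b)
    (hac : G.Adj a c) : ¬ G.Adj b c := by
  classical
  exact fun hbc ↦ h {a, b, c} (is3Clique_triple_iff.2 ⟨hab, hac, hbc⟩)

lemma colorable_of_subset_neighbors (h : G.CliqueFree 3) {B : Set V} {P : List V}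
    (hB : ∀ v ∈ B, ∃ p ∈ P, G.Adj v p) : (G.induce B).Colorable P.length := by
  have : ∀ v : B, ∃ i : Fin P.length, G.Adj v P[i] := by
    rintro ⟨v, hv⟩
    obtain ⟨p, hp, hvp⟩ := hB v hv
    obtain ⟨i, hi, rfl⟩ := List.getElem_of_mem hp
    exact ⟨⟨i, hi⟩, hvp⟩
  choose f hf using this
  refine ⟨Coloring.mk f fun {u v} huv he ↦ ?_⟩
  have hv := hf v
  rw [← he] at hv
  exact not_adj_of_cliqueFree_three h (hf u).symm hv.symm huv

lemma colorable_two_of_subset_closed_neighbors (h : G.CliqueFree 3) {B : Set V} {y : V}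
    (hB : ∀ v ∈ B, v = y ∨ G.Adj v y) : (G.induce B).Colorable 2 := by
  classical
  refine ⟨Coloring.mk (fun v ↦ if v.1 = y then (0 : Fin 2) else 1) fun {u v} huv he ↦ ?_⟩
  have huv : G.Adj u v := huv
  have hu := hB u u.2
  have hv := hB v v.2
  have hne := huv.ne
  by_cases h1 : u.1 = y <;> by_cases h2 : v.1 = y
  · exact hne (h1.trans h2.symm)
  · simp [h1, h2] at he
  · simp [h1, h2] at he
  · exact not_adj_of_cliqueFree_three h (hu.resolve_left h1).symm (hv.resolve_left h2).symm huv

lemma exists_extension {ℓ : ℕ} (hl : 4 ≤ ℓ) (htri : G.CliqueFree 3)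
    (hhole : ∀ (v : V) (C : G.Walk v v), IsHole G C → C.length ≤ ℓ) {C : Set V}
    (hne : C.Nonempty) (hC : ∀ a ∈ C, ∀ b ∈ C, ∃ w : G.Walk a b, ∀ v ∈ w.support, v ∈ C)
    (P : List V) (hP : IsInducedPath G P) (hPl : P.length ≤ ℓ - 2)
    (hCP : ∀ c ∈ C, ∀ p ∈ P, c ≠ p ∧ ¬ G.Adj c p)
    (hdom : ∀ u ∉ C, ∀ c ∈ C, G.Adj u c → ∃ p ∈ P, G.Adj u p) :
    ∃ (y : V) (P' : List V), IsInducedPath G P' ∧ P'.length ≤ ℓ - 2 ∧ y ∈ P' ∧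
      (y ∈ C ∨ ∃ c ∈ C, G.Adj y c) ∧
      (∀ c ∈ C, ∀ p ∈ P', p ≠ y → c ≠ p ∧ ¬ G.Adj c p) ∧
      (∀ u ∉ C, ∀ c ∈ C, G.Adj u c → ∃ p ∈ P', G.Adj u p) ∧
      ∀ B : Set V, (∀ v ∈ B, v = y ∨ G.Adj v y ∨ v ∉ C ∧ ∃ c ∈ C, G.Adj v c) →
        (G.induce B).Colorable (ℓ - 2) := by
  by_cases hN : ∃ u ∉ C, ∃ c ∈ C, G.Adj u c
  swap
  · push Not at hN
    obtain ⟨y, hy⟩ := hne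
    refine ⟨y, [y], .singleton y, by simp; omega, by simp, .inl hy, by simp,
      fun u hu c hc h ↦ absurd h (hN u hu c hc), fun B hB ↦ ?_⟩
    refine (colorable_two_of_subset_closed_neighbors htri (y := y) fun v hv ↦ ?_).mono
      (by omega : 2 ≤ ℓ - 2)
    rcases hB v hv with h | h | ⟨hv, c, hc, h⟩
    exacts [.inl h, .inr h, absurd h (hN v hv c hc)]
  induction P using List.reverseRecOn with
  | nil =>
    obtain ⟨u, hu, c, hc, h⟩ := hN
    simpa using hdom u hu c hc h
  | append_singleton P₂ q ih =>
    by_cases hred : ∀ u ∉ C, ∀ c ∈ C, G.Adj u c → ∃ p ∈ P₂, G.Adj u p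
    · exact ih hP.of_append_left (by simp at hPl; omega)
        (fun c hc p hp ↦ hCP c hc p (by simp [hp])) hred
    push Not at hred
    obtain ⟨y, hyC, c, hc, hyc, hy⟩ := hred
    have hyq : G.Adj y q := by
      obtain ⟨p, hp, h⟩ := hdom y hyC c hc hyc
      rcases List.mem_append.1 hp with hp | hp
      · exact absurd h (hy p hp)
      · simpa using List.mem_singleton.1 hp ▸ h
    have hout : ∀ u, ∀ c ∈ C, G.Adj u c → u ∉ P₂ ++ [q] := fun u c hc h hu ↦
      (hCP c hc u hu).2 h.symm
    have hP' : IsInducedPath G (P₂ ++ [q] ++ [y]) := by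
      rw [List.append_assoc]
      refine hP.append (.singleton y) ?_ hyq.symm ?_
      · intro a ha hay
        exact hout y c hc hyc (List.mem_singleton.1 hay ▸ ha)
      · intro a ha b hb hab
        obtain rfl := List.mem_singleton.1 hb
        refine ⟨?_, rfl⟩
        rcases List.mem_append.1 ha with ha | ha
        · exact absurd hab.symm (hy a ha)
        · exact List.mem_singleton.1 ha
    have finish : ∀ Q, IsInducedPath G (Q ++ [y]) → Q.length + 1 ≤ ℓ - 2 → q ∈ Q →
        (∀ p ∈ Q, p ∈ P₂ ++ [q]) →
        (∀ u ∉ C, ∀ c ∈ C, G.Adj u c → ∃ p ∈ Q ++ [y], G.Adj u p) →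
        ∃ (y : V) (P' : List V), IsInducedPath G P' ∧ P'.length ≤ ℓ - 2 ∧ y ∈ P' ∧
        (y ∈ C ∨ ∃ c ∈ C, G.Adj y c) ∧
        (∀ c ∈ C, ∀ p ∈ P', p ≠ y → c ≠ p ∧ ¬ G.Adj c p) ∧
        (∀ u ∉ C, ∀ c ∈ C, G.Adj u c → ∃ p ∈ P', G.Adj u p) ∧
        ∀ B : Set V, (∀ v ∈ B, v = y ∨ G.Adj v y ∨ v ∉ C ∧ ∃ c ∈ C, G.Adj v c) →
          (G.induce B).Colorable (ℓ - 2) := by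
      intro Q hQ hlen hqQ hQP hQdom
      refine ⟨y, Q ++ [y], hQ, by simpa using hlen, by simp, .inr ⟨c, hc, hyc⟩, ?_, hQdom,
        fun B hB ↦ ?_⟩
      · intro c hc p hp hpy
        have hp : p ∈ Q := by simpa [hpy] using hp
        exact hCP c hc p (hQP p hp)
      · refine (colorable_of_subset_neighbors htri (P := Q ++ [y]) fun v hv ↦ ?_).mono
          (by simpa using hlen)
        rcases hB v hv with rfl | h | ⟨hv, c, hc, h⟩
        exacts [⟨q, by simp [hqQ], hyq⟩, ⟨y, by simp, h⟩, hQdom v hv c hc h]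
    by_cases hshort : (P₂ ++ [q]).length + 1 ≤ ℓ - 2
    · refine finish (P₂ ++ [q]) hP' hshort (by simp) (fun p hp ↦ hp) fun u hu c hc h ↦ ?_
      obtain ⟨p, hp, h⟩ := hdom u hu c hc h
      exact ⟨p, List.mem_append_left _ hp, h⟩
    rcases P₂ with _ | ⟨p, P₃⟩
    · simp at hshort; omega
    refine finish (P₃ ++ [q]) hP'.2.2 (by simp at hPl ⊢; omega) (by simp)
      (fun p hp ↦ List.mem_cons_of_mem _ hp) fun z hz d hd hzd ↦ ?_
    by_contra! hcon
    have hzP : ∀ x ∈ P₃ ++ [q], ¬ G.Adj z x := fun x hx ↦ hcon x (List.mem_append_left _ hx)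
    have hzp : G.Adj z p := by
      obtain ⟨x, hx, h⟩ := hdom z hz d hd hzd
      rcases List.mem_cons.1 hx with rfl | hx
      · exact h
      · exact absurd h (hzP x hx)
    obtain ⟨v, H, hH, hlen⟩ := hP.exists_long_hole (y := y) (z := z) rfl rfl
      (by rintro rfl; exact hy p (by simp) hzp)
      (fun h ↦ hcon y (by simp) h.symm) (hout y c hc hyc) (hout z d hd hzd)
      (fun x hx ↦ ⟨fun h ↦ by
        rcases List.mem_append.1 hx with hx | hx
        · exact absurd h (hy x hx)
        · exact List.mem_singleton.1 hx, fun h ↦ h ▸ hyq⟩)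
      (fun x hx ↦ ⟨fun h ↦ by
        rcases List.mem_cons.1 hx with rfl | hx
        · rfl
        · exact absurd h (hzP x hx), fun h ↦ h ▸ hzp⟩)
      hCP hC ⟨c, hc, hyc⟩ ⟨d, hd, hzd⟩
    have := hhole v H hH
    omega

lemma exists_component {D : Set V} (hD : D.Nonempty) : ∃ C ⊆ D, C.Nonempty ∧
    (∀ a ∈ C, ∀ b ∈ C, ∃ w : G.Walk a b, ∀ v ∈ w.support, v ∈ C) ∧
    ∀ u ∈ D, ∀ c ∈ C, G.Adj u c → u ∈ C := by
  classical
  obtain ⟨d, hd⟩ := hD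
  refine ⟨{v | ∃ w : G.Walk d v, ∀ u ∈ w.support, u ∈ D}, ?_, ⟨d, .nil, by simpa⟩, ?_, ?_⟩
  · rintro v ⟨w, hw⟩
    exact hw v w.end_mem_support
  · have key : ∀ a, ∀ w : G.Walk d a, (∀ u ∈ w.support, u ∈ D) →
        ∀ v ∈ w.support, ∃ w : G.Walk d v, ∀ u ∈ w.support, u ∈ D := fun a w hw v hv ↦
      ⟨w.takeUntil v hv, fun u hu ↦ hw u (w.support_takeUntil_subset_support hv hu)⟩
    rintro a ⟨w, hw⟩ b ⟨w', hw'⟩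
    refine ⟨w.reverse.append w', fun v hv ↦ ?_⟩
    rw [Walk.mem_support_append_iff, Walk.support_reverse, List.mem_reverse] at hv
    rcases hv with hv | hv
    exacts [key a w hw v hv, key b w' hw' v hv]
  · rintro u hu c ⟨w, hw⟩ h
    refine ⟨w.concat h.symm, fun v hv ↦ ?_⟩
    simp only [Walk.support_concat, List.mem_append, List.mem_singleton] at hv
    rcases hv with hv | rfl
    exacts [hw v hv, hu]

lemma exists_rootedDecomp [Fintype V] {ℓ : ℕ} (hl : 4 ≤ ℓ) (htri : G.CliqueFree 3)
    (hhole : ∀ (v : V) (C : G.Walk v v), IsHole G C → C.length ≤ ℓ) (n : ℕ) :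
    ∀ (D B : Set V) (P : List V), D.ncard ≤ n → IsInducedPath G P → P.length ≤ ℓ - 2 →
    (∀ d ∈ D, ∀ p ∈ P, d ≠ p ∧ ¬ G.Adj d p) →
    (∀ u ∉ D, ∀ d ∈ D, G.Adj u d → u ∈ B ∧ ∃ p ∈ P, G.Adj u p) →
    Disjoint D B → (G.induce B).Colorable (ℓ - 2) → RootedDecomp G (ℓ - 2) (B ∪ D) B := by
  induction n with
  | zero =>
    intro D B P hn _ _ _ _ _ hB
    obtain rfl := (Set.ncard_eq_zero D.toFinite).1 (Nat.le_zero.1 hn)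
    rw [Set.union_empty]
    exact .single hB
  | succ n ih =>
    intro D B P hn hP hPl hDP hdom hDB hB
    rcases D.eq_empty_or_nonempty with rfl | hD
    · rw [Set.union_empty]
      exact .single hB
    obtain ⟨C, hCD, hne, hC, hcl⟩ := exists_component (G := G) hD
    have hout : ∀ u ∉ C, ∀ c ∈ C, G.Adj u c → u ∉ D := fun u hu c hc h hu' ↦
      hu (hcl u hu' c hc h)
    obtain ⟨y, P', hP', hPl', hyP', hyC, hCP', hdom', hcol⟩ := exists_extension hl htri hhole hne hC
      P hP hPl (fun c hc ↦ hDP c (hCD hc))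
      (fun u hu c hc h ↦ (hdom u (hout u hu c hc h) c (hCD hc) h).2)
    have hcard : ∀ E ⊆ D, (∃ x ∈ D, x ∉ E) → E.ncard ≤ n := by
      rintro E hE ⟨x, hx, hxE⟩
      have : E.ncard < D.ncard := Set.ncard_lt_ncard ⟨hE, fun h ↦ hxE (h hx)⟩
      omega
    set N : Set V := {v | v ∉ C ∧ ∃ c ∈ C, G.Adj v c}
    set B' : Set V := N ∪ {v ∈ C | v = y ∨ G.Adj v y}
    set D' : Set V := {v ∈ C | v ≠ y ∧ ¬ G.Adj v y}
    have hrest : RootedDecomp G (ℓ - 2) (B ∪ (D \ C)) B := by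
      refine ih _ _ P (hcard _ Set.sdiff_subset ?_) hP hPl (fun d hd ↦ hDP d hd.1) ?_
        (hDB.mono_left Set.sdiff_subset) hB
      · obtain ⟨c, hc⟩ := hne
        exact ⟨c, hCD hc, fun h ↦ h.2 hc⟩
      · intro u hu d hd h
        refine hdom u (fun huD ↦ ?_) d hd.1 h
        have huC : u ∈ C := by by_contra huC; exact hu ⟨huD, huC⟩
        exact hd.2 (hcl d hd.1 u huC h.symm)
    have hcomp : RootedDecomp G (ℓ - 2) (B' ∪ D') B' := by
      refine ih _ _ P' (hcard _ (fun v hv ↦ hCD hv.1) ?_) hP' hPl' ?_ ?_ ?_ (hcol _ ?_)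
      · rcases hyC with hy | ⟨c, hc, hyc⟩
        · exact ⟨y, hCD hy, fun h ↦ h.2.1 rfl⟩
        · exact ⟨c, hCD hc, fun h ↦ h.2.2 hyc.symm⟩
      · intro d hd p hp
        by_cases hpy : p = y
        · exact hpy ▸ hd.2
        · exact hCP' d hd.1 p hp hpy
      · intro u hu d hd h
        by_cases huC : u ∈ C
        · have huy : u = y ∨ G.Adj u y := by
            by_contra! hcon
            exact hu ⟨huC, hcon⟩
          refine ⟨.inr ⟨huC, huy⟩, y, hyP', huy.resolve_left ?_⟩
          rintro rfl
          exact hd.2.2 h.symm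
        · exact ⟨.inl ⟨huC, d, hd.1, h⟩, hdom' u huC d hd.1 h⟩
      · rw [Set.disjoint_left]
        rintro v ⟨hv, h1, h2⟩ (h | h)
        · exact h.1 hv
        · exact h.2.elim h1 h2
      · rintro v (h | h)
        · exact .inr (.inr h)
        · exact h.2.imp_right .inl
    have hunion : B' ∪ D' = C ∪ N := by
      ext v
      simp only [B', D', Set.mem_union, Set.mem_ofPred_eq]
      tauto
    have hNB : N ⊆ B := fun u ⟨hu, c, hc, h⟩ ↦ (hdom u (hout u hu c hc h) c (hCD hc) h).1
    have hinter : (B ∪ (D \ C)) ∩ (B' ∪ D') ⊆ N := by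
      rw [hunion]
      rintro v ⟨h1, h2 | h2⟩
      · rcases h1 with h1 | h1
        · exact absurd h1 (Set.disjoint_left.1 hDB (hCD h2))
        · exact absurd h2 h1.2
      · exact h2
    have := hrest.glue hcomp (hinter.trans hNB) (hinter.trans Set.subset_union_left) (by
      rw [hunion]
      rintro u hu v (hv | hv) h
      · by_cases huC : u ∈ C
        exacts [.inl (.inl huC), .inl (.inr ⟨huC, v, hv, h⟩)]
      · exact .inr (.inl (hNB hv)))
    convert this using 1
    rw [hunion]
    ext v
    have h1 := @hCD v
    have h2 := @hNB v
    simp only [Set.mem_union, Set.mem_sdiff]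
    tauto

end

/-- For every integer `ℓ ≥ 4`, if `G` is a triangle-free graph with
no hole of length greater than `ℓ`, then `tree-χ(G) ≤ ℓ − 2`. -/
theorem stmt7 {V : Type} [Fintype V] (G : SimpleGraph V) (ℓ : ℕ) (hl : 4 ≤ ℓ)
    (htri : G.CliqueFree 3)
    (hhole : ∀ (v : V) (C : G.Walk v v), IsHole G C → C.length ≤ ℓ) :
    treeChi G ≤ ℓ - 2 := by
  have h := exists_rootedDecomp hl htri hhole _ Set.univ ∅ [] le_rfl trivial (by simp) (by simp)
    (by simp) (by simp) (.of_isEmpty _)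
  rw [Set.empty_union] at h
  exact h.treeChi_le
end

section
/- Let G be a finite graph with at least one vertex and let (T, {B_t : t ∈ V(T)}) be a tree-decomposition of G whose chromatic number equals tree-χ(G) and, subject to this, with |V(T)| minimal. Then there exist a vertex v ∈ V(G) and a node ℓ ∈ V(T) such that N_G[v] ⊆ B_ℓ. -/
open SimpleGraph

/-- Connectedness passes along a surjection sending adjacent vertices to reachable ones. -/
theorem SimpleGraph.Connected.of_surjective {α β : Type*} {G : SimpleGraph α} {H : SimpleGraph β}
    (hG : G.Connected) (f : α → β) (hf : Function.Surjective f)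
    (h : ∀ a b, G.Adj a b → H.Reachable (f a) (f b)) : H.Connected := by
  have key : ∀ {a b : α}, G.Walk a b → H.Reachable (f a) (f b) := by
    intro a b w
    induction w with
    | nil => exact Reachable.refl _
    | cons hab _ ih => exact (h _ _ hab).trans ih
  have : Nonempty β := hG.nonempty.map f
  refine ⟨fun x y => ?_⟩
  obtain ⟨a, rfl⟩ := hf x
  obtain ⟨b, rfl⟩ := hf y
  exact (hG.preconnected a b).elim key

namespace TreeDecomp

variable {V : Type} {G : SimpleGraph V}

/-- Deleting a leaf whose bag is contained in the bag of its neighbour. -/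
def deleteLeaf (D : TreeDecomp G) {l p : D.ι} [Fintype (D.T.neighborSet l)]
    (hdeg : D.T.degree l = 1) (hlp : D.T.Adj l p) (hp : ∀ t, D.T.Adj l t → t = p)
    (hsub : D.bag l ⊆ D.bag p) : TreeDecomp G where
  ι := ({l}ᶜ : Set D.ι)
  fin := have := D.fin; inferInstance
  T := D.T.induce {l}ᶜ
  isTree := ⟨D.isTree.connected.induce_compl_singleton_of_degree_eq_one hdeg,
    D.isTree.isAcyclic.induce _⟩
  bag t := D.bag t.1
  covers u v huv := by
    obtain ⟨t, hu, hv⟩ := D.covers huv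
    by_cases ht : t = l
    · subst ht
      exact ⟨⟨p, hlp.ne'⟩, hsub hu, hsub hv⟩
    · exact ⟨⟨t, ht⟩, hu, hv⟩
  conn v := by
    classical
    refine (D.conn v).of_surjective (fun t => if ht : t.1 = l then
      ⟨⟨p, hlp.ne'⟩, hsub (ht ▸ t.2)⟩ else ⟨⟨t.1, ht⟩, t.2⟩) ?_ ?_
    · rintro ⟨⟨t, ht⟩, htv⟩
      exact ⟨⟨t, htv⟩, dif_neg ht⟩
    · rintro ⟨a, ha⟩ ⟨b, hb⟩ hab
      replace hab : D.T.Adj a b := hab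
      by_cases h1 : a = l
      · subst h1
        obtain rfl := hp b hab
        simp [hab.ne']
      · by_cases h2 : b = l
        · subst h2
          obtain rfl := hp a hab.symm
          simp [hab.ne]
        · simp only [h1, h2, dite_false]
          exact Adj.reachable hab

theorem chrom_deleteLeaf_le (D : TreeDecomp G) {l p : D.ι} [Fintype (D.T.neighborSet l)]
    (hdeg : D.T.degree l = 1) (hlp : D.T.Adj l p) (hp : ∀ t, D.T.Adj l t → t = p)
    (hsub : D.bag l ⊆ D.bag p) : (D.deleteLeaf hdeg hlp hp hsub).chrom ≤ D.chrom := by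
  have := D.fin
  refine csSup_le_csSup (Set.finite_range fun t => chromNat (G.induce (D.bag t))).bddAbove
    ⟨_, ⟨p, hlp.ne'⟩, rfl⟩ ?_
  rintro _ ⟨t, rfl⟩
  exact ⟨t.1, rfl⟩

/-- A vertex in a single bag has its closed neighbourhood in that bag. -/
theorem mem_bag_of_adj_of_forall_eq (D : TreeDecomp G) {v : V} {l : D.ι}
    (hv : ∀ t, v ∈ D.bag t → t = l) {u : V} (huv : G.Adj v u) : u ∈ D.bag l := by
  obtain ⟨t, ht, hu⟩ := D.covers huv
  exact hv t ht ▸ hu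

end TreeDecomp

/-- Let `G` be a finite graph with at least one vertex, and let `D`
be a tree-decomposition of `G` whose chromatic number equals `tree-χ(G)` and which,
subject to this, has the minimum number of tree nodes.  Then some bag of `D` contains
the closed neighbourhood of some vertex of `G`. -/
theorem stmt8 {V : Type} [Fintype V] [Nonempty V] (G : SimpleGraph V)
    (D : TreeDecomp G) (hopt : D.chrom = treeChi G)
    (hmin : ∀ D' : TreeDecomp G, D'.chrom = treeChi G → Nat.card D.ι ≤ Nat.card D'.ι) :
    ∃ (v : V) (t : D.ι), v ∈ D.bag t ∧ ∀ u, G.Adj v u → u ∈ D.bag t := by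
  classical
  have := D.fin
  have := Fintype.ofFinite D.ι
  rcases subsingleton_or_nontrivial D.ι with _ | _
  · obtain ⟨v⟩ := ‹Nonempty V›
    obtain ⟨⟨l, hl⟩⟩ := (D.conn v).nonempty
    exact ⟨v, l, hl, fun u => D.mem_bag_of_adj_of_forall_eq fun t _ => Subsingleton.elim t l⟩
  obtain ⟨l, hdeg⟩ := D.isTree.exists_vert_degree_one_of_nontrivial
  obtain ⟨p, hlp, hp⟩ := degree_eq_one_iff_existsUnique_adj.mp hdeg
  by_cases hsub : D.bag l ⊆ D.bag p
  · have hle := D.chrom_deleteLeaf_le hdeg hlp hp hsub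
    have hcard := hmin (D.deleteLeaf hdeg hlp hp hsub)
      ((hle.trans_eq hopt).antisymm (Nat.sInf_le ⟨_, rfl⟩))
    have hlt : Nat.card ({l}ᶜ : Set D.ι) < Nat.card D.ι :=
      Finite.card_subtype_lt (x := l) (by simp)
    exact absurd hcard hlt.not_ge
  · obtain ⟨v, hvl, hvp⟩ := Set.not_subset.mp hsub
    refine ⟨v, l, hvl, fun u => D.mem_bag_of_adj_of_forall_eq fun t ht => ?_⟩
    by_contra hne
    have : Nontrivial {t | v ∈ D.bag t} :=
      ⟨⟨l, hvl⟩, ⟨t, ht⟩, fun h => hne (congrArg Subtype.val h).symm⟩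
    obtain ⟨⟨q, hq⟩, hlq⟩ := (D.conn v).preconnected.exists_adj_of_nontrivial ⟨l, hvl⟩
    exact hvp (hp q hlq ▸ hq)
end

section
/- Every graph with no K_5-minor has tree-chromatic number at most 4. -/
open SimpleGraph

/-- `H` is a minor of `G`: there is a family of branch sets in `G`, one for each
vertex of `H`, which are connected, pairwise disjoint, and joined by an edge of `G`
whenever the corresponding vertices are adjacent in `H`. -/
def HasMinor {V W : Type} (G : SimpleGraph V) (H : SimpleGraph W) : Prop :=
  ∃ b : W → Set V,
    (∀ w, (G.induce (b w)).Connected) ∧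
    (Pairwise fun w₁ w₂ => Disjoint (b w₁) (b w₂)) ∧
    (∀ ⦃w₁ w₂ : W⦄, H.Adj w₁ w₂ → ∃ u ∈ b w₁, ∃ v ∈ b w₂, G.Adj u v)

/-- A model of a complete graph: the branch sets are connected, pairwise disjoint and
pairwise joined by an edge. -/
def IsCliqueModel {V W : Type} (G : SimpleGraph V) (b : W → Set V) : Prop :=
  (∀ w, (G.induce (b w)).Connected) ∧
    (Pairwise fun w₁ w₂ => Disjoint (b w₁) (b w₂)) ∧
    (Pairwise fun w₁ w₂ => ∃ u ∈ b w₁, ∃ v ∈ b w₂, G.Adj u v)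

theorem IsCliqueModel.hasMinor {V W : Type} {G : SimpleGraph V} {b : W → Set V}
    (hb : IsCliqueModel G b) : HasMinor G (⊤ : SimpleGraph W) :=
  ⟨b, hb.1, hb.2.1, fun _ _ h => hb.2.2 h.ne⟩

theorem HasMinor.exists_isCliqueModel {V W : Type} {G : SimpleGraph V}
    (h : HasMinor G (⊤ : SimpleGraph W)) : ∃ b : W → Set V, IsCliqueModel G b := by
  obtain ⟨b, h₁, h₂, h₃⟩ := h
  exact ⟨b, h₁, h₂, fun _ _ hne => h₃ ((top_adj _ _).2 hne)⟩

theorem IsCliqueModel.cons {V : Type} {G : SimpleGraph V} {n : ℕ} {b : Fin n → Set V}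
    (hb : IsCliqueModel G b) {S : Set V} (hS : (G.induce S).Connected)
    (hdisj : ∀ i, Disjoint S (b i)) (hadj : ∀ i, ∃ u ∈ S, ∃ v ∈ b i, G.Adj u v) :
    IsCliqueModel G (Fin.cons S b : Fin (n + 1) → Set V) := by
  refine ⟨fun i => ?_, fun i j hij => ?_, fun i j hij => ?_⟩
  · refine Fin.cases ?_ (fun i => ?_) i
    · exact hS
    · exact hb.1 i
  · induction i using Fin.cases with
    | zero =>
      induction j using Fin.cases with
      | zero => exact absurd rfl hij
      | succ j => simpa using hdisj j
    | succ i =>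
      induction j using Fin.cases with
      | zero => simpa using (hdisj i).symm
      | succ j => simpa using hb.2.1 (fun h => hij (congrArg Fin.succ h))
  · induction i using Fin.cases with
    | zero =>
      induction j using Fin.cases with
      | zero => exact absurd rfl hij
      | succ j => simpa using hadj j
    | succ i =>
      induction j using Fin.cases with
      | zero =>
        obtain ⟨u, hu, v, hv, huv⟩ := hadj i
        exact ⟨v, by simpa using hv, u, by simpa using hu, huv.symm⟩
      | succ j => simpa using hb.2.2 (fun h => hij (congrArg Fin.succ h))

theorem connected_induce_image_val {V : Type} {G : SimpleGraph V} {U : Set V} {s : Set U}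
    (hs : ((G.induce U).induce s).Connected) :
    (G.induce (Subtype.val '' s)).Connected := by
  let φ : (G.induce U).induce s →g G.induce (Subtype.val '' s) :=
    ⟨fun x => ⟨x.1.1, x.1, x.2, rfl⟩, fun h => h⟩
  refine hs.map φ ?_
  rintro ⟨_, x, hx, rfl⟩
  exact ⟨⟨x, hx⟩, rfl⟩

theorem IsCliqueModel.image_val {V W : Type} {G : SimpleGraph V} {U : Set V} {b : W → Set U}
    (hb : IsCliqueModel (G.induce U) b) : IsCliqueModel G fun w => Subtype.val '' b w := by
  refine ⟨fun w => connected_induce_image_val (hb.1 w), fun w₁ w₂ hne => ?_, fun w₁ w₂ hne => ?_⟩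
  · exact (Set.disjoint_image_iff Subtype.val_injective).2 (hb.2.1 hne)
  · obtain ⟨u, hu, v, hv, huv⟩ := hb.2.2 hne
    exact ⟨u, ⟨u, hu, rfl⟩, v, ⟨v, hv, rfl⟩, huv⟩

theorem connected_induce_insert {V : Type} {G : SimpleGraph V} {S : Set V} {s x : V}
    (hS : (G.induce S).Connected) (hs : s ∈ S) (h : G.Adj s x) :
    (G.induce (insert x S)).Connected := by
  rw [Set.insert_eq, Set.union_comm]
  exact connected_induce_union hS.preconnected (by simp) hs rfl h

theorem connected_induce_image_Ico {V : Type} {G : SimpleGraph V} {f : ℕ → V} {i j : ℕ}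
    (hij : i < j) (hf : ∀ m, i ≤ m → m + 1 < j → G.Adj (f m) (f (m + 1))) :
    (G.induce (f '' Set.Ico i j)).Connected := by
  induction j, hij using Nat.le_induction with
  | base =>
    have : Set.Ico i i.succ = {i} := by ext; simp; omega
    rw [this, Set.image_singleton]
    simp
  | succ j hij ih =>
    have hj : Set.Ico i (j + 1) = insert j (Set.Ico i j) := by
      ext; simp at *; omega
    rw [hj, Set.image_insert_eq]
    obtain ⟨k, rfl⟩ : ∃ k, j = k + 1 := ⟨j - 1, by simp at hij; omega⟩
    exact connected_induce_insert (ih fun m h₁ h₂ => hf m h₁ (by omega))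
      ⟨k, ⟨by simp at hij; omega, by omega⟩, rfl⟩
      (hf k (by simp at hij; omega) (by omega))

/-- A cycle splits into three arcs, the vertices at positions `i < j < k` lying in
different arcs. -/
theorem SimpleGraph.Walk.IsCycle.exists_arcs {V : Type} {G : SimpleGraph V} {v : V}
    {c : G.Walk v v} (hc : c.IsCycle) {i j k : ℕ} (hij : i < j) (hjk : j < k)
    (hk : k < c.length) :
    ∃ b : Fin 3 → Set V, IsCliqueModel G b ∧ (∀ w, b w ⊆ {x | x ∈ c.support}) ∧
      c.getVert i ∈ b 0 ∧ c.getVert j ∈ b 1 ∧ c.getVert k ∈ b 2 := by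
  have hadj : ∀ m, m < c.length → G.Adj (c.getVert m) (c.getVert (m + 1)) :=
    fun m hm => c.adj_getVert_succ hm
  have hinj := hc.getVert_injOn'
  have hd : ∀ {p q r s : ℕ}, q ≤ r → s ≤ c.length →
      Disjoint (c.getVert '' Set.Ico p q) (c.getVert '' Set.Ico r s) := by
    intro p q r s hqr hs
    rw [Set.disjoint_left]
    rintro _ ⟨x, hx, rfl⟩ ⟨y, hy, hxy⟩
    simp only [Set.mem_Ico] at hx hy
    have := hinj (x₁ := y) (x₂ := x) (by simp only [Set.mem_ofPred_eq]; omega)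
      (by simp only [Set.mem_ofPred_eq]; omega) hxy
    omega
  have hA : ∀ {p q r : ℕ}, p < q → q < r → r ≤ c.length →
      ∃ u ∈ c.getVert '' Set.Ico p q, ∃ w ∈ c.getVert '' Set.Ico q r, G.Adj u w := by
    intro p q r hpq hqr hr
    refine ⟨_, ⟨q - 1, ⟨by omega, by omega⟩, rfl⟩, _, ⟨q, ⟨le_rfl, hqr⟩, rfl⟩, ?_⟩
    have := hadj (q - 1) (by omega)
    rwa [Nat.sub_add_cancel (by omega)] at this
  have hL : ∃ u ∈ c.getVert '' Set.Ico 0 j, ∃ w ∈ c.getVert '' Set.Ico k c.length,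
      G.Adj u w := by
    refine ⟨_, ⟨0, ⟨le_rfl, by omega⟩, rfl⟩, _,
      ⟨c.length - 1, ⟨by omega, by omega⟩, rfl⟩, ?_⟩
    have := hadj (c.length - 1) (by omega)
    rw [Nat.sub_add_cancel (by omega), Walk.getVert_length] at this
    simpa using this.symm
  have hsymm : ∀ {s t : Set V}, (∃ u ∈ s, ∃ w ∈ t, G.Adj u w) → ∃ u ∈ t, ∃ w ∈ s, G.Adj u w :=
    fun ⟨u, hu, w, hw, h⟩ => ⟨w, hw, u, hu, h.symm⟩
  refine ⟨![c.getVert '' Set.Ico 0 j, c.getVert '' Set.Ico j k,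
    c.getVert '' Set.Ico k c.length], ⟨?_, ?_, ?_⟩, ?_, ?_, ?_, ?_⟩
  · intro w
    fin_cases w
    · exact connected_induce_image_Ico (by omega) fun m _ _ => hadj m (by omega)
    · exact connected_induce_image_Ico (by omega) fun m _ _ => hadj m (by omega)
    · exact connected_induce_image_Ico (by omega) fun m _ _ => hadj m (by omega)
  · intro w₁ w₂ hne
    fin_cases w₁ <;> fin_cases w₂
    · exact absurd rfl hne
    · exact hd le_rfl (by omega)
    · exact hd (by omega) le_rfl
    · exact (hd le_rfl (by omega)).symm
    · exact absurd rfl hne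
    · exact hd le_rfl le_rfl
    · exact (hd (by omega) le_rfl).symm
    · exact (hd le_rfl le_rfl).symm
    · exact absurd rfl hne
  · intro w₁ w₂ hne
    fin_cases w₁ <;> fin_cases w₂
    · exact absurd rfl hne
    · exact hA (by omega) hjk (by omega)
    · exact hL
    · exact hsymm (hA (by omega) hjk (by omega))
    · exact absurd rfl hne
    · exact hA hjk hk le_rfl
    · exact hsymm hL
    · exact hsymm (hA hjk hk le_rfl)
    · exact absurd rfl hne
  · intro w
    fin_cases w <;> rintro _ ⟨m, -, rfl⟩ <;> exact c.getVert_mem_support m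
  · exact ⟨i, ⟨by omega, hij⟩, rfl⟩
  · exact ⟨j, ⟨le_rfl, hjk⟩, rfl⟩
  · exact ⟨k, ⟨le_rfl, hk⟩, rfl⟩

theorem SimpleGraph.Walk.IsCycle.exists_rooted_triangle {V : Type} {G : SimpleGraph V} {v : V}
    {c : G.Walk v v} (hc : c.IsCycle) {N : Finset V} (hN : 3 ≤ N.card)
    (hNc : ∀ x ∈ N, x ∈ c.support) :
    ∃ b : Fin 3 → Set V, IsCliqueModel G b ∧ (∀ w, b w ⊆ {x | x ∈ c.support}) ∧
      ∀ w, ∃ x ∈ b w, x ∈ N := by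
  classical
  have hidx : ∀ x ∈ N, ∃ m < c.length, c.getVert m = x := by
    intro x hx
    obtain ⟨m, hm, hle⟩ := Walk.mem_support_iff_exists_getVert.1 (hNc x hx)
    rcases hle.lt_or_eq with h | h
    · exact ⟨m, h, hm⟩
    · refine ⟨0, by have := hc.three_le_length; omega, ?_⟩
      rw [← hm, h]; simp
  let I : Finset ℕ := (Finset.range c.length).filter fun m => c.getVert m ∈ N
  have hI : 3 ≤ I.card := by
    refine hN.trans ((Finset.card_le_card (t := I.image c.getVert) fun x hx => ?_).trans
      Finset.card_image_le)
    obtain ⟨m, hm, rfl⟩ := hidx x hx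
    exact Finset.mem_image_of_mem _ (Finset.mem_filter.2 ⟨Finset.mem_range.2 hm, hx⟩)
  obtain ⟨J, hJI, hJ⟩ := Finset.exists_subset_card_eq hI
  let e := J.orderEmbOfFin hJ
  have he : ∀ w, e w < c.length ∧ c.getVert (e w) ∈ N := fun w => by
    simpa [I] using hJI (J.orderEmbOfFin_mem hJ w)
  obtain ⟨b, hb, hsub, h0, h1, h2⟩ := hc.exists_arcs
    (e.strictMono (show (0 : Fin 3) < 1 by decide))
    (e.strictMono (show (1 : Fin 3) < 2 by decide)) (he 2).1
  refine ⟨b, hb, hsub, fun w => ?_⟩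
  fin_cases w
  · exact ⟨_, h0, (he 0).2⟩
  · exact ⟨_, h1, (he 1).2⟩
  · exact ⟨_, h2, (he 2).2⟩

theorem not_isAcyclic_of_two_neighbors {V : Type} [Finite V] [Nontrivial V] {G : SimpleGraph V}
    (h : ∀ v w, v ≠ w → (∃ a b, a ≠ b ∧ G.Adj v a ∧ G.Adj v b) ∨
      ∃ a b, a ≠ b ∧ G.Adj w a ∧ G.Adj w b) : ¬ G.IsAcyclic := by
  intro hG
  obtain ⟨u, v, p, hp, hmax⟩ := Walk.exists_isPath_forall_isPath_length_le_length G
  have key : ∀ {u v : V} (p : G.Walk u v), p.IsPath →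
      (∀ (u' v' : V) (p' : G.Walk u' v'), p'.IsPath → p'.length ≤ p.length) →
      ∀ a b, a ≠ b → G.Adj u a → G.Adj u b → False := by
    intro u v p hp hmax a b hab ha hb
    have hmem : ∀ y, G.Adj u y → y = p.snd := by
      intro y hy
      refine hG.eq_snd_of_adj_start hp hy ?_
      by_contra hy'
      have := hmax _ _ (Walk.cons hy.symm p) ((Walk.cons_isPath_iff _ _).2 ⟨hp, hy'⟩)
      simp at this
    exact hab ((hmem a ha).trans (hmem b hb).symm)
  have huv : u ≠ v := by
    rintro rfl
    have hlen : p.length = 0 := by simp [Walk.isPath_iff_nil.1 hp]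
    obtain ⟨x, y, hxy⟩ := exists_pair_ne V
    have : ∃ z a, G.Adj z a := by
      rcases h x y hxy with ⟨a, _, _, ha, _⟩ | ⟨a, _, _, ha, _⟩
      exacts [⟨x, a, ha⟩, ⟨y, a, ha⟩]
    obtain ⟨z, a, hza⟩ := this
    have := hmax _ _ hza.toWalk (by simp [hza.ne])
    simp [hlen] at this
  rcases h u v huv with ⟨a, b, hab, ha, hb⟩ | ⟨a, b, hab, ha, hb⟩
  · exact key p hp hmax a b hab ha hb
  · exact key p.reverse hp.reverse (by simpa using hmax) a b hab ha hb

theorem exists_isCycle_subset {V : Type} [Finite V] {G : SimpleGraph V} {U : Set V}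
    (hU : U.Nontrivial)
    (h : ∀ v ∈ U, ∀ w ∈ U, v ≠ w →
      (∃ a ∈ U, ∃ b ∈ U, a ≠ b ∧ G.Adj v a ∧ G.Adj v b) ∨
        ∃ a ∈ U, ∃ b ∈ U, a ≠ b ∧ G.Adj w a ∧ G.Adj w b) :
    ∃ (v : V) (c : G.Walk v v), c.IsCycle ∧ ∀ x ∈ c.support, x ∈ U := by
  have : Nontrivial U := Set.nontrivial_coe_sort.2 hU
  have hU' : ¬ (G.induce U).IsAcyclic := by
    refine not_isAcyclic_of_two_neighbors fun v w hvw => ?_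
    refine (h v v.2 w w.2 (Subtype.coe_ne_coe.2 hvw)).imp ?_ ?_ <;>
    · rintro ⟨a, ha, b, hb, hab, h₁, h₂⟩
      exact ⟨⟨a, ha⟩, ⟨b, hb⟩, by simpa using hab, h₁, h₂⟩
  simp only [IsAcyclic, not_forall, not_not] at hU'
  obtain ⟨v, c, hc⟩ := hU'
  refine ⟨_, c.map (Embedding.induce (G := G) U).toHom, hc.map (Embedding.induce (G := G) U).injective, ?_⟩
  intro x hx
  rw [Walk.support_map, List.mem_map] at hx
  obtain ⟨y, -, rfl⟩ := hx
  exact y.2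

theorem exists_isCliqueModel_four_of_three_le {V : Type} [Finite V] (G : SimpleGraph V)
    [DecidableRel G.Adj] (A : Finset V) (hA : A.Nonempty)
    (hdeg : ∀ v ∈ A, 3 ≤ (A.filter (G.Adj v)).card) :
    ∃ b : Fin 4 → Set V, IsCliqueModel G b := by
  classical
  induction A using Finset.strongInduction with
  | H A ih =>
  let P : Finset V → Prop := fun S => (G.induce (S : Set V)).Connected ∧
    ∃ (v : V) (c : G.Walk v v), c.IsCycle ∧ ∀ x ∈ c.support, x ∈ A \ S
  have hpair : ∀ {T : Finset V}, 1 < T.card → ∃ a ∈ T, ∃ b ∈ T, a ≠ b := fun h =>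
    Finset.one_lt_card.1 h
  have hP : (A.powerset.filter P).Nonempty := by
    obtain ⟨v, hv⟩ := hA
    refine ⟨{v}, Finset.mem_filter.2 ⟨by simpa using hv, ?_, ?_⟩⟩
    · rw [Finset.coe_singleton]; simp
    · have hnb : ∀ w ∈ A, ∃ a ∈ A \ {v}, ∃ b ∈ A \ {v}, a ≠ b ∧ G.Adj w a ∧ G.Adj w b := by
        intro w hw
        have h1 := Finset.pred_card_le_card_erase (s := A.filter (G.Adj w)) (a := v)
        obtain ⟨a, ha, b, hb, hab⟩ := hpair
          (T := (A.filter (G.Adj w)).erase v) (by have := hdeg w hw; omega)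
        simp only [Finset.mem_erase, Finset.mem_filter] at ha hb
        exact ⟨a, by simp [ha], b, by simp [hb], hab, ha.2.2, hb.2.2⟩
      have := exists_isCycle_subset (G := G) (U := ((A \ {v} : Finset V) : Set V)) ?_ ?_
      · simpa using this
      · obtain ⟨a, ha, b, hb, hab, -⟩ := hnb v hv
        exact ⟨a, ha, b, hb, hab⟩
      · intro w hw _ _ _
        left
        simpa only [Finset.mem_coe] using hnb w (Finset.mem_sdiff.1 hw).1
  obtain ⟨S, hS, hmax⟩ := Finset.exists_max_image _ Finset.card hP
  obtain ⟨hSA, hScon, v, c, hc, hcU⟩ := Finset.mem_filter.1 hS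
  rw [Finset.mem_powerset] at hSA
  have hSne : S.Nonempty := by
    obtain ⟨⟨x, hx⟩⟩ := hScon.nonempty
    exact ⟨x, hx⟩
  let N : Finset V := (A \ S).filter fun x => ∃ s ∈ S, G.Adj s x
  have hmax' : ∀ x ∈ N, ¬ ∃ (v : V) (c : G.Walk v v), c.IsCycle ∧
      ∀ y ∈ c.support, y ∈ A \ insert x S := by
    intro x hx hcyc
    obtain ⟨hxA, s, hs, hsx⟩ := Finset.mem_filter.1 hx
    rw [Finset.mem_sdiff] at hxA
    have := hmax (insert x S) (Finset.mem_filter.2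
      ⟨Finset.mem_powerset.2 (Finset.insert_subset hxA.1 hSA), ?_, hcyc⟩)
    · rw [Finset.card_insert_of_notMem hxA.2] at this
      omega
    · rw [Finset.coe_insert]
      exact connected_induce_insert hScon hs hsx
  have hout : ∀ w ∈ A \ S, w ∉ N → A.filter (G.Adj w) ⊆ A \ S := by
    intro w hw hwN y hy
    rw [Finset.mem_filter] at hy
    refine Finset.mem_sdiff.2 ⟨hy.1, fun hyS => hwN (Finset.mem_filter.2 ⟨hw, y, hyS, hy.2.symm⟩)⟩
  by_cases hN3 : 3 ≤ N.card
  · have hNc : ∀ x ∈ N, x ∈ c.support := by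
      intro x hx
      by_contra hxc
      refine hmax' x hx ⟨v, c, hc, fun y hy => ?_⟩
      have hy' := Finset.mem_sdiff.1 (hcU y hy)
      refine Finset.mem_sdiff.2 ⟨hy'.1, ?_⟩
      rw [Finset.mem_insert]
      rintro (rfl | h)
      exacts [hxc hy, hy'.2 h]
    obtain ⟨b, hb, hbc, hbN⟩ := hc.exists_rooted_triangle hN3 hNc
    refine ⟨_, hb.cons hScon (fun i => Set.disjoint_left.2 fun x hx hxb =>
      (Finset.mem_sdiff.1 (hcU x (hbc i hxb))).2 hx) fun i => ?_⟩
    obtain ⟨x, hxb, hxN⟩ := hbN i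
    obtain ⟨-, s, hs, hsx⟩ := Finset.mem_filter.1 hxN
    exact ⟨s, hs, x, hxb, hsx⟩
  rcases N.eq_empty_or_nonempty with hN | ⟨x, hx⟩
  · refine ih (A \ S) (Finset.sdiff_ssubset hSA hSne) ⟨v, hcU v c.start_mem_support⟩ ?_
    intro w hw
    refine (hdeg w (Finset.mem_sdiff.1 hw).1).trans (Finset.card_le_card fun y hy => ?_)
    exact Finset.mem_filter.2 ⟨hout w hw (by simp [hN]) hy, (Finset.mem_filter.1 hy).2⟩
  · exfalso
    apply hmax' x hx
    have hF : A \ insert x S = (A \ S).erase x := by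
      ext y; simp; tauto
    have hcard : 3 ≤ (A \ S).card := by
      have h1 : c.support.tail.toFinset ⊆ A \ S := fun y hy =>
        hcU y (List.mem_of_mem_tail (List.mem_toFinset.1 hy))
      have h2 := Finset.card_le_card h1
      rw [List.toFinset_card_of_nodup hc.support_nodup, List.length_tail,
        Walk.length_support] at h2
      have := hc.three_le_length
      omega
    have := exists_isCycle_subset (G := G) (U := ((A \ insert x S : Finset V) : Set V)) ?_ ?_
    · simpa only [Finset.mem_coe] using this
    · rw [hF]
      have h1 := Finset.pred_card_le_card_erase (s := A \ S) (a := x)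
      obtain ⟨a, ha, b, hb, hab⟩ := hpair (T := (A \ S).erase x) (by omega)
      exact ⟨a, ha, b, hb, hab⟩
    · have hnb : ∀ w ∈ A \ insert x S, w ∉ N →
          ∃ a ∈ A \ insert x S, ∃ b ∈ A \ insert x S, a ≠ b ∧ G.Adj w a ∧ G.Adj w b := by
        intro w hw hwN
        rw [hF, Finset.mem_erase] at hw
        have h1 := Finset.pred_card_le_card_erase (s := A.filter (G.Adj w)) (a := x)
        have h2 := hdeg w (Finset.mem_sdiff.1 hw.2).1
        obtain ⟨a, ha, b, hb, hab⟩ := hpair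
          (T := (A.filter (G.Adj w)).erase x) (by omega)
        have hsub : (A.filter (G.Adj w)).erase x ⊆ A \ insert x S := by
          rw [hF]
          exact Finset.erase_subset_erase _ (hout w hw.2 hwN)
        exact ⟨a, hsub ha, b, hsub hb, hab,
          (Finset.mem_filter.1 (Finset.mem_of_mem_erase ha)).2,
          (Finset.mem_filter.1 (Finset.mem_of_mem_erase hb)).2⟩
      intro w hw w' hw' hne
      simp only [Finset.mem_coe] at hw hw' ⊢
      by_cases hwN : w ∈ N
      · by_cases hwN' : w' ∈ N
        · refine absurd ?_ hN3
          have hxw : x ≠ w := by rintro rfl; simp at hw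
          have hxw' : x ≠ w' := by rintro rfl; simp at hw'
          rw [← Finset.card_eq_three.2 ⟨x, w, w', hxw, hxw', hne, rfl⟩]
          exact Finset.card_le_card (by simp [Finset.insert_subset_iff, hx, hwN, hwN'])
        · exact Or.inr (hnb w' hw' hwN')
      · exact Or.inl (hnb w hw hwN)

theorem colorable_three_of_not_hasMinor {V : Type} [Finite V] {G : SimpleGraph V}
    (h : ¬ HasMinor G (⊤ : SimpleGraph (Fin 4))) : G.Colorable 3 := by
  classical
  have := Fintype.ofFinite V
  suffices H : ∀ A : Finset V, ∃ c : V → Fin 3, ∀ u ∈ A, ∀ v ∈ A, G.Adj u v → c u ≠ c v by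
    obtain ⟨c, hc⟩ := H Finset.univ
    exact ⟨Coloring.mk c fun {u v} huv => hc u (Finset.mem_univ u) v (Finset.mem_univ v) huv⟩
  intro A
  induction A using Finset.strongInduction with
  | H A ih =>
  rcases A.eq_empty_or_nonempty with rfl | hA
  · exact ⟨fun _ => 0, by simp⟩
  obtain ⟨v, hv, hdeg⟩ : ∃ v ∈ A, (A.filter (G.Adj v)).card < 3 := by
    by_contra! hcon
    obtain ⟨b, hb⟩ := exists_isCliqueModel_four_of_three_le G A hA hcon
    exact h hb.hasMinor
  obtain ⟨c, hc⟩ := ih (A.erase v) (Finset.erase_ssubset hv)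
  obtain ⟨k, hk⟩ : ∃ k, k ∉ (A.filter (G.Adj v)).image c := by
    by_contra! hcon
    have h1 := Finset.card_le_card (fun k _ => hcon k : (Finset.univ : Finset (Fin 3)) ⊆ _)
    have h2 := Finset.card_image_le (s := A.filter (G.Adj v)) (f := c)
    simp only [Finset.card_univ, Fintype.card_fin] at h1
    omega
  have hk' : ∀ w ∈ A, G.Adj v w → c w ≠ k := fun w hw hvw hck =>
    hk (Finset.mem_image.2 ⟨w, Finset.mem_filter.2 ⟨hw, hvw⟩, hck⟩)
  refine ⟨Function.update c v k, fun u hu w hw huw => ?_⟩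
  by_cases huv : u = v
  · subst huv
    rw [Function.update_self, Function.update_of_ne huw.ne']
    exact (hk' w hw huw).symm
  · by_cases hwv : w = v
    · subst hwv
      rw [Function.update_self, Function.update_of_ne huw.ne]
      exact hk' u hu huw.symm
    · rw [Function.update_of_ne huv, Function.update_of_ne hwv]
      exact hc u (Finset.mem_erase.2 ⟨huv, hu⟩) w (Finset.mem_erase.2 ⟨hwv, hw⟩) huw

theorem isTree_fromRel_of_lt {ι : Type} [LinearOrder ι] [OrderTop ι] [Finite ι] {p : ι → ι}
    (hp : ∀ i, i ≠ ⊤ → i < p i) : (fromRel fun i j => i ≠ ⊤ ∧ p i = j).IsTree := by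
  have hadj : ∀ i, i ≠ ⊤ → (fromRel fun i j => i ≠ ⊤ ∧ p i = j).Adj i (p i) := fun i hi =>
    (fromRel_adj _ _ _).2 ⟨(hp i hi).ne, Or.inl ⟨hi, rfl⟩⟩
  have hreach : ∀ i, (fromRel fun i j => i ≠ ⊤ ∧ p i = j).Reachable i ⊤ := by
    intro i
    induction i using WellFoundedGT.induction with
    | ind i ih =>
      by_cases hi : i = ⊤
      · rw [hi]
      · exact (hadj i hi).reachable.trans (ih (p i) (hp i hi))
  have hconn : (fromRel fun i j => i ≠ ⊤ ∧ p i = j).Connected :=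
    (connected_iff _).2 ⟨fun i j => (hreach i).trans (hreach j).symm, ⟨⊤⟩⟩
  refine isTree_iff_connected_and_card.2
    ⟨hconn, le_antisymm ?_ hconn.card_vert_le_card_edgeSet_add_one⟩
  have hsub : (fromRel fun i j => i ≠ ⊤ ∧ p i = j).edgeSet ⊆ (fun i => s(i, p i)) '' {⊤}ᶜ := by
    intro e
    induction e using Sym2.ind with
    | _ i j =>
      intro h
      rcases ((fromRel_adj _ _ _).1 ((mem_edgeSet _).1 h)).2 with ⟨hi, rfl⟩ | ⟨hj, rfl⟩
      · exact ⟨i, hi, rfl⟩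
      · exact ⟨j, hj, Sym2.eq_swap⟩
  have h1 := Set.ncard_le_ncard hsub (Set.toFinite _)
  have h2 := Set.ncard_image_le (s := ({⊤}ᶜ : Set ι)) (f := fun i => s(i, p i)) (Set.toFinite _)
  have h3 := Set.ncard_add_ncard_compl ({⊤} : Set ι)
  rw [Set.ncard_singleton] at h3
  rw [Nat.card_coe_set_eq]
  omega

/-- The vertices joined to `t` by a walk all of whose vertices are at most `t`. -/
def lowerComponent {V : Type} [LinearOrder V] (G : SimpleGraph V) (t : V) : Set V :=
  {u | ∃ p : G.Walk t u, ∀ x ∈ p.support, x ≤ t}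

/-- The vertices greater than `t` with a neighbour in the lower component of `t`. -/
def upperNeighbors {V : Type} [LinearOrder V] (G : SimpleGraph V) (t : V) : Set V :=
  {u | t < u ∧ ∃ x ∈ lowerComponent G t, G.Adj x u}

section LowerComponent

variable {V : Type} [LinearOrder V] {G : SimpleGraph V}

theorem self_mem_lowerComponent (t : V) : t ∈ lowerComponent G t :=
  ⟨Walk.nil, by simp⟩

theorem le_of_mem_lowerComponent {t u : V} (h : u ∈ lowerComponent G t) : u ≤ t := by
  obtain ⟨p, hp⟩ := h
  exact hp u p.end_mem_support

theorem connected_lowerComponent (t : V) : (G.induce (lowerComponent G t)).Connected := by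
  refine induce_connected_of_patches t (self_mem_lowerComponent t) ?_
  rintro u ⟨p, hp⟩
  refine ⟨{x | x ∈ p.support}, fun x hx => ?_, p.start_mem_support, p.end_mem_support,
    p.connected_induce_support.preconnected _ _⟩
  exact ⟨p.takeUntil x hx, fun y hy => hp y (p.support_takeUntil_subset_support hx hy)⟩

theorem lowerComponent_subset {t w : V} (h : w ∈ upperNeighbors G t) :
    lowerComponent G t ⊆ lowerComponent G w := by
  obtain ⟨htw, x, ⟨p, hp⟩, hxw⟩ := h
  rintro u ⟨q, hq⟩
  refine ⟨(Walk.cons hxw.symm p.reverse).append q, fun y hy => ?_⟩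
  rw [Walk.mem_support_append_iff, Walk.support_cons, List.mem_cons, Walk.support_reverse,
    List.mem_reverse] at hy
  rcases hy with (rfl | hy) | hy
  exacts [le_rfl, (hp y hy).trans htw.le, (hq y hy).trans htw.le]

theorem colorable_insert_upperNeighbors [Finite V]
    (h5 : ¬ HasMinor G (⊤ : SimpleGraph (Fin 5))) (t : V) :
    (G.induce (insert t (upperNeighbors G t))).Colorable 4 := by
  have h3 : (G.induce (upperNeighbors G t)).Colorable 3 := by
    refine colorable_three_of_not_hasMinor fun h4 => ?_
    obtain ⟨b, hb⟩ := h4.exists_isCliqueModel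
    refine h5 (hb.image_val.cons (connected_lowerComponent t) (fun i => ?_) fun i => ?_).hasMinor
    · rw [Set.disjoint_left]
      rintro _ hx ⟨y, -, rfl⟩
      exact y.2.1.not_ge (le_of_mem_lowerComponent hx)
    · obtain ⟨⟨y, hy⟩⟩ := (hb.1 i).nonempty
      obtain ⟨x, hx, hxy⟩ := y.2.2
      exact ⟨x, hx, y, ⟨y, hy, rfl⟩, hxy⟩
  classical
  obtain ⟨c⟩ := h3
  have hmem : ∀ x : ↥(insert t (upperNeighbors G t)), x.1 ≠ t → x.1 ∈ upperNeighbors G t :=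
    fun x hx => x.2.resolve_left hx
  refine ⟨Coloring.mk
    (fun x => if hx : x.1 = t then Fin.last 3 else (c ⟨x.1, hmem x hx⟩).castSucc) ?_⟩
  intro x y hxy
  have hxy' : G.Adj x.1 y.1 := hxy
  by_cases hx : x.1 = t
  · have hy : y.1 ≠ t := fun hy => hxy'.ne (hx.trans hy.symm)
    rw [dif_pos hx, dif_neg hy]
    exact (Fin.castSucc_lt_last _).ne'
  · by_cases hy : y.1 = t
    · rw [dif_neg hx, dif_pos hy]
      exact (Fin.castSucc_lt_last _).ne
    · rw [dif_neg hx, dif_neg hy]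
      exact fun h => c.valid (v := ⟨x.1, hmem x hx⟩) (w := ⟨y.1, hmem y hy⟩) hxy'
        (Fin.castSucc_injective _ h)

theorem exists_parent [Finite V] (G : SimpleGraph V) (i : WithTop V) :
    ∃ j : WithTop V, (i ≠ ⊤ → i < j) ∧ ∀ t : V, i = t → (upperNeighbors G t).Nonempty →
      ∃ w ∈ upperNeighbors G t, j = w ∧ ∀ u ∈ upperNeighbors G t, w ≤ u := by
  induction i using WithTop.recTopCoe with
  | top => exact ⟨⊤, fun h => absurd rfl h, fun t ht => absurd ht.symm (WithTop.coe_ne_top)⟩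
  | coe s =>
    by_cases hs : (upperNeighbors G s).Nonempty
    · obtain ⟨w, hw, hmin⟩ := Set.exists_min_image _ id (Set.toFinite _) hs
      refine ⟨w, fun _ => WithTop.coe_lt_coe.2 hw.1, fun t ht _ => ?_⟩
      rw [WithTop.coe_inj] at ht
      subst ht
      exact ⟨w, hw, rfl, hmin⟩
    · refine ⟨⊤, fun _ => WithTop.coe_lt_top s, fun t ht hne => ?_⟩
      rw [WithTop.coe_inj] at ht
      subst ht
      exact absurd hne hs

/-- The bag of the elimination decomposition at a node. -/
def eliminationBag (G : SimpleGraph V) (i : WithTop V) : Set V :=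
  {u | ∃ t : V, i = t ∧ u ∈ insert t (upperNeighbors G t)}

theorem eliminationBag_coe (t : V) :
    eliminationBag G t = insert t (upperNeighbors G t) := by
  ext u
  simp only [eliminationBag, Set.mem_ofPred_eq]
  constructor
  · rintro ⟨s, hs, hu⟩
    rw [WithTop.coe_inj] at hs
    exact hs ▸ hu
  · exact fun hu => ⟨t, rfl, hu⟩

theorem eliminationBag_top : eliminationBag G ⊤ = ∅ :=
  Set.eq_empty_of_forall_notMem fun _ ⟨_, hs, _⟩ => WithTop.coe_ne_top hs.symm

theorem exists_treeDecomp_bag_eq [Finite V] (G : SimpleGraph V) :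
    ∃ D : TreeDecomp G, ∀ i, D.bag i = ∅ ∨ ∃ t, D.bag i = insert t (upperNeighbors G t) := by
  choose p hp hp' using exists_parent G
  refine ⟨⟨WithTop V, inferInstanceAs (Finite (Option V)), _, isTree_fromRel_of_lt hp,
    eliminationBag G, ?_, ?_⟩, ?_⟩
  · intro u v huv
    rcases lt_or_gt_of_ne huv.ne with h | h
    · refine ⟨u, ?_⟩
      rw [eliminationBag_coe]
      exact ⟨Or.inl rfl, Or.inr ⟨h, u, self_mem_lowerComponent u, huv⟩⟩
    · refine ⟨v, ?_⟩
      rw [eliminationBag_coe]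
      exact ⟨Or.inr ⟨h, v, self_mem_lowerComponent v, huv.symm⟩, Or.inl rfl⟩
  · intro v
    have hv : v ∈ eliminationBag G (v : WithTop V) := by
      rw [eliminationBag_coe]; exact Or.inl rfl
    rw [connected_iff_exists_forall_reachable]
    refine ⟨⟨v, hv⟩, ?_⟩
    rintro ⟨i, hi⟩
    obtain ⟨t, rfl, hvt⟩ := hi
    apply Reachable.symm
    induction t using WellFoundedGT.induction with
    | ind t ih =>
      rcases hvt with rfl | hvt
      · rfl
      · obtain ⟨w, hw, hpw, hmin⟩ := hp' t t rfl ⟨v, hvt⟩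
        have hvw : v ∈ insert w (upperNeighbors G w) := by
          rcases (hmin v hvt).eq_or_lt with h | h
          · exact Or.inl h.symm
          · obtain ⟨x, hx, hxv⟩ := hvt.2
            exact Or.inr ⟨h, x, lowerComponent_subset hw hx, hxv⟩
        refine Reachable.trans (Adj.reachable ?_) (ih w hw.1 hvw)
        refine (fromRel_adj (fun i j => i ≠ ⊤ ∧ p i = j) _ _).2 ⟨?_, Or.inl ⟨WithTop.coe_ne_top, hpw⟩⟩
        exact (WithTop.coe_lt_coe.2 hw.1).ne
  · intro i
    induction i using WithTop.recTopCoe with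
    | top => exact Or.inl eliminationBag_top
    | coe t => exact Or.inr ⟨t, eliminationBag_coe t⟩

end LowerComponent

/-- Every graph with no `K_5`-minor has tree-chromatic number at
most `4`. -/
theorem stmt12 {V : Type} [Fintype V] (G : SimpleGraph V)
    (h5 : ¬ HasMinor G (⊤ : SimpleGraph (Fin 5))) :
    treeChi G ≤ 4 := by
  classical
  let _ : LinearOrder V :=
    LinearOrder.lift' (Fintype.equivFin V) (Fintype.equivFin V).injective
  obtain ⟨D, hD⟩ := exists_treeDecomp_bag_eq G
  refine (Nat.sInf_le ⟨D, rfl⟩ : treeChi G ≤ D.chrom).trans ?_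
  obtain ⟨i₀⟩ := D.isTree.connected.nonempty
  refine csSup_le ⟨_, i₀, rfl⟩ ?_
  rintro _ ⟨i, rfl⟩
  refine Nat.sInf_le ?_
  rcases hD i with h | ⟨t, h⟩
  · rw [h]
    exact Colorable.of_isEmpty _
  · rw [h]
    exact colorable_insert_upperNeighbors h5 t
end
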